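/- Let X be a projective variety over an infinite field k, φ: X → X a morphism, and L an ample line bundle on X such that φ*(L) ≅ L^{⊗d} for some d ≥ 1. Then there exist an integer N, a closed embedding ι: X → P^N_k, and a morphism ψ: P^N_k → P^N_k such that ψ ∘ ι = ι ∘ φ. -/

import Mathlib

open AlgebraicGeometry CategoryTheory CategoryTheory.Limits Opposite

noncomputable section

universe u

/-- Restriction of sections of the structure sheaf, as a ring homomorphism. -/
def sres (X : Scheme.{u}) {V W : X.Opens} (h : V ≤ W) : Γ(X, W) →+* Γ(X, V) :=
  (X.presheaf.map (homOfLE h).op : Γ(X, W) ⟶ Γ(X, V)).hom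

lemma sres_sres (X : Scheme.{u}) {V W T : X.Opens} (h₁ : V ≤ W) (h₂ : W ≤ T) (a : Γ(X, T)) :
    sres X h₁ (sres X h₂ a) = sres X (h₁.trans h₂) a := by
  have : (homOfLE (h₁.trans h₂)).op = (homOfLE h₂).op ≫ (homOfLE h₁).op := rfl
  simp only [sres, this, Functor.map_comp]
  rfl

/-- A line bundle (invertible sheaf) on a scheme `X`, presented by an open cover and a
Čech `1`-cocycle of transition units. -/
structure LineBundle (X : Scheme.{u}) where
  ι : Type u
  U : ι → X.Opens
  covers : iSup U = ⊤
  t : ∀ i j, (Γ(X, U i ⊓ U j))ˣ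
  cocycle : ∀ i j l,
    Units.map (sres X (show U i ⊓ U j ⊓ U l ≤ U i ⊓ U j from inf_le_left)).toMonoidHom (t i j)
      * Units.map (sres X (show U i ⊓ U j ⊓ U l ≤ U j ⊓ U l from
          le_inf (inf_le_left.trans inf_le_right) inf_le_right)).toMonoidHom (t j l)
    = Units.map (sres X (show U i ⊓ U j ⊓ U l ≤ U i ⊓ U l from
          le_inf (inf_le_left.trans inf_le_left) inf_le_right)).toMonoidHom (t i l)

namespace LineBundle

variable {X Y : Scheme.{u}}

/-- The `n`-th tensor power of a line bundle. -/
def pow (L : LineBundle X) (n : ℕ) : LineBundle X where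
  ι := L.ι
  U := L.U
  covers := L.covers
  t i j := L.t i j ^ n
  cocycle i j l := by
    simp only [map_pow, ← mul_pow, L.cocycle i j l]

/-- The dual (inverse) of a line bundle. -/
def dual (L : LineBundle X) : LineBundle X where
  ι := L.ι
  U := L.U
  covers := L.covers
  t i j := (L.t i j)⁻¹
  cocycle i j l := by
    simp only [map_inv, ← mul_inv, L.cocycle i j l]

/-- The trivial line bundle. -/
def trivial (X : Scheme.{u}) : LineBundle X where
  ι := PUnit
  U _ := ⊤
  covers := by simp
  t _ _ := 1
  cocycle _ _ _ := by simp

lemma unit_sres_sres (X : Scheme.{u}) {V W T : X.Opens} (h₁ : V ≤ W) (h₂ : W ≤ T)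
    (u : (Γ(X, T))ˣ) :
    Units.map (sres X h₁).toMonoidHom (Units.map (sres X h₂).toMonoidHom u)
      = Units.map (sres X (h₁.trans h₂)).toMonoidHom u := by
  ext
  exact sres_sres X h₁ h₂ u

/-- The tensor product of two line bundles. -/
def tensor (L M : LineBundle X) : LineBundle X where
  ι := L.ι × M.ι
  U p := L.U p.1 ⊓ M.U p.2
  covers := by
    apply le_antisymm le_top
    have h : (⊤ : X.Opens) = (⨆ i, L.U i) ⊓ ⨆ j, M.U j := by
      rw [L.covers, M.covers, top_inf_eq]
    rw [h, iSup_inf_eq]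
    refine iSup_le fun i => ?_
    rw [inf_iSup_eq]
    exact iSup_le fun j => le_iSup_of_le (i, j) le_rfl
  t p q :=
    Units.map (sres X (show (L.U p.1 ⊓ M.U p.2) ⊓ (L.U q.1 ⊓ M.U q.2) ≤ L.U p.1 ⊓ L.U q.1 from
        le_inf (inf_le_left.trans inf_le_left) (inf_le_right.trans inf_le_left))).toMonoidHom
      (L.t p.1 q.1) *
    Units.map (sres X (show (L.U p.1 ⊓ M.U p.2) ⊓ (L.U q.1 ⊓ M.U q.2) ≤ M.U p.2 ⊓ M.U q.2 from
        le_inf (inf_le_left.trans inf_le_right) (inf_le_right.trans inf_le_right))).toMonoidHom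
      (M.t p.2 q.2)
  cocycle p q r := by
    simp only [map_mul, unit_sres_sres]
    have hL := congrArg (Units.map (sres X (show
        (L.U p.1 ⊓ M.U p.2) ⊓ (L.U q.1 ⊓ M.U q.2) ⊓ (L.U r.1 ⊓ M.U r.2) ≤
          L.U p.1 ⊓ L.U q.1 ⊓ L.U r.1 from
        le_inf (le_inf (inf_le_left.trans (inf_le_left.trans inf_le_left))
          (inf_le_left.trans (inf_le_right.trans inf_le_left)))
          (inf_le_right.trans inf_le_left))).toMonoidHom) (L.cocycle p.1 q.1 r.1)
    have hM := congrArg (Units.map (sres X (show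
        (L.U p.1 ⊓ M.U p.2) ⊓ (L.U q.1 ⊓ M.U q.2) ⊓ (L.U r.1 ⊓ M.U r.2) ≤
          M.U p.2 ⊓ M.U q.2 ⊓ M.U r.2 from
        le_inf (le_inf (inf_le_left.trans (inf_le_left.trans inf_le_right))
          (inf_le_left.trans (inf_le_right.trans inf_le_right)))
          (inf_le_right.trans inf_le_right))).toMonoidHom) (M.cocycle p.2 q.2 r.2)
    simp only [map_mul, unit_sres_sres] at hL hM
    rw [mul_mul_mul_comm, hL, hM]

lemma preimage_mono (f : X ⟶ Y) {U U' : Y.Opens} (h : U ≤ U') : f ⁻¹ᵁ U ≤ f ⁻¹ᵁ U' :=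
  fun _ hx => h hx

lemma unit_sres_appLE (f : X ⟶ Y) {U : Y.Opens} {V V' : X.Opens} (e : V ≤ f ⁻¹ᵁ U)
    (h : V' ≤ V) (u : (Γ(Y, U))ˣ) :
    Units.map (sres X h).toMonoidHom (Units.map (f.appLE U V e).hom.toMonoidHom u)
      = Units.map (f.appLE U V' (h.trans e)).hom.toMonoidHom u := by
  ext
  show sres X h (f.appLE U V e u) = f.appLE U V' (h.trans e) u
  rw [show f.appLE U V' (h.trans e)
      = f.appLE U V e ≫ X.presheaf.map (homOfLE h).op from (f.appLE_map e (homOfLE h).op).symm]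
  rfl

lemma unit_appLE_sres (f : X ⟶ Y) {U U' : Y.Opens} {V : X.Opens} (e : V ≤ f ⁻¹ᵁ U)
    (h : U ≤ U') (u : (Γ(Y, U'))ˣ) :
    Units.map (f.appLE U V e).hom.toMonoidHom (Units.map (sres Y h).toMonoidHom u)
      = Units.map (f.appLE U' V (e.trans (preimage_mono f h))).hom.toMonoidHom u := by
  ext
  show f.appLE U V e (sres Y h u) = f.appLE U' V _ u
  rw [show f.appLE U' V (e.trans (preimage_mono f h))
      = Y.presheaf.map (homOfLE h).op ≫ f.appLE U V e from (f.map_appLE e (homOfLE h).op).symm]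
  rfl

lemma preimage_inf (f : X ⟶ Y) (U V : Y.Opens) :
    f ⁻¹ᵁ (U ⊓ V) = f ⁻¹ᵁ U ⊓ f ⁻¹ᵁ V := by
  ext x; simp

set_option maxHeartbeats 1000000 in
/-- The pullback of a line bundle along a morphism of schemes. -/
def pullbackLB (f : X ⟶ Y) (L : LineBundle Y) : LineBundle X where
  ι := L.ι
  U i := f ⁻¹ᵁ L.U i
  covers := by
    have : (⨆ i, f ⁻¹ᵁ L.U i) = f ⁻¹ᵁ (⨆ i, L.U i) := by
      ext x
      simp [TopologicalSpace.Opens.mem_iSup]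
    rw [this, L.covers]
    rfl
  t i j :=
    Units.map (f.appLE (L.U i ⊓ L.U j) (f ⁻¹ᵁ L.U i ⊓ f ⁻¹ᵁ L.U j)
      (preimage_inf f (L.U i) (L.U j)).ge).hom.toMonoidHom (L.t i j)
  cocycle i j l := by
    have key := congrArg (Units.map (f.appLE (L.U i ⊓ L.U j ⊓ L.U l)
        (f ⁻¹ᵁ L.U i ⊓ f ⁻¹ᵁ L.U j ⊓ f ⁻¹ᵁ L.U l)
        (le_of_eq (show f ⁻¹ᵁ L.U i ⊓ f ⁻¹ᵁ L.U j ⊓ f ⁻¹ᵁ L.U l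
            = f ⁻¹ᵁ (L.U i ⊓ L.U j ⊓ L.U l) by
          rw [preimage_inf, preimage_inf]))).hom.toMonoidHom)
      (L.cocycle i j l)
    rw [map_mul] at key
    rw [unit_sres_appLE, unit_sres_appLE, unit_sres_appLE]
    rw [unit_appLE_sres, unit_appLE_sres, unit_appLE_sres] at key
    exact key

/-- A global section of a line bundle: compatible local sections with respect to the
transition cocycle. -/
@[ext]
structure GlobalSec {X : Scheme.{u}} (L : LineBundle X) where
  s : ∀ i, Γ(X, L.U i)
  compat : ∀ i j, sres X (inf_le_left : L.U i ⊓ L.U j ≤ L.U i) (s i)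
    = (L.t i j : Γ(X, L.U i ⊓ L.U j)) * sres X inf_le_right (s j)

/-- The open locus where a global section of a line bundle does not vanish. -/
def GlobalSec.locus {X : Scheme.{u}} {L : LineBundle X} (σ : GlobalSec L) : X.Opens :=
  ⨆ i, X.basicOpen (σ.s i)

/-- A line bundle `L` on a scheme `X` is ample if `X` is quasi-compact and every point has
an affine neighbourhood of the form `X_s` for a global section `s` of some positive tensor
power of `L`. -/
def IsAmple {X : Scheme.{u}} (L : LineBundle X) : Prop :=
  CompactSpace X ∧ ∀ x : X, ∃ (m : ℕ) (_ : 0 < m) (σ : GlobalSec (L.pow m)),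
    x ∈ σ.locus ∧ IsAffineOpen σ.locus

/-- Two line bundles are isomorphic iff on a common refinement of their trivialising covers
their transition cocycles differ by a coboundary. -/
def EquivLB {X : Scheme.{u}} (L M : LineBundle X) : Prop :=
  ∃ (κ : Type u) (V : κ → X.Opens) (_ : iSup V = ⊤) (a : κ → L.ι) (b : κ → M.ι)
    (ha : ∀ c, V c ≤ L.U (a c)) (hb : ∀ c, V c ≤ M.U (b c)) (s : ∀ c, (Γ(X, V c))ˣ),
    ∀ c c' : κ,
      Units.map (sres X (le_inf ((inf_le_left.trans (ha c)))
          (inf_le_right.trans (ha c')) : V c ⊓ V c' ≤ L.U (a c) ⊓ L.U (a c'))).toMonoidHom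
          (L.t (a c) (a c'))
        * Units.map (sres X (inf_le_right : V c ⊓ V c' ≤ V c')).toMonoidHom (s c')
      = Units.map (sres X (inf_le_left : V c ⊓ V c' ≤ V c)).toMonoidHom (s c)
        * Units.map (sres X (le_inf ((inf_le_left.trans (hb c)))
            (inf_le_right.trans (hb c')))).toMonoidHom (M.t (b c) (b c'))

/-- The canonical algebra map `k → Γ(X, U)` for a scheme `X` over `Spec k`. -/
def toSections {k : Type u} [Field k] {X : Scheme.{u}} (sX : X ⟶ Spec (CommRingCat.of k))
    (U : X.Opens) : k →+* Γ(X, U) :=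
  ((sres X (le_top : U ≤ ⊤)).comp
    ((sX.appTop.hom : Γ(Spec (CommRingCat.of k), ⊤) →+* Γ(X, ⊤)))).comp
    ((Scheme.ΓSpecIso (CommRingCat.of k)).inv : CommRingCat.of k ⟶ _).hom

lemma sres_toSections {k : Type u} [Field k] {X : Scheme.{u}}
    (sX : X ⟶ Spec (CommRingCat.of k)) {V U : X.Opens} (h : V ≤ U) (c : k) :
    sres X h (toSections sX U c) = toSections sX V c := by
  simp only [toSections, RingHom.comp_apply, sres_sres]

/-- The space of global sections of a line bundle on a scheme over `k`, as a `k`-submodule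
of the product of the local section spaces. -/
def secSubmodule {k : Type u} [Field k] {X : Scheme.{u}} (sX : X ⟶ Spec (CommRingCat.of k))
    (L : LineBundle X) :
    letI : ∀ i, Module k Γ(X, L.U i) := fun i => (toSections sX (L.U i)).toModule
    Submodule k (∀ i, Γ(X, L.U i)) :=
  letI : ∀ i, Module k Γ(X, L.U i) := fun i => (toSections sX (L.U i)).toModule
  { carrier := {s | ∀ i j, sres X (inf_le_left : L.U i ⊓ L.U j ≤ L.U i) (s i)
      = (L.t i j : Γ(X, L.U i ⊓ L.U j)) * sres X inf_le_right (s j)}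
    add_mem' := by
      intro s r hs hr i j
      simp only [Pi.add_apply, map_add, hs i j, hr i j, mul_add]
    zero_mem' := by
      intro i j
      simp
    smul_mem' := by
      intro c s hs i j
      show sres X _ (toSections sX (L.U i) c * s i)
        = (L.t i j : Γ(X, L.U i ⊓ L.U j)) * sres X _ (toSections sX (L.U j) c * s j)
      rw [map_mul, map_mul, hs i j, sres_toSections, sres_toSections]
      ring }

/-- The dimension `h⁰(X, L)` of the space of global sections of a line bundle on a scheme
over a field `k`. -/
def h0 {k : Type u} [Field k] {X : Scheme.{u}} (sX : X ⟶ Spec (CommRingCat.of k))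
    (L : LineBundle X) : ℕ :=
  letI : ∀ i, Module k Γ(X, L.U i) := fun i => (toSections sX (L.U i)).toModule
  Module.finrank k (secSubmodule sX L)

lemma sres_appLE (f : X ⟶ Y) {U : Y.Opens} {V V' : X.Opens} (e : V ≤ f ⁻¹ᵁ U)
    (h : V' ≤ V) (a : Γ(Y, U)) :
    sres X h (f.appLE U V e a) = f.appLE U V' (h.trans e) a := by
  rw [show f.appLE U V' (h.trans e)
      = f.appLE U V e ≫ X.presheaf.map (homOfLE h).op from (f.appLE_map e (homOfLE h).op).symm]
  rfl

lemma appLE_sres (f : X ⟶ Y) {U U' : Y.Opens} {V : X.Opens} (e : V ≤ f ⁻¹ᵁ U)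
    (h : U ≤ U') (a : Γ(Y, U')) :
    f.appLE U V e (sres Y h a) = f.appLE U' V (e.trans (preimage_mono f h)) a := by
  rw [show f.appLE U' V (e.trans (preimage_mono f h))
      = Y.presheaf.map (homOfLE h).op ≫ f.appLE U V e from (f.map_appLE e (homOfLE h).op).symm]
  rfl

/-- Pullback of global sections of a line bundle. -/
def pullbackSec (f : X ⟶ Y) (L : LineBundle Y) (σ : GlobalSec L) :
    GlobalSec (pullbackLB f L) where
  s i := f.app (L.U i) (σ.s i)
  compat i j := by
    have key := congrArg (f.appLE (L.U i ⊓ L.U j)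
      (f ⁻¹ᵁ L.U i ⊓ f ⁻¹ᵁ L.U j) (preimage_inf f (L.U i) (L.U j)).ge) (σ.compat i j)
    rw [map_mul, appLE_sres, appLE_sres] at key
    exact key

end LineBundle

attribute [local instance] MvPolynomial.gradedAlgebra

/-- Projective `N`-space over `k`, as the `Proj` of the polynomial ring in `N + 1`
variables with its standard grading. -/
def ProjSpace (k : Type u) [Field k] (N : ℕ) : Scheme.{u} :=
  Proj (MvPolynomial.homogeneousSubmodule (Fin (N + 1)) k)

/-- The inclusion of `k` into the degree-zero part of the polynomial ring. -/
def degreeZeroInclusion (k : Type u) [Field k] (N : ℕ) :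
    k →+* (MvPolynomial.homogeneousSubmodule (Fin (N + 1)) k 0) where
  toFun c := ⟨MvPolynomial.C c, by
    simp [MvPolynomial.mem_homogeneousSubmodule, MvPolynomial.isHomogeneous_C]⟩
  map_one' := by ext; simp
  map_mul' x y := by ext; simp
  map_zero' := by ext; simp
  map_add' x y := by ext; simp

/-- The structure morphism of projective space over `k`. -/
def ProjSpace.str (k : Type u) [Field k] (N : ℕ) :
    ProjSpace k N ⟶ Spec (CommRingCat.of k) :=
  Proj.toSpecZero _ ≫ Spec.map (CommRingCat.ofHom (degreeZeroInclusion k N))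

/-- A scheme over `k` is a projective variety if it is integral and admits a closed
immersion into some projective space over `k`, compatibly with the structure morphisms. -/
def IsProjectiveVariety {k : Type u} [Field k] {X : Scheme.{u}}
    (sX : X ⟶ Spec (CommRingCat.of k)) : Prop :=
  IsIntegral X ∧ ∃ (N : ℕ) (ι : X ⟶ ProjSpace k N),
    IsClosedImmersion ι ∧ ι ≫ ProjSpace.str k N = sX

section

/-- A field `K` over `k` with a family of subalgebras `reg x` (local rings of points) and
nonzero elements `τ x` (local trivialisations of a line bundle), such that every valuation
ring of `K` over `k` contains some `reg x`. -/
structure PointData (k K P : Type*) [Field k] [Field K] [Algebra k K] where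
  reg : P → Subalgebra k K
  τ : P → K
  τ_ne : ∀ x, τ x ≠ 0
  exists_le : ∀ V : ValuationSubring K, (∀ c : k, algebraMap k K c ∈ V) → ∃ x, ∀ f ∈ reg x, f ∈ V

namespace PointData

variable {k K P : Type*} [Field k] [Field K] [Algebra k K] (D : PointData k K P)

/-- The sections of the `m`-th power of the line bundle. -/
def S (m : ℕ) : Submodule k K where
  carrier := {σ | ∀ x, D.τ x ^ m * σ ∈ D.reg x}
  add_mem' ha hb x := by rw [mul_add]; exact add_mem (ha x) (hb x)
  zero_mem' x := by simp
  smul_mem' c σ h x := by rw [mul_smul_comm]; exact (D.reg x).smul_mem (h x) c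

theorem mem_S {m : ℕ} {σ : K} : σ ∈ D.S m ↔ ∀ x, D.τ x ^ m * σ ∈ D.reg x := Iff.rfl

/-- A section of the `m`-th power of the line bundle does not vanish at a point. -/
def NonvanAt (m : ℕ) (σ : K) (x : P) : Prop := σ ≠ 0 ∧ (D.τ x ^ m * σ)⁻¹ ∈ D.reg x

theorem mul_mem_S {m n : ℕ} {a b : K} (ha : a ∈ D.S m) (hb : b ∈ D.S n) : a * b ∈ D.S (m + n) :=
  fun x => by
    rw [pow_add, mul_mul_mul_comm]
    exact mul_mem (ha x) (hb x)

theorem one_mem_S : (1 : K) ∈ D.S 0 := fun x => by simp [one_mem]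

theorem pow_mem_S {m : ℕ} {a : K} (ha : a ∈ D.S m) (n : ℕ) : a ^ n ∈ D.S (m * n) := fun x => by
  rw [pow_mul, ← mul_pow]
  exact pow_mem (ha x) n

theorem prod_mem_S {ι : Type*} (s : Finset ι) {m : ι → ℕ}
    {a : ι → K} (ha : ∀ i ∈ s, a i ∈ D.S (m i)) :
    ∏ i ∈ s, a i ∈ D.S (∑ i ∈ s, m i) := fun x => by
  rw [← Finset.prod_pow_eq_pow_sum, ← Finset.prod_mul_distrib]
  exact prod_mem fun i hi => ha i hi x

theorem NonvanAt.pow {m : ℕ} {a : K} {x : P} (ha : D.NonvanAt m a x) (n : ℕ) :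
    D.NonvanAt (m * n) (a ^ n) x :=
  ⟨pow_ne_zero _ ha.1, by
    rw [pow_mul, ← mul_pow, ← inv_pow]
    exact pow_mem ha.2 n⟩

open Polynomial

/-- A valuation of `K(X)` is bounded on sections by its value on a base point free family. -/
theorem exists_valuation_bound {F : Type*} [Field F] [Algebra K[X] F]
    (V : ValuationSubring F) (hk : ∀ c : k, algebraMap K[X] F (C (algebraMap k K c)) ∈ V)
    {ι : Type*} (b : ι → K) {e : ℕ}
    (hb : ∀ i, b i ∈ D.S e) (hbpf : ∀ x, ∃ i, D.NonvanAt e (b i) x) :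
    ∃ γ, (∃ i, V.valuation (algebraMap K[X] F (C (b i) * X ^ e)) = γ ^ e) ∧
      ∀ m, ∀ σ ∈ D.S m, V.valuation (algebraMap K[X] F (C σ * X ^ m)) ≤ γ ^ m := by
  let f : K →+* F := (algebraMap K[X] F).comp C
  obtain ⟨x, hx⟩ := D.exists_le (V.comap f) hk
  have hτ : f (D.τ x) ≠ 0 := (map_ne_zero f).2 (D.τ_ne x)
  have key : ∀ m σ, algebraMap K[X] F (C σ * X ^ m) =
      f (D.τ x ^ m * σ) * (algebraMap K[X] F X / f (D.τ x)) ^ m := fun m σ => by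
    rw [map_mul, map_mul, map_pow, map_pow, div_pow, mul_comm (f (D.τ x) ^ m), mul_assoc,
      mul_div_cancel₀ _ (pow_ne_zero m hτ)]
    rfl
  refine ⟨V.valuation (algebraMap K[X] F X / f (D.τ x)), ?_, fun m σ hσ => ?_⟩
  · obtain ⟨i, hi0, hi⟩ := hbpf x
    refine ⟨i, ?_⟩
    rw [key, map_mul, map_pow]
    have h1 : V.valuation (f (D.τ x ^ e * b i)) ≤ 1 := (V.valuation_le_one_iff _).2 (hx _ (hb i x))
    have h2 : V.valuation (f (D.τ x ^ e * b i)⁻¹) ≤ 1 := (V.valuation_le_one_iff _).2 (hx _ hi)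
    have h3 : V.valuation (f (D.τ x ^ e * b i)) = 1 := by
      refine le_antisymm h1 ?_
      rw [map_inv₀] at h2
      refine (inv_le_one₀ ?_).1 (by rwa [map_inv₀] at h2)
      rw [zero_lt_iff, Valuation.ne_zero_iff]
      exact (map_ne_zero f).2 (mul_ne_zero (pow_ne_zero _ (D.τ_ne x)) hi0)
    rw [h3, one_mul]
  · rw [key, map_mul, map_pow]
    exact mul_le_of_le_one_left' ((V.valuation_le_one_iff _).2 (hx _ (hσ x)))

theorem isIntegral_of_basePointFree {ι : Type*} (b : ι → K) {e : ℕ} (he : e ≠ 0)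
    (hb : ∀ i, b i ∈ D.S e) (hbpf : ∀ x, ∃ i, D.NonvanAt e (b i) x) (B : Subalgebra k K[X])
    (hB : ∀ i, C (b i) * X ^ e ∈ B) {m : ℕ} {σ : K} (hσ : σ ∈ D.S m) :
    _root_.IsIntegral B (C σ * X ^ m : K[X]) := by
  have inj : Function.Injective (algebraMap K[X] (FractionRing K[X])) :=
    IsFractionRing.injective _ _
  rw [← isIntegral_algebraMap_iff inj]
  by_contra h
  let R : Subring (FractionRing K[X]) := (integralClosure B (FractionRing K[X])).toSubring
  have : IsIntegrallyClosedIn R (FractionRing K[X]) := 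
    inferInstanceAs (IsIntegrallyClosedIn (integralClosure B (FractionRing K[X])) _)
  obtain ⟨V, hV, hσV⟩ := Subring.exists_le_valuationSubring_of_isIntegrallyClosedIn (R := R) h
  have hBV : ∀ y ∈ B, algebraMap K[X] (FractionRing K[X]) y ∈ V := fun y hy =>
    hV (isIntegral_algebraMap (R := B) (x := ⟨y, hy⟩))
  obtain ⟨γ, ⟨i, hi⟩, hγ⟩ := D.exists_valuation_bound V
    (fun c => hBV _ (B.algebraMap_mem c)) b hb hbpf
  refine hσV ((V.valuation_le_one_iff _).1 ((hγ m σ hσ).trans (pow_le_one' ?_ _)))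
  rw [← pow_le_one_iff he, ← hi]
  exact (V.valuation_le_one_iff _).2 (hBV _ (hB i))

theorem mem_prime_of_basePointFree {ι : Type*} (b : ι → K) {e : ℕ} (he : e ≠ 0)
    (hb : ∀ i, b i ∈ D.S e) (hbpf : ∀ x, ∃ i, D.NonvanAt e (b i) x) {A : Type*} [CommRing A]
    [Algebra k A] (ev : A →ₐ[k] K[X]) (p : Ideal A) [p.IsPrime] (hp : RingHom.ker ev ≤ p)
    (y : ι → A) (hy : ∀ i, ev (y i) = C (b i) * X ^ e) (hyp : ∀ i, y i ∈ p)
    {m : ℕ} (hm : m ≠ 0) {σ : K} (hσ : σ ∈ D.S m) {z : A} (hz : ev z = C σ * X ^ m) : z ∈ p := by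
  let F := FractionRing K[X]
  have inj : Function.Injective (algebraMap K[X] F) := IsFractionRing.injective _ _
  let f : A →+* F := (algebraMap K[X] F).comp ev.toRingHom
  have hf : ∀ a : p.primeCompl, IsUnit (f a) := fun a => by
    rw [isUnit_iff_ne_zero]
    intro h
    exact a.2 (hp (inj (by rw [map_zero]; exact h)))
  let g : Localization.AtPrime p →+* F := IsLocalization.lift hf
  have hg : ∀ a, g (algebraMap A _ a) = f a := IsLocalization.lift_eq hf
  obtain ⟨V, hV, hloc⟩ := IsLocalRing.exists_factor_valuationRing g
  have hmem : ∀ a, f a ∈ V := fun a => hg a ▸ hV _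
  have hlt : ∀ a, V.valuation (f a) < 1 ↔ a ∈ p := fun a => by
    have h1 : V.valuation (f a) < 1 ↔ (⟨f a, hmem a⟩ : V) ∈ IsLocalRing.maximalIdeal V :=
      (V.valuation_lt_one_iff ⟨f a, hmem a⟩).symm
    rw [h1, IsLocalRing.mem_maximalIdeal, mem_nonunits_iff]
    have h2 : (⟨f a, hmem a⟩ : V) = g.codRestrict V.toSubring hV (algebraMap A _ a) :=
      Subtype.ext (hg a).symm
    have h3 : IsUnit (⟨f a, hmem a⟩ : V) ↔ IsUnit (algebraMap A (Localization.AtPrime p) a) := by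
      rw [h2]
      exact isUnit_map_iff (g.codRestrict V.toSubring hV) _
    rw [h3, IsLocalization.AtPrime.isUnit_to_map_iff _ p]
    simp [Ideal.primeCompl]
  obtain ⟨γ, ⟨i, hi⟩, hγ⟩ := D.exists_valuation_bound V
    (fun c => by simpa [f] using hmem (algebraMap k A c)) b hb hbpf
  have hγ1 : γ < 1 := by
    rw [← pow_lt_one_iff he, ← hi, ← hy]
    exact (hlt _).2 (hyp i)
  rw [← hlt]
  refine lt_of_le_of_lt ?_ (pow_lt_one' hγ1 hm)
  have := hγ m σ hσ
  rwa [← hz] at this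

end PointData

end

section

/-- A torsion-free extension of a finite module over a noetherian factorial domain is finite if
it is multiplied into the module by powers of two coprime elements. -/
theorem Submodule.fg_of_isRelPrime {A E : Type*} [CommRing A] [IsDomain A]
    [UniqueFactorizationMonoid A] [IsNoetherianRing A] [AddCommGroup E] [Module A E]
    [Module.IsTorsionFree A E] (R M : Submodule A E) (hR : R.FG) {a b : A} (ha : a ≠ 0)
    (hab : IsRelPrime a b) (h : ∀ f ∈ M, ∃ N : ℕ, a ^ N • f ∈ R ∧ b ^ N • f ∈ R) : M.FG := by
  classical
  obtain ⟨s, hs⟩ := hR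
  obtain ⟨t, ht, hst⟩ := exists_maximal_linearIndepOn A (fun i : s => (i : E))
  choose! c hc0 hc using hst
  let c' : s → A := fun i => if i ∈ t then 1 else c i
  have hc'0 : ∏ i, c' i ≠ 0 := Finset.prod_ne_zero_iff.2 fun i _ => by
    by_cases hi : i ∈ t <;> simp [c', hi, hc0]
  set v : t → E := fun i => ((i : s) : E) with hv
  have hvt : (fun i : s => (i : E)) '' t = Set.range v := by
    rw [Set.image_eq_range]
  have hRc : ∀ f ∈ R, (∏ i, c' i) • f ∈ span A (Set.range v) := by
    intro f hf
    rw [← hs] at hf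
    induction hf using Submodule.span_induction with
    | mem x hx =>
      have h1 : c' ⟨x, hx⟩ • x ∈ span A (Set.range v) := by
        by_cases hi : (⟨x, hx⟩ : s) ∈ t
        · simp only [c', hi, if_true, one_smul]
          exact subset_span ⟨⟨⟨x, hx⟩, hi⟩, rfl⟩
        · simp only [c', hi, if_false]
          rw [← hvt]
          exact hc _ hi
      rw [← Finset.mul_prod_erase _ _ (Finset.mem_univ (⟨x, hx⟩ : s)), mul_comm, mul_smul]
      exact smul_mem _ _ h1
    | zero => simp
    | add x y _ _ hx hy => rw [smul_add]; exact add_mem hx hy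
    | smul r x _ hx => rw [smul_comm]; exact smul_mem _ _ hx
  have hM : ∀ f ∈ M, (∏ i, c' i) • f ∈ span A (Set.range v) := by
    intro f hf
    obtain ⟨N, h1, h2⟩ := h f hf
    have h1 := hRc _ h1
    have h2 := hRc _ h2
    rw [smul_comm] at h1 h2
    set g := (∏ i, c' i) • f
    obtain ⟨p, hp⟩ := (mem_span_range_iff_exists_fun A).1 h1
    obtain ⟨q, hq⟩ := (mem_span_range_iff_exists_fun A).1 h2
    have hind : LinearIndependent A v := ht
    have hpq : ∀ i, b ^ N * p i = a ^ N * q i := by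
      have : ∑ i, (b ^ N * p i - a ^ N * q i) • v i = 0 := by
        simp_rw [sub_smul, mul_smul, Finset.sum_sub_distrib, ← Finset.smul_sum, hp, hq]
        rw [smul_comm, sub_self]
      exact fun i => sub_eq_zero.1 (Fintype.linearIndependent_iff.1 hind _ this i)
    have hdvd : ∀ i, a ^ N ∣ p i := fun i => by
      have h3 : a ^ N ∣ b ^ N * p i := ⟨_, hpq i⟩
      exact (hab.pow).dvd_of_dvd_mul_left h3
    choose p' hp' using hdvd
    have h4 : a ^ N • (g - ∑ i, p' i • v i) = 0 := by
      rw [smul_sub, ← hp, Finset.smul_sum, sub_eq_zero]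
      exact Finset.sum_congr rfl fun i _ => by rw [hp', mul_smul]
    have h5 := (smul_eq_zero.1 h4).resolve_left (pow_ne_zero _ ha)
    rw [sub_eq_zero.1 h5]
    exact (mem_span_range_iff_exists_fun A).2 ⟨p', rfl⟩
  refine Submodule.fg_of_fg_map_injective (LinearMap.lsmul A E (∏ i, c' i))
    (fun x y hxy => ?_) ?_
  · have : (∏ i, c' i) • (x - y) = 0 := by
      rw [smul_sub, sub_eq_zero]; exact hxy
    exact sub_eq_zero.1 ((smul_eq_zero.1 this).resolve_left hc'0)
  · have : Module.Finite A (span A (Set.range v)) :=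
      Module.Finite.span_of_finite A (Set.finite_range v)
    have : IsNoetherian A (span A (Set.range v)) := isNoetherian_of_isNoetherianRing_of_finite _ _
    refine FG.of_le (isNoetherian_submodule.1 this _ le_rfl) ?_
    rintro _ ⟨f, hf, rfl⟩
    exact hM f hf

theorem card_le_of_algebraicIndependent {k F ι : Type*} [Field k] [CommRing F]
    [IsDomain F] [Algebra k F]
    [Fintype ι] {t : ℕ} (G : MvPolynomial (Fin t) k →ₐ[k] F) (hG : Function.Injective G) (x : ι → F)
    (hx : AlgebraicIndependent k x) (ha : ∀ i, IsAlgebraic G.range (x i)) : Fintype.card ι ≤ t := by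
  let A' := Subalgebra.algebraicClosure G.range F
  have h1 : Algebra.trdeg k G.range = t := by
    have := (AlgEquiv.ofInjective G hG).lift_trdeg_eq
    rw [MvPolynomial.trdeg_of_isDomain] at this
    simpa using this.symm
  have : FaithfulSMul G.range A' := (faithfulSMul_iff_algebraMap_injective _ _).2
    fun a b hab => Subtype.ext (congrArg A'.val hab)
  have h2 : Algebra.trdeg k A' = t := by
    have := trdeg_add_eq k G.range (A := A')
    rw [h1, trdeg_eq_zero, add_zero] at this
    exact this.symm
  have h3 : AlgebraicIndependent k (fun i => (⟨x i, ha i⟩ : A')) :=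
    AlgebraicIndependent.of_comp (A'.val.restrictScalars k) hx
  have h4 := h3.lift_cardinalMk_le_trdeg
  rw [h2] at h4
  simpa using h4

end

section

open Polynomial

theorem MvPolynomial.mem_radical_of_constantCoeff {k ι : Type*} [Field k]
    (J : Ideal (MvPolynomial ι k)) (hJ : ∀ i, X i ∈ J.radical) (p : MvPolynomial ι k)
    (hp : constantCoeff p = 0) : p ∈ J.radical := by
  have h : p ∈ Ideal.span (X '' (Set.univ : Set ι)) := by
    rw [mem_ideal_span_X_image]
    intro m hm
    by_contra! h
    have hm0 : m = 0 := by ext i; exact h i trivial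
    subst hm0
    rw [mem_support_iff] at hm
    exact hm hp
  refine (Ideal.span_le.2 ?_) h
  rintro _ ⟨i, -, rfl⟩
  exact hJ i

/-- Noether normalisation of the image of a polynomial ring by polynomials without constant
term. -/
theorem exists_noetherNormalization {k ι E : Type*} [Field k] [Finite ι] [CommRing E]
    [Nontrivial E] [Algebra k E] (ev : MvPolynomial ι k →ₐ[k] E) :
    ∃ (t : ℕ) (G : MvPolynomial (Fin t) k →ₐ[k] E), Function.Injective G ∧
      (∀ i, ∃ p, MvPolynomial.constantCoeff p = 0 ∧ G (MvPolynomial.X i) = ev p) ∧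
      ∀ p, _root_.IsIntegral G.range (ev p) := by
  have : Algebra.FiniteType k ev.range :=
    Algebra.FiniteType.of_surjective ev.rangeRestrict ev.rangeRestrict_surjective
  obtain ⟨t, g, hg, hgi⟩ := exists_integral_inj_algHom_of_fg k ev.range
  choose p hp using fun i => (g (MvPolynomial.X i)).2
  let c : Fin t → k := fun i => MvPolynomial.constantCoeff (p i)
  let sh : (Fin t → k) → MvPolynomial (Fin t) k →ₐ[k] MvPolynomial (Fin t) k :=
    fun c => MvPolynomial.aeval fun i => MvPolynomial.X i - MvPolynomial.C (c i)
  have hsh : ∀ c q, sh c (sh (-c) q) = q := by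
    intro c q
    have : (sh c).comp (sh (-c)) = AlgHom.id k _ := by
      ext i
      simp [sh]
    exact DFunLike.congr_fun this q
  let G : MvPolynomial (Fin t) k →ₐ[k] E := (ev.range.val.comp g).comp (sh c)
  refine ⟨t, G, ?_, fun i => ⟨p i - MvPolynomial.C (c i), by simp [c], ?_⟩, fun q => ?_⟩
  · refine (Subtype.val_injective.comp hg).comp ?_
    refine Function.LeftInverse.injective (g := sh (-c)) fun q => ?_
    simpa using hsh (-c) q
  · have h1 := hp i
    simp only [G, sh, AlgHom.comp_apply, MvPolynomial.aeval_X, map_sub] at h1 ⊢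
    rw [MvPolynomial.algHom_C, MvPolynomial.algHom_C]
    rw [show ev.range.val (algebraMap k _ (c i)) = algebraMap k E (c i) from rfl]
    rw [show ev.range.val (g (MvPolynomial.X i)) = ev (p i) from h1.symm]
  · obtain ⟨P, hP, hP0⟩ := hgi ⟨ev q, q, rfl⟩
    have hr : ∀ x, ev.range.val (g x) ∈ G.range := fun x => ⟨sh (-c) x, by
      exact congrArg (fun y => ev.range.val (g y)) (hsh c x)⟩
    let f : MvPolynomial (Fin t) k →+* G.range :=
      ((ev.range.val.comp g).codRestrict G.range hr).toRingHom
    refine ⟨P.map f, hP.map f, ?_⟩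
    rw [Polynomial.eval₂_map]
    have := congrArg ev.range.val.toRingHom hP0
    rw [Polynomial.hom_eval₂] at this
    rw [map_zero] at this
    exact this

namespace PointData

variable {k K P : Type*} [Field k] [Field K] [Algebra k K] (D : PointData k K P)

/-- The graded ring of sections, as a subalgebra of a polynomial ring. -/
def sectionRing : Subalgebra k K[X] where
  carrier := {f | ∀ m, f.coeff m ∈ D.S m}
  mul_mem' {f g} hf hg m := by
    rw [coeff_mul]
    refine Submodule.sum_mem _ fun x hx => ?_
    rw [← Finset.HasAntidiagonal.mem_antidiagonal.1 hx]
    exact D.mul_mem_S (hf _) (hg _)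
  one_mem' m := by
    rw [coeff_one]
    split_ifs with h
    · subst h; exact D.one_mem_S
    · exact zero_mem _
  add_mem' hf hg m := by rw [coeff_add]; exact add_mem (hf m) (hg m)
  zero_mem' m := by simp
  algebraMap_mem' c m := by
    rw [Polynomial.algebraMap_apply, coeff_C]
    split_ifs with h
    · subst h
      rw [Algebra.algebraMap_eq_smul_one]
      exact (D.S 0).smul_mem c D.one_mem_S
    · exact zero_mem _

theorem monomial_mem_sectionRing {m : ℕ} {σ : K} (h : σ ∈ D.S m) :
    C σ * X ^ m ∈ D.sectionRing := fun j => by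
  rw [coeff_C_mul_X_pow]
  split_ifs with hj
  · rwa [hj]
  · exact zero_mem _

end PointData

end

section

open Polynomial

namespace PointData

variable {k K P : Type*} [Field k] [Field K] [Algebra k K] (D : PointData k K P)

/-- The polynomial map whose image is generated by sections `z i` in degree one. -/
noncomputable def ev (k : Type*) {K ι : Type*} [Field k] [Field K] [Algebra k K] (z : ι → K) :
    MvPolynomial ι k →ₐ[k] K[X] :=
  MvPolynomial.aeval fun i => C (z i) * X

theorem ev_X {ι : Type*} (z : ι → K) (i : ι) : ev k z (MvPolynomial.X i) = C (z i) * X := by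
  simp [ev]

theorem exists_conductor {ι : Type*} [Finite ι] (z : ι → K) (hz : ∀ i, z i ∈ D.S 1)
    (s : ι → Finset K) (hs : ∀ i, ∀ f ∈ s i, ∃ N, z i ^ N * f ∈ D.S N) :
    ∃ T : Set K[X], T.Finite ∧ (∀ y ∈ T, ∃ m, ∃ σ ∈ D.S m, y = C σ * X ^ m) ∧
      (∀ i, C (z i) * X ∈ T) ∧
      ∀ i, ∀ a ∈ Algebra.adjoin k (s i : Set K), ∃ N₀, ∀ N, N₀ ≤ N →
        C (a * z i ^ N) * X ^ N ∈ Algebra.adjoin k T := by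
  choose! N hN using hs
  let T : Set K[X] := Set.range (fun i => C (z i) * X) ∪
    ⋃ i, (fun f => C (z i ^ N i f * f) * X ^ N i f) '' (s i : Set K)
  have hzT : ∀ i, C (z i) * X ∈ T := fun i => Or.inl ⟨i, rfl⟩
  refine ⟨T, (Set.finite_range _).union (Set.finite_iUnion fun i => (s i).finite_toSet.image _),
    ?_, hzT, fun i a ha => ?_⟩
  · rintro y (⟨i, rfl⟩ | hy)
    · exact ⟨1, z i, hz i, by simp⟩
    · obtain ⟨i, f, hf, rfl⟩ := Set.mem_iUnion.1 hy
      exact ⟨N i f, _, hN i f hf, rfl⟩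
  · have hpow : ∀ j, C (z i ^ j) * X ^ j ∈ Algebra.adjoin k T := fun j => by
      rw [C_pow, ← mul_pow]
      exact pow_mem (Algebra.subset_adjoin (hzT i)) j
    induction ha using Algebra.adjoin_induction with
    | mem f hf =>
      refine ⟨N i f, fun M hM => ?_⟩
      obtain ⟨j, rfl⟩ := Nat.exists_eq_add_of_le hM
      have h1 : C (z i ^ N i f * f) * X ^ N i f ∈ Algebra.adjoin k T :=
        Algebra.subset_adjoin (Or.inr (Set.mem_iUnion.2 ⟨i, f, hf, rfl⟩))
      convert mul_mem h1 (hpow j) using 1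
      simp only [C_mul, pow_add]
      ring
    | algebraMap c =>
      refine ⟨0, fun M _ => ?_⟩
      convert (Algebra.adjoin k T).smul_mem (hpow M) c using 1
      rw [← Algebra.smul_def, ← smul_C, smul_mul_assoc]
    | add a b _ _ iha ihb =>
      obtain ⟨M1, h1⟩ := iha
      obtain ⟨M2, h2⟩ := ihb
      refine ⟨max M1 M2, fun M hM => ?_⟩
      convert add_mem (h1 M (le_of_max_le_left hM)) (h2 M (le_of_max_le_right hM)) using 1
      rw [add_mul, C_add, add_mul]
    | mul a b _ _ iha ihb =>
      obtain ⟨M1, h1⟩ := iha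
      obtain ⟨M2, h2⟩ := ihb
      refine ⟨M1 + M2, fun M hM => ?_⟩
      obtain ⟨j, rfl⟩ := Nat.exists_eq_add_of_le hM
      convert mul_mem (mul_mem (h1 M1 le_rfl) (h2 M2 le_rfl)) (hpow j) using 1
      simp only [C_mul, pow_add]
      ring

theorem sectionRing_le_span_of_isAlgebraic {ι : Type*} (z : ι → K) (i : ι) (hz0 : z i ≠ 0)
    (s : Finset K) (hA : ∀ m, ∀ σ ∈ D.S m, σ / z i ^ m ∈ Algebra.adjoin k (s : Set K))
    (hs : ∀ a ∈ Algebra.adjoin k (s : Set K), IsAlgebraic k a) :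
    ∃ T : Set K[X], T.Finite ∧ ∀ f ∈ D.sectionRing, f ∈ Submodule.span (ev k z).range T := by
  obtain ⟨t, ht⟩ := fg_adjoin_of_finite s.finite_toSet fun x hx =>
    (hs x (Algebra.subset_adjoin hx)).isIntegral
  refine ⟨C '' (t : Set K), t.finite_toSet.image _, fun f hf => ?_⟩
  rw [f.as_sum_range_C_mul_X_pow]
  refine Submodule.sum_mem _ fun m _ => ?_
  have h1 := hA m _ (hf m)
  rw [← Subalgebra.mem_toSubmodule, ← ht] at h1
  have h2 : ∀ a ∈ Submodule.span k (t : Set K),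
      C (a * z i ^ m) * X ^ m ∈ Submodule.span (ev k z).range (C '' (t : Set K)) := by
    intro a ha
    induction ha using Submodule.span_induction with
    | mem a ha =>
      convert Submodule.smul_mem _ ((ev k z).rangeRestrict (MvPolynomial.X i) ^ m)
        (Submodule.subset_span (Set.mem_image_of_mem C ha)) using 1
      rw [Subalgebra.smul_def]
      rw [SubmonoidClass.coe_pow, show ((ev k z).rangeRestrict (MvPolynomial.X i) : K[X]) =
        C (z i) * X from ev_X z i, smul_eq_mul, C_mul, C_pow]
      ring
    | zero => simp
    | add a b _ _ ha hb =>
      rw [add_mul, C_add, add_mul]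
      exact add_mem ha hb
    | smul c a _ ha =>
      convert Submodule.smul_mem _ (algebraMap k (ev k z).range c) ha using 1
      rw [algebraMap_smul, smul_mul_assoc, ← smul_C, smul_mul_assoc]
  convert h2 _ h1 using 3
  rw [div_mul_cancel₀ _ (pow_ne_zero _ hz0)]

theorem algebraicIndependent_C_X (u a : K) (hu : Transcendental k u) (ha : a ≠ 0) :
    AlgebraicIndependent k
      (fun o : Option Unit => o.elim (C a * X) (fun _ => (C u : K[X]))) := by
  have hx : AlgebraicIndependent k (fun _ : Unit => (C u : K[X])) := by
    rw [algebraicIndependent_unique_type_iff]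
    exact (transcendental_algebraMap_iff (S := K) (A := K[X]) C_injective).2 hu
  rw [AlgebraicIndependent.option_iff_transcendental hx]
  have hC : ∀ y ∈ Algebra.adjoin k (Set.range fun _ : Unit => (C u : K[X])), C (y.coeff 0) = y := by
    intro y hy
    have h1 : Algebra.adjoin k (Set.range fun _ : Unit => (C u : K[X])) ≤
        (Algebra.ofId K K[X]).range.restrictScalars k := by
      refine Algebra.adjoin_le ?_
      rintro _ ⟨_, rfl⟩
      exact ⟨u, rfl⟩
    obtain ⟨y, rfl⟩ := h1 hy
    simp
  have hT : Transcendental K (C a * X : K[X]) :=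
    Polynomial.transcendental _ (by rw [natDegree_C_mul_X _ ha]; exact one_ne_zero)
      (mem_nonZeroDivisors_of_ne_zero (by simpa using ha))
  refine fun h => hT (h.ringHom_of_comp_eq ((constantCoeff : K[X] →+* K).comp
    (Algebra.adjoin k (Set.range fun _ : Unit => (C u : K[X]))).val.toRingHom)
    (RingHom.id K[X]) (fun x y hxy => Subtype.ext ?_) (RingHom.ext fun x => hC x x.2))
  rw [← hC x x.2, ← hC y y.2]
  exact congrArg C hxy

end PointData

end

section

open Polynomial

theorem MvPolynomial.isRelPrime_X_X {k σ : Type*} [Field k] {i j : σ} (h : i ≠ j) :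
    IsRelPrime (X i : MvPolynomial σ k) (X j) := by
  rw [Irreducible.isRelPrime_iff_not_dvd X_prime.irreducible, X_dvd_X]
  exact h

namespace PointData

variable {k K P : Type*} [Field k] [Field K] [Algebra k K] (D : PointData k K P)

/-- The ring of sections as a module over a subalgebra. -/
def sectionModule (B : Subalgebra k K[X]) (hB : B ≤ D.sectionRing) : Submodule B K[X] where
  carrier := D.sectionRing
  add_mem' ha hb := add_mem ha hb
  zero_mem' := zero_mem _
  smul_mem' c _ hx := mul_mem (hB c.2) hx

theorem ev_range_le {ι : Type*} (z : ι → K) (hz : ∀ i, z i ∈ D.S 1) :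
    (ev k z).range ≤ D.sectionRing := by
  rintro _ ⟨p, rfl⟩
  change ev k z p ∈ _
  induction p using MvPolynomial.induction_on with
  | C c => rw [MvPolynomial.algHom_C]; exact Subalgebra.algebraMap_mem _ c
  | add p q hp hq => rw [map_add]; exact add_mem hp hq
  | mul_X p i hp =>
    rw [map_mul, ev_X]
    refine mul_mem hp ?_
    simpa using D.monomial_mem_sectionRing (hz i)

theorem exists_span_sectionRing {ι : Type*} [Finite ι] (z : ι → K) (hz : ∀ i, z i ∈ D.S 1)
    (hz0 : ∀ i, z i ≠ 0) (hbpf : ∀ x, ∃ i, D.NonvanAt 1 (z i) x)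
    (s : ι → Finset K) (hs : ∀ i, ∀ f ∈ s i, ∃ N, z i ^ N * f ∈ D.S N)
    (hA : ∀ i m, ∀ σ ∈ D.S m, σ / z i ^ m ∈ Algebra.adjoin k (s i : Set K)) :
    ∃ T : Set K[X], T.Finite ∧ T ⊆ D.sectionRing ∧
      ∀ f ∈ D.sectionRing, f ∈ Submodule.span (ev k z).range T := by
  classical
  have hle := D.ev_range_le z hz
  have hnoeth : IsNoetherianRing (ev k z).range :=
    isNoetherianRing_of_surjective _ _ (ev k z).rangeRestrict.toRingHom
      (ev k z).rangeRestrict_surjective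
  obtain ⟨x, -⟩ := D.exists_le ⊤ fun c => ValuationSubring.mem_top _
  obtain ⟨i₀, -⟩ := hbpf x
  by_cases halg : ∀ a ∈ Algebra.adjoin k (s i₀ : Set K), IsAlgebraic k a
  · obtain ⟨T, hTf, hT⟩ := D.sectionRing_le_span_of_isAlgebraic z i₀ (hz0 i₀) (s i₀) (hA i₀) halg
    have : Module.Finite (ev k z).range (Submodule.span (ev k z).range T) :=
      Module.Finite.span_of_finite _ hTf
    have : IsNoetherian (ev k z).range (Submodule.span (ev k z).range T) :=
      isNoetherian_of_isNoetherianRing_of_finite (ev k z).range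
        (Submodule.span (ev k z).range T)
    obtain ⟨t, ht⟩ := isNoetherian_submodule.1 this (D.sectionModule _ hle) hT
    have ht' : ∀ f, f ∈ Submodule.span (ev k z).range (t : Set K[X]) ↔ f ∈ D.sectionRing :=
      fun f => by rw [ht]; rfl
    exact ⟨t, t.finite_toSet, fun y hy => (ht' y).1 (Submodule.subset_span hy),
      fun f hf => (ht' f).2 hf⟩
  · push Not at halg
    obtain ⟨u, hu, hutr⟩ := halg
    obtain ⟨n, G, hG, hG0, hGi⟩ := exists_noetherNormalization (ev k z)
    obtain ⟨T, hTf, hTS, hzT, hTA⟩ := D.exists_conductor z hz s hs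
    have hGle : G.range ≤ (ev k z).range := by
      rintro _ ⟨p, rfl⟩
      change G p ∈ _
      induction p using MvPolynomial.induction_on with
      | C c => rw [MvPolynomial.algHom_C]; exact Subalgebra.algebraMap_mem _ c
      | add p q hp hq => rw [map_add]; exact add_mem hp hq
      | mul_X p i hp =>
        obtain ⟨q, -, hq⟩ := hG0 i
        rw [map_mul, hq]
        exact mul_mem hp ⟨q, rfl⟩
    have hint : ∀ m, ∀ σ ∈ D.S m, _root_.IsIntegral G.range (C σ * X ^ m) := by
      intro m σ hσ
      have h1 := D.isIntegral_of_basePointFree z one_ne_zero hz hbpf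
        ((integralClosure G.range K[X]).restrictScalars k)
        (fun i => by
          have := hGi (MvPolynomial.X i)
          rw [ev_X] at this
          rw [pow_one]
          exact this) hσ
      have h2 : _root_.IsIntegral (integralClosure G.range K[X]) (C σ * X ^ m) := h1
      exact isIntegral_trans _ h2
    let R := Subalgebra.toSubmodule (Algebra.adjoin G.range T)
    have hR : R.FG := fg_adjoin_of_finite hTf fun y hy => by
      obtain ⟨m, σ, hσ, rfl⟩ := hTS y hy
      exact hint m σ hσ
    have hTR : ∀ y ∈ Algebra.adjoin k T, y ∈ Algebra.adjoin G.range T := by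
      have : Algebra.adjoin k T ≤ (Algebra.adjoin G.range T).restrictScalars k :=
        Algebra.adjoin_le Algebra.subset_adjoin
      exact this
    have hevR : ∀ p, ev k z p ∈ Algebra.adjoin G.range T := fun p => by
      induction p using MvPolynomial.induction_on with
      | C c =>
        rw [MvPolynomial.algHom_C]
        exact hTR _ (Subalgebra.algebraMap_mem _ c)
      | add p q hp hq => rw [map_add]; exact add_mem hp hq
      | mul_X p i hp =>
        rw [map_mul, ev_X]
        exact mul_mem hp (Algebra.subset_adjoin (hzT i))
    have hn : 2 ≤ n := by
      have h1 := card_le_of_algebraicIndependent G hG _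
        (algebraicIndependent_C_X u (z i₀) hutr (hz0 i₀)) ?_
      · simpa using h1
      have hzi : _root_.IsIntegral G.range (C (z i₀) * X) := by
        have := hint 1 _ (hz i₀)
        rwa [pow_one] at this
      rintro (_ | _)
      · exact hzi.isAlgebraic
      · obtain ⟨N, hN⟩ := hTA i₀ u hu
        have h2 : _root_.IsIntegral G.range (C (u * z i₀ ^ N) * X ^ N) := by
          have h3 := hTR _ (hN N le_rfl)
          have : Module.Finite G.range R := Module.Finite.iff_fg.2 hR
          exact _root_.IsIntegral.of_mem_of_fg _ hR _ h3
        have h4 : (C (u * z i₀ ^ N) * X ^ N : K[X]) = (C (z i₀) * X) ^ N * C u := by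
          rw [C_mul, C_pow, mul_pow]; ring
        rw [h4] at h2
        refine IsAlgebraic.of_mul (mem_nonZeroDivisors_of_ne_zero ?_) (hzi.pow N).isAlgebraic
          h2.isAlgebraic
        exact pow_ne_zero _ (mul_ne_zero (by simpa using hz0 i₀) X_ne_zero)
    have hcond : ∀ f ∈ D.sectionRing, ∀ i, ∃ N, G (MvPolynomial.X i) ^ N * f ∈ R := by
      intro f hf i
      let J : Ideal (MvPolynomial ι k) :=
        { carrier := {p | ev k z p * f ∈ R}
          add_mem' := fun {a b} ha hb => by
            change ev k z (a + b) * f ∈ R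
            rw [map_add, add_mul]; exact add_mem ha hb
          zero_mem' := by
            change ev k z 0 * f ∈ R
            rw [map_zero, zero_mul]; exact zero_mem _
          smul_mem' := fun c x hx => by
            change ev k z (c * x) * f ∈ R
            rw [map_mul, mul_assoc]
            exact mul_mem (S := Subalgebra G.range K[X]) (hevR c) hx }
      have hJ : ∀ j, MvPolynomial.X j ∈ J.radical := by
        intro j
        choose N hN using fun m => hTA j _ (hA j m _ (hf m))
        refine ⟨∑ m ∈ Finset.range (f.natDegree + 1), N m, ?_⟩
        change ev k z (MvPolynomial.X j ^ _) * f ∈ R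
        rw [map_pow, ev_X]
        rw [show ∀ M, (C (z j) * X) ^ M * f = ∑ m ∈ Finset.range (f.natDegree + 1),
            (C (z j) * X) ^ M * (C (f.coeff m) * X ^ m) from fun M => by
          rw [← Finset.mul_sum, ← f.as_sum_range_C_mul_X_pow]]
        refine Submodule.sum_mem _ fun m hm => ?_
        have hNm : N m ≤ ∑ m ∈ Finset.range (f.natDegree + 1), N m :=
          Finset.single_le_sum (fun _ _ => Nat.zero_le _) hm
        generalize (∑ m ∈ Finset.range (f.natDegree + 1), N m) = M at hNm
        have h1 := hTR _ (hN m (M + m) (hNm.trans (Nat.le_add_right _ _)))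
        have h2 : f.coeff m / z j ^ m * z j ^ (M + m) = z j ^ M * f.coeff m := by
          rw [pow_add, mul_comm (z j ^ M), ← mul_assoc, div_mul_cancel₀ _ (pow_ne_zero _ (hz0 j)),
            mul_comm]
        have h3 : (C (z j) * X) ^ M * (C (f.coeff m) * X ^ m) =
            C (f.coeff m / z j ^ m * z j ^ (M + m)) * X ^ (M + m) := by
          rw [h2, C_mul, C_pow, pow_add, mul_pow]
          ring
        rw [h3]
        exact h1
      obtain ⟨p, hp, hGp⟩ := hG0 i
      obtain ⟨N, hN⟩ := MvPolynomial.mem_radical_of_constantCoeff J hJ p hp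
      refine ⟨N, ?_⟩
      rw [hGp, ← map_pow]
      exact hN
    let e := AlgEquiv.ofInjective G hG
    have : UniqueFactorizationMonoid G.range := e.toMulEquiv.uniqueFactorizationMonoid inferInstance
    have : IsNoetherianRing G.range := isNoetherianRing_of_ringEquiv _ e.toRingEquiv
    have : Module.IsTorsionFree G.range K[X] := by infer_instance
    have hrel : IsRelPrime (e (MvPolynomial.X ⟨0, by omega⟩))
        (e (MvPolynomial.X ⟨1, by omega⟩)) := by
      intro d hd0 hd1
      have hX : IsRelPrime (MvPolynomial.X ⟨0, by omega⟩ : MvPolynomial (Fin n) k)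
        (MvPolynomial.X ⟨1, by omega⟩) := MvPolynomial.isRelPrime_X_X (by simp)
      have := hX (d := e.symm d) (by simpa using map_dvd e.symm hd0)
        (by simpa using map_dvd e.symm hd1)
      simpa using this.map e
    obtain ⟨t, ht⟩ := Submodule.fg_of_isRelPrime R (D.sectionModule G.range (hGle.trans hle)) hR
      (by simp : e (MvPolynomial.X ⟨0, by omega⟩) ≠ 0) hrel (by
        intro f hf
        obtain ⟨N, hN⟩ := hcond f hf ⟨0, by omega⟩
        obtain ⟨M, hM⟩ := hcond f hf ⟨1, by omega⟩
        refine ⟨N + M, ?_, ?_⟩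
        · rw [add_comm, pow_add, mul_smul]
          exact R.smul_mem _ hN
        · rw [pow_add, mul_smul]
          exact R.smul_mem _ hM)
    have ht' : ∀ f, f ∈ Submodule.span G.range (t : Set K[X]) ↔ f ∈ D.sectionRing :=
      fun f => by rw [ht]; rfl
    refine ⟨t, t.finite_toSet, fun y hy => (ht' y).1 (Submodule.subset_span hy), fun f hf => ?_⟩
    replace hf := (ht' f).2 hf
    induction hf using Submodule.span_induction with
    | mem y hy => exact Submodule.subset_span hy
    | zero => exact zero_mem _
    | add x y _ _ hx hy => exact add_mem hx hy
    | smul c x _ hx => exact Submodule.smul_mem _ (⟨c, hGle c.2⟩ : (ev k z).range) hx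

end PointData

end

section

open Polynomial

namespace PointData

variable {k K P : Type*} [Field k] [Field K] [Algebra k K] (D : PointData k K P)

theorem S_mul_S_le (m n : ℕ) : D.S m * D.S n ≤ D.S (m + n) :=
  Submodule.mul_le.2 fun _ ha _ hb => D.mul_mem_S ha hb

theorem S_pow_le (m n : ℕ) : D.S m ^ n ≤ D.S (m * n) := by
  induction n with
  | zero =>
    rw [pow_zero, Submodule.one_le, mul_zero]
    exact D.one_mem_S
  | succ n ih =>
    rw [pow_succ, mul_add_one]
    exact (mul_le_mul' ih le_rfl).trans (D.S_mul_S_le _ _)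

theorem coeff_ev_mem {ι : Type*} (z : ι → K) (p : MvPolynomial ι k) (m : ℕ) :
    (ev k z p).coeff m ∈ Submodule.span k (Set.range z) ^ m := by
  induction p using MvPolynomial.induction_on generalizing m with
  | C c =>
    rw [MvPolynomial.algHom_C, Polynomial.algebraMap_apply, coeff_C]
    split_ifs with h
    · subst h
      rw [pow_zero, Algebra.algebraMap_eq_smul_one]
      exact Submodule.smul_mem _ _ (Submodule.one_le.1 le_rfl)
    · exact zero_mem _
  | add p q hp hq => rw [map_add, coeff_add]; exact add_mem (hp m) (hq m)
  | mul_X p i hp =>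
    rw [map_mul, ev_X, ← mul_assoc]
    cases m with
    | zero => simp
    | succ m =>
      rw [coeff_mul_X, coeff_mul_C, pow_succ]
      exact Submodule.mul_mem_mul (hp m) (Submodule.subset_span ⟨i, rfl⟩)

/-- The degree `m` part of a product of graded submodules `Z ^ i` and `W j`. -/
def powMul (Z : Submodule k K) (W : ℕ → Submodule k K) (m : ℕ) : Submodule k K :=
  (Finset.HasAntidiagonal.antidiagonal m).sup fun p => Z ^ p.1 * W p.2

theorem le_powMul (Z : Submodule k K) (W : ℕ → Submodule k K) {i j m : ℕ} (h : i + j = m) :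
    Z ^ i * W j ≤ powMul Z W m :=
  Finset.le_sup (f := fun p : ℕ × ℕ => Z ^ p.1 * W p.2) (b := (i, j))
    (Finset.HasAntidiagonal.mem_antidiagonal.2 h)

theorem powMul_le {Z : Submodule k K} {W : ℕ → Submodule k K} {m : ℕ} {U : Submodule k K}
    (h : ∀ i j, i + j = m → Z ^ i * W j ≤ U) : powMul Z W m ≤ U :=
  Finset.sup_le fun _ hp => h _ _ (Finset.HasAntidiagonal.mem_antidiagonal.1 hp)

theorem pow_mul_powMul_le (Z : Submodule k K) (W : ℕ → Submodule k K) (a b : ℕ) :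
    Z ^ a * powMul Z W b ≤ powMul Z W (a + b) := by
  rw [Submodule.mul_le]
  intro x hx y hy
  have : powMul Z W b ≤ (powMul Z W (a + b)).comap (LinearMap.mulLeft k x) := by
    refine powMul_le fun i j hij => ?_
    rw [Submodule.mul_le]
    intro u hu v hv
    rw [Submodule.mem_comap, LinearMap.mulLeft_apply, ← mul_assoc]
    refine le_powMul Z W (i := a + i) (j := j) (by omega) (Submodule.mul_mem_mul ?_ hv)
    rw [pow_add]
    exact Submodule.mul_mem_mul hx hu
  exact this hy

theorem powMul_fg {Z : Submodule k K} {W : ℕ → Submodule k K} (hZ : Z.FG) (hW : ∀ j, (W j).FG)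
    (m : ℕ) : (powMul Z W m).FG :=
  Submodule.fg_finset_sup _ _ fun _ _ => (hZ.pow _).mul (hW _)

/-- The span of the coefficients of degree `j`. -/
def coeffSpan (k : Type*) {K : Type*} [Field k] [Field K] [Algebra k K] (T : Set K[X]) (j : ℕ) :
    Submodule k K :=
  Submodule.span k ((fun f : K[X] => f.coeff j) '' T)

theorem coeff_mem_powMul {ι : Type*} (z : ι → K) (T : Set K[X]) (f : K[X])
    (hf : f ∈ Submodule.span (ev k z).range T) (m : ℕ) :
    f.coeff m ∈ powMul (Submodule.span k (Set.range z)) (coeffSpan k T) m := by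
  induction hf using Submodule.span_induction generalizing m with
  | mem f hf =>
    have := le_powMul (Submodule.span k (Set.range z)) (coeffSpan k T) (zero_add m)
    rw [pow_zero, one_mul] at this
    exact this (Submodule.subset_span ⟨f, hf, rfl⟩)
  | zero => simp
  | add f g _ _ hf hg => rw [coeff_add]; exact add_mem (hf m) (hg m)
  | smul r f _ hf =>
    rw [Subalgebra.smul_def, smul_eq_mul, coeff_mul]
    refine Submodule.sum_mem _ fun p hp => ?_
    rw [← Finset.HasAntidiagonal.mem_antidiagonal.1 hp]
    obtain ⟨q, hq⟩ := r.2
    rw [← hq]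
    exact pow_mul_powMul_le _ _ _ _ (Submodule.mul_mem_mul (coeff_ev_mem z q _) (hf _))

theorem exists_veronese {ι : Type*} [Finite ι] (z : ι → K) (hz : ∀ i, z i ∈ D.S 1)
    (hz0 : ∀ i, z i ≠ 0) (hbpf : ∀ x, ∃ i, D.NonvanAt 1 (z i) x)
    (s : ι → Finset K) (hs : ∀ i, ∀ f ∈ s i, ∃ N, z i ^ N * f ∈ D.S N)
    (hA : ∀ i m, ∀ σ ∈ D.S m, σ / z i ^ m ∈ Algebra.adjoin k (s i : Set K)) :
    ∃ e, 0 < e ∧ (D.S e).FG ∧ ∀ m, D.S (e * (m + 1)) ≤ D.S e ^ (m + 1) := by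
  obtain ⟨T, hTf, hTS, hT⟩ := D.exists_span_sectionRing z hz hz0 hbpf s hs hA
  have hZ : Submodule.span k (Set.range z) ≤ D.S 1 :=
    Submodule.span_le.2 (by rintro _ ⟨i, rfl⟩; exact hz i)
  have hWS : ∀ j, coeffSpan k T j ≤ D.S j := fun j =>
    Submodule.span_le.2 (by rintro _ ⟨f, hf, rfl⟩; exact hTS hf j)
  have hWfg : ∀ j, (coeffSpan k T j).FG := fun j => Submodule.fg_span (hTf.image _)
  have hZfg : (Submodule.span k (Set.range z)).FG := Submodule.fg_span (Set.finite_range z)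
  have hSV : ∀ m, D.S m ≤ powMul (Submodule.span k (Set.range z)) (coeffSpan k T) m := by
    intro m σ hσ
    have := coeff_mem_powMul z T _ (hT _ (D.monomial_mem_sectionRing hσ)) m
    rwa [coeff_C_mul_X_pow, if_pos rfl] at this
  obtain ⟨b, hb⟩ := (hTf.image natDegree).bddAbove
  have hW0 : ∀ j, b < j → coeffSpan k T j = ⊥ := fun j hj => by
    rw [coeffSpan, Submodule.span_eq_bot]
    rintro _ ⟨f, hf, rfl⟩
    exact coeff_eq_zero_of_natDegree_lt ((hb ⟨f, hf, rfl⟩).trans_lt hj)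
  generalize Submodule.span k (Set.range z) = Z at *
  generalize coeffSpan k T = W at *
  have hZS : ∀ n, Z ^ n ≤ D.S n := fun n => (pow_le_pow_left' hZ n).trans
    ((D.S_pow_le 1 n).trans_eq (by rw [one_mul]))
  have hVS : ∀ m, powMul Z W m ≤ D.S m := fun m => powMul_le fun i j h => by
    rw [← h]
    exact (mul_le_mul' (hZS _) (hWS _)).trans (D.S_mul_S_le _ _)
  refine ⟨b + 1, Nat.succ_pos b, ?_, fun m => (hSV _).trans (powMul_le fun i j h => ?_)⟩
  · rw [le_antisymm (hSV _) (hVS _)]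
    exact powMul_fg hZfg hWfg _
  · by_cases hj : b < j
    · rw [hW0 _ hj, Submodule.mul_bot]
      exact bot_le
    · obtain ⟨a, ha⟩ := Nat.exists_eq_add_of_le (not_lt.1 hj)
      have h1 : i = (b + 1) * m + (a + 1) := by
        have : (b + 1) * (m + 1) = (b + 1) * m + (b + 1) := by ring
        omega
      rw [h1, pow_add, pow_mul, mul_assoc, pow_succ (D.S (b + 1))]
      refine mul_le_mul' (pow_le_pow_left' (hZS _) m) ?_
      refine (mul_le_mul' (hZS _) (hWS _)).trans ((D.S_mul_S_le _ _).trans_eq ?_)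
      congr 1
      omega

end PointData

end

section

open Polynomial

namespace PointData

variable {k K P : Type*} [Field k] [Field K] [Algebra k K] (D : PointData k K P)

theorem ev_of_isHomogeneous {ι : Type*} (x : ι → K) {m : ℕ} {G : MvPolynomial ι k}
    (hG : G.IsHomogeneous m) : ev k x G = C (MvPolynomial.aeval x G) * X ^ m := by
  rw [ev, MvPolynomial.aeval_def, MvPolynomial.eval₂_eq, MvPolynomial.aeval_def,
    MvPolynomial.eval₂_eq, map_sum, Finset.sum_mul]
  refine Finset.sum_congr rfl fun s hs => ?_
  rw [MvPolynomial.mem_support_iff] at hs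
  have h1 : ∑ i ∈ s.support, s i = m := by
    rw [← hG hs, Finsupp.weight_apply]
    simp [Finsupp.sum]
  rw [C_mul, mul_assoc, Polynomial.algebraMap_apply, map_prod, ← h1, ← Finset.prod_pow_eq_pow_sum,
    ← Finset.prod_mul_distrib]
  simp_rw [mul_pow, C_pow]

theorem coeff_ev {ι : Type*} (x : ι → K) (G : MvPolynomial ι k) (m : ℕ) :
    (ev k x G).coeff m = MvPolynomial.aeval x (MvPolynomial.homogeneousComponent m G) := by
  conv_lhs => rw [← MvPolynomial.sum_homogeneousComponent G]
  rw [map_sum, finsetSum_coeff]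
  simp_rw [ev_of_isHomogeneous x (MvPolynomial.homogeneousComponent_isHomogeneous _ G),
    coeff_C_mul_X_pow]
  rw [Finset.sum_ite_eq, ite_eq_left_iff]
  intro h
  rw [MvPolynomial.homogeneousComponent_eq_zero, map_zero]
  rw [Finset.mem_range] at h
  omega

theorem ev_eq_zero_iff {ι : Type*} (x : ι → K) {m : ℕ} {G : MvPolynomial ι k}
    (hG : G.IsHomogeneous m) : ev k x G = 0 ↔ MvPolynomial.aeval x G = 0 := by
  rw [ev_of_isHomogeneous x hG, mul_eq_zero, or_iff_left (pow_ne_zero _ X_ne_zero), C_eq_zero]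

theorem exists_ker_ev_eq_span {ι : Type*} [Finite ι] (x : ι → K) :
    ∃ n, 0 < n ∧ ∃ T : Set (MvPolynomial ι k), (∀ G ∈ T, ∃ m ≤ n, G.IsHomogeneous m) ∧
      RingHom.ker (ev k x) = Ideal.span T := by
  obtain ⟨s, hs⟩ := (isNoetherianRing_iff_ideal_fg _).1
    (inferInstance : IsNoetherianRing (MvPolynomial ι k)) (RingHom.ker (ev k x))
  refine ⟨s.sup MvPolynomial.totalDegree + 1, Nat.succ_pos _,
    {G | ∃ f ∈ s, ∃ m ≤ f.totalDegree, G = MvPolynomial.homogeneousComponent m f}, ?_,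
    le_antisymm ?_ ?_⟩
  · rintro _ ⟨f, hf, m, hm, rfl⟩
    exact ⟨m, (hm.trans (Finset.le_sup hf)).trans (Nat.le_succ _),
      MvPolynomial.homogeneousComponent_isHomogeneous _ _⟩
  · rw [← hs, Ideal.span_le]
    intro f hf
    rw [SetLike.mem_coe, ← MvPolynomial.sum_homogeneousComponent f]
    refine Ideal.sum_mem _ fun m hm => Ideal.subset_span ⟨f, hf, m, ?_, rfl⟩
    exact Nat.lt_succ_iff.1 (Finset.mem_range.1 hm)
  · rw [Ideal.span_le]
    rintro _ ⟨f, hf, m, -, rfl⟩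
    have h0 : ev k x f = 0 := by
      have : f ∈ RingHom.ker (ev k x) := hs ▸ Ideal.subset_span hf
      exact this
    rw [SetLike.mem_coe, RingHom.mem_ker,
      ev_eq_zero_iff x (MvPolynomial.homogeneousComponent_isHomogeneous _ _), ← coeff_ev, h0,
      coeff_zero]

/-- The algebra map sending the variable of a word to the product of its letters. -/
noncomputable def wordMap (k : Type*) (ι : Type*) [Field k] (n : ℕ) :
    MvPolynomial (Fin n → ι) k →ₐ[k] MvPolynomial ι k :=
  MvPolynomial.aeval fun w => ∏ p, MvPolynomial.X (w p)

theorem span_range_pow {ι A : Type*} [CommRing A] [Algebra k A] (x : ι → A) (n : ℕ) :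
    Submodule.span k (Set.range x) ^ n =
      Submodule.span k (Set.range fun w : Fin n → ι => ∏ p, x (w p)) := by
  rw [Submodule.span_pow]
  congr 1
  ext y
  rw [Set.mem_pow]
  constructor
  · rintro ⟨f, rfl⟩
    choose g hg using fun p => (f p).2
    exact ⟨g, by simp only [hg]; rw [List.prod_ofFn]⟩
  · rintro ⟨w, rfl⟩
    exact ⟨fun p => ⟨x (w p), w p, rfl⟩, by rw [List.prod_ofFn]⟩

theorem map_homogeneousSubmodule_aeval {ι A : Type*} [CommRing A] [Algebra k A] (x : ι → A)
    (m : ℕ) : (MvPolynomial.homogeneousSubmodule ι k m).map (MvPolynomial.aeval x).toLinearMap =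
      Submodule.span k (Set.range x) ^ m := by
  rw [← MvPolynomial.homogeneousSubmodule_one_pow, Submodule.map_pow,
    MvPolynomial.homogeneousSubmodule_one_eq_span_X, Submodule.map_span, ← Set.range_comp]
  congr 3
  ext i
  simp

theorem map_wordMap (ι : Type*) (n m : ℕ) :
    (MvPolynomial.homogeneousSubmodule (Fin n → ι) k m).map (wordMap k ι n).toLinearMap =
      MvPolynomial.homogeneousSubmodule ι k (n * m) := by
  rw [wordMap, map_homogeneousSubmodule_aeval, ← span_range_pow, ← pow_mul,
    ← MvPolynomial.homogeneousSubmodule_one_eq_span_X,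
    MvPolynomial.homogeneousSubmodule_one_pow]

theorem prod_update_mul {ι M : Type*} [CommMonoid M] {n : ℕ} (f : ι → M) (w : Fin n → ι)
    (p : Fin n) (j : ι) :
    (∏ q, f (Function.update w p j q)) * f (w p) = f j * ∏ q, f (w q) := by
  rw [← Finset.mul_prod_erase Finset.univ _ (Finset.mem_univ p),
    ← Finset.mul_prod_erase Finset.univ (fun q => f (w q)) (Finset.mem_univ p),
    Function.update_self, mul_assoc, mul_comm _ (f (w p))]
  congr 2
  refine Finset.prod_congr rfl fun q hq => ?_
  rw [Function.update_of_ne (Finset.ne_of_mem_erase hq)]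

/-- A function on words satisfying the quadratic relations is a product of functions of
letters. -/
theorem exists_eq_mul_prod {ι F : Type*} [Field F] {n : ℕ} (ζ : (Fin n → ι) → F)
    (hrel : ∀ a b c d : Fin n → ι,
      (∏ p, MvPolynomial.X (R := k) (a p)) * ∏ p, MvPolynomial.X (b p) =
        (∏ p, MvPolynomial.X (c p)) * ∏ p, MvPolynomial.X (d p) → ζ a * ζ b = ζ c * ζ d)
    {w : Fin n → ι} (hw : ζ w ≠ 0) (p₀ : Fin n) :
    ∃ κ, κ ≠ 0 ∧ ∀ v, ζ v = κ * ∏ p, ζ (Function.update w p₀ (v p)) := by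
  classical
  have hX : ∀ i, MvPolynomial.X (R := k) (σ := ι) i ≠ 0 := fun i => MvPolynomial.X_ne_zero i
  have h1 : ∀ p j, ζ (Function.update w p j) * ζ w =
      ζ (Function.update w p (w p₀)) * ζ (Function.update w p₀ j) := fun p j => by
    refine hrel _ _ _ _ (mul_right_cancel₀ (mul_ne_zero (hX (w p)) (hX (w p₀))) ?_)
    have e1 := prod_update_mul (MvPolynomial.X (R := k)) w p j
    have e2 := prod_update_mul (MvPolynomial.X (R := k)) w p (w p₀)
    have e3 := prod_update_mul (MvPolynomial.X (R := k)) w p₀ j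
    generalize ∏ q, MvPolynomial.X (R := k) (Function.update w p j q) = a at *
    generalize ∏ q, MvPolynomial.X (R := k) (Function.update w p (w p₀) q) = b at *
    generalize ∏ q, MvPolynomial.X (R := k) (Function.update w p₀ j q) = c at *
    generalize ∏ q, MvPolynomial.X (R := k) (w q) = d at *
    linear_combination (d * MvPolynomial.X (w p₀)) * e1 - (c * MvPolynomial.X (w p₀)) * e2 -
      (MvPolynomial.X (w p₀) * d) * e3
  have hc : ∀ p, ζ (Function.update w p (w p₀)) ≠ 0 := fun p h => by
    have := h1 p (w p)
    rw [h, zero_mul, Function.update_eq_self] at this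
    exact hw (mul_self_eq_zero.1 this)
  have h2 : ∀ (v : Fin n → ι) (S : Finset (Fin n)), ζ (S.piecewise v w) * ζ w ^ S.card =
      ζ w * ∏ p ∈ S, ζ (Function.update w p (v p)) := fun v S => by
    induction S using Finset.induction_on with
    | empty => simp
    | insert p S hp ih =>
      have h3 : ζ (Function.update (S.piecewise v w) p (v p)) * ζ w =
          ζ (S.piecewise v w) * ζ (Function.update w p (v p)) := by
        refine hrel _ _ _ _ (mul_right_cancel₀ (hX (w p)) ?_)
        have h4 := prod_update_mul (MvPolynomial.X (R := k)) (S.piecewise v w) p (v p)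
        rw [Finset.piecewise_eq_of_notMem _ _ _ hp] at h4
        rw [mul_right_comm, h4, mul_assoc _ _ (MvPolynomial.X (w p)), prod_update_mul]
        ring
      rw [Finset.piecewise_insert, Finset.card_insert_of_notMem hp, Finset.prod_insert hp,
        pow_succ', ← mul_assoc, h3, mul_right_comm, ih]
      ring
  refine ⟨ζ w * (∏ p, ζ (Function.update w p (w p₀))) / ζ w ^ (2 * n), ?_, fun v => ?_⟩
  · exact div_ne_zero (mul_ne_zero hw (Finset.prod_ne_zero_iff.2 fun p _ => hc p))
      (pow_ne_zero _ hw)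
  · have h5 := h2 v Finset.univ
    rw [Finset.piecewise_univ, Finset.card_univ, Fintype.card_fin] at h5
    have h6 : (∏ p, ζ (Function.update w p (v p))) * ζ w ^ n =
        (∏ p, ζ (Function.update w p (w p₀))) * ∏ p, ζ (Function.update w p₀ (v p)) := by
      rw [← Finset.prod_mul_distrib, ← Finset.prod_congr rfl fun p _ => h1 p (v p),
        Finset.prod_mul_distrib]
      simp
    rw [div_mul_eq_mul_div, eq_div_iff (pow_ne_zero _ hw), mul_assoc (ζ w), ← h6, two_mul, pow_add,
      ← mul_assoc, h5]
    ring

end PointData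

end

section

open Polynomial

namespace PointData

variable {k K P : Type*} [Field k] [Field K] [Algebra k K] (D : PointData k K P)

theorem aeval_mul_of_isHomogeneous {ι A : Type*} [CommRing A] [Algebra k A] (κ : A) (g : ι → A)
    {m : ℕ} {G : MvPolynomial ι k} (hG : G.IsHomogeneous m) :
    MvPolynomial.aeval (fun i => κ * g i) G = κ ^ m * MvPolynomial.aeval g G := by
  rw [MvPolynomial.aeval_def, MvPolynomial.eval₂_eq, MvPolynomial.aeval_def,
    MvPolynomial.eval₂_eq, Finset.mul_sum]
  refine Finset.sum_congr rfl fun s hs => ?_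
  rw [MvPolynomial.mem_support_iff] at hs
  have h1 : ∑ i ∈ s.support, s i = m := by
    rw [← hG hs, Finsupp.weight_apply]
    simp [Finsupp.sum]
  simp_rw [mul_pow]
  rw [Finset.prod_mul_distrib, Finset.prod_pow_eq_pow_sum, h1, mul_left_comm]

theorem aeval_wordMap {ι A : Type*} [CommRing A] [Algebra k A] (u : ι → A) {n : ℕ}
    (G : MvPolynomial (Fin n → ι) k) :
    MvPolynomial.aeval u (wordMap k ι n G) =
      MvPolynomial.aeval (fun w : Fin n → ι => ∏ p, u (w p)) G := by
  have : (MvPolynomial.aeval u).comp (wordMap k ι n) =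
      MvPolynomial.aeval (fun w : Fin n → ι => ∏ p, u (w p)) := by
    ext w
    simp [wordMap]
  exact DFunLike.congr_fun this G

theorem isHomogeneous_wordMap {ι : Type*} {n m : ℕ} {G : MvPolynomial (Fin n → ι) k}
    (hG : G.IsHomogeneous m) : (wordMap k ι n G).IsHomogeneous (n * m) := by
  rw [← MvPolynomial.mem_homogeneousSubmodule, ← map_wordMap]
  exact ⟨G, hG, rfl⟩

theorem X_mem_prime_of_two_le {ι ι' : Type*} {x : ι → K} (hx : ∀ i, x i ∈ D.S 1)
    {n d : ℕ} (hn : 0 < n) (hd : 2 ≤ d) (T : Set (MvPolynomial ι k))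
    (hT : ∀ G ∈ T, ∃ m ≤ n, G.IsHomogeneous m) (hTx : RingHom.ker (ev k x) = Ideal.span T)
    (b : ι' → K) (hb : ∀ i, b i ∈ D.S (n * d)) (hbpf : ∀ y, ∃ i, D.NonvanAt (n * d) (b i) y)
    (q : ι' → MvPolynomial (Fin n → ι) k) (hq : ∀ i, (q i).IsHomogeneous d)
    (hqb : ∀ i, ev k x (wordMap k ι n (q i)) = C (b i) * X ^ (n * d))
    (p : Ideal (MvPolynomial (Fin n → ι) k)) [p.IsPrime]
    (hU : ∀ u, u.IsHomogeneous d → ev k x (wordMap k ι n u) = 0 → u ∈ p)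
    (hqp : ∀ i, q i ∈ p) (w : Fin n → ι) : MvPolynomial.X w ∈ p := by
  by_contra hw
  let F := p.ResidueField
  let ζ : MvPolynomial (Fin n → ι) k →ₐ[k] F := IsScalarTower.toAlgHom k _ _
  have hζ : ∀ G, ζ G = 0 ↔ G ∈ p := fun G => Ideal.algebraMap_residueField_eq_zero
  rw [← hζ] at hw
  have hI : ∀ m ≤ d, ∀ G, G.IsHomogeneous m → ev k x (wordMap k ι n G) = 0 → ζ G = 0 := by
    intro m hm G hG h0
    have h1 : ζ (MvPolynomial.X w ^ (d - m) * G) = 0 := by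
      rw [hζ]
      refine hU _ ?_ (by rw [map_mul, map_mul, h0, mul_zero])
      have := ((MvPolynomial.isHomogeneous_X k w).pow (d - m)).mul hG
      rwa [one_mul, Nat.sub_add_cancel hm] at this
    rw [map_mul, map_pow] at h1
    exact (mul_eq_zero.1 h1).resolve_left (pow_ne_zero _ hw)
  have hX : ∀ v, wordMap k ι n (MvPolynomial.X v) = ∏ r, MvPolynomial.X (v r) := fun v => by
    simp [wordMap]
  obtain ⟨κ, hκ, hfac⟩ := exists_eq_mul_prod (k := k) (fun v => ζ (MvPolynomial.X v))
    (fun a b c e h => by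
      rw [← sub_eq_zero, ← map_mul, ← map_mul, ← map_sub]
      refine hI 2 hd _ (((MvPolynomial.isHomogeneous_X k a).mul
        (MvPolynomial.isHomogeneous_X k b)).sub ((MvPolynomial.isHomogeneous_X k c).mul
        (MvPolynomial.isHomogeneous_X k e))) ?_
      rw [map_sub, map_mul, map_mul, hX, hX, hX, hX, h, sub_self, map_zero]) hw ⟨0, hn⟩
  set u : ι → F := fun j => ζ (MvPolynomial.X (Function.update w ⟨0, hn⟩ j)) with hu
  have hu0 : u (w ⟨0, hn⟩) ≠ 0 := by
    rw [hu]
    simpa using hw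
  have hζu : ∀ m G, G.IsHomogeneous m →
      ζ G = κ ^ m * MvPolynomial.aeval u (wordMap k ι n G) := fun m G hG => by
    have : ζ = MvPolynomial.aeval (fun v => κ * ∏ r, u (v r)) := by
      ext v
      rw [MvPolynomial.aeval_X]
      exact hfac v
    rw [aeval_wordMap, ← aeval_mul_of_isHomogeneous _ _ hG, ← this]
  let φ : MvPolynomial ι k →ₐ[k] F := MvPolynomial.aeval u
  have hker : RingHom.ker (ev k x) ≤ RingHom.ker φ := by
    rw [hTx, Ideal.span_le]
    intro G hG
    obtain ⟨m, hm, hGm⟩ := hT G hG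
    have h1 := ((MvPolynomial.isHomogeneous_X k (w ⟨0, hn⟩)).pow (n - m)).mul hGm
    rw [one_mul, Nat.sub_add_cancel hm] at h1
    have h1' := (MvPolynomial.mem_homogeneousSubmodule _ _).2 h1
    have hmap := map_wordMap (k := k) ι n 1
    rw [mul_one] at hmap
    rw [← hmap] at h1'
    obtain ⟨ℓ, hℓ, hℓG⟩ := h1'
    change wordMap k ι n ℓ = _ at hℓG
    have h2 : ev k x G = 0 := by
      have : G ∈ RingHom.ker (ev k x) := hTx ▸ Ideal.subset_span hG
      exact this
    have h3 := hI 1 (one_le_two.trans hd) ℓ hℓ (by rw [hℓG, map_mul, h2, mul_zero])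
    rw [hζu 1 ℓ hℓ, pow_one, hℓG, map_mul, map_pow, MvPolynomial.aeval_X] at h3
    exact (mul_eq_zero.1 ((mul_eq_zero.1 h3).resolve_left hκ)).resolve_left (pow_ne_zero _ hu0)
  have hprime : (RingHom.ker φ).IsPrime := RingHom.ker_isPrime _
  have := D.mem_prime_of_basePointFree b (Nat.mul_ne_zero hn.ne' (by omega)) hb hbpf (ev k x)
    (RingHom.ker φ) hker (fun i => wordMap k ι n (q i)) hqb (fun i => by
      have := hζu d (q i) (hq i)
      rw [(hζ _).2 (hqp i)] at this
      exact (mul_eq_zero.1 this.symm).resolve_left (pow_ne_zero _ hκ)) one_ne_zero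
    (hx (w ⟨0, hn⟩)) (z := MvPolynomial.X (w ⟨0, hn⟩)) (by rw [ev_X, pow_one])
  rw [RingHom.mem_ker, MvPolynomial.aeval_X] at this
  exact hu0 this

/-- An endomorphism of a Noetherian domain over whose image the domain is integral is
injective. -/
theorem injective_of_isIntegral {R : Type*} [CommRing R] [IsDomain R] [IsNoetherianRing R]
    (f : R →+* R) (hf : f.IsIntegral) : Function.Injective f := by
  have hpow : ∀ n, (f ^ n : R →+* R).IsIntegral := fun n => by
    induction n with
    | zero => exact RingHom.isIntegral_of_surjective _ Function.surjective_id
    | succ n ih => rw [pow_succ]; exact hf.trans _ _ ih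
  obtain ⟨N, hN⟩ : ∃ N, ∀ m, N ≤ m → RingHom.ker (f ^ N) = RingHom.ker (f ^ m) :=
    monotone_stabilizes_iff_noetherian.2 (inferInstance : IsNoetherian R R)
    ⟨fun n => RingHom.ker (f ^ n : R →+* R), monotone_nat_of_le_succ fun n a ha => by
      rw [RingHom.mem_ker] at ha ⊢
      rw [pow_succ', RingHom.mul_def, RingHom.comp_apply, ha, map_zero]⟩
  have hN' : ∀ a, (f ^ (N + N)) a = 0 → (f ^ N) a = 0 := fun a ha => by
    have := hN (N + N) (Nat.le_add_left _ _)
    rw [← RingHom.mem_ker, this]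
    exact ha
  have hinj : Function.Injective (f ^ N : R →+* R) := by
    rw [injective_iff_map_eq_zero]
    intro a ha
    by_contra ha0
    obtain ⟨q, hq, hqa⟩ := hpow N a
    have h1 := Ideal.comap_ne_bot_of_root_mem (f := (f ^ N : R →+* R).range.subtype)
      (I := RingHom.ker (f ^ N : R →+* R)) ha0 ha (hq.map (f ^ N : R →+* R).rangeRestrict).ne_zero
      (by rw [eval₂_map]; exact hqa)
    refine h1 (eq_bot_iff.2 ?_)
    rintro ⟨_, b, rfl⟩ hb
    rw [Ideal.mem_bot]
    refine Subtype.ext (hN' b ?_)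
    rw [pow_add]
    exact hb
  rw [injective_iff_map_eq_zero]
  intro a ha
  have h2 : a ∈ RingHom.ker (f ^ (N + 1)) := by
    rw [RingHom.mem_ker, pow_succ, RingHom.mul_def, RingHom.comp_apply, ha, map_zero]
  rw [← hN (N + 1) (Nat.le_succ N), RingHom.mem_ker] at h2
  exact hinj (h2.trans (map_zero _).symm)

end PointData

end

section

open Polynomial

namespace PointData

variable {k K P : Type*} [Field k] [Field K] [Algebra k K] (D : PointData k K P)

theorem isIntegralElem_of_surjective {A B S : Type*} [CommRing A] [CommRing B] [CommRing S]
    {f : B →+* S} {g : A →+* B} (hg : Function.Surjective g) {y : S} (hy : f.IsIntegralElem y) :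
    (f.comp g).IsIntegralElem y := by
  obtain ⟨p, hp, hpy⟩ := hy
  obtain ⟨q, rfl, -, hq⟩ := lifts_and_natDegree_eq_and_monic
    ((lifts_iff_coeff_lifts p).2 fun n => hg _) hp
  exact ⟨q, hq, by rwa [eval₂_map] at hpy⟩

theorem ker_ev_eq_of_basePointFree {ι : Type*} [Finite ι] {x b : ι → K} (hx : ∀ i, x i ∈ D.S 1)
    (hb : ∀ i, b i ∈ Submodule.span k (Set.range x))
    (hbpf : ∀ y, ∃ i, D.NonvanAt 1 (b i) y) (hker : RingHom.ker (ev k x) ≤ RingHom.ker (ev k b)) :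
    RingHom.ker (ev k x) = RingHom.ker (ev k b) := by
  have hbS : ∀ i, b i ∈ D.S 1 := fun i =>
    (Submodule.span_le.2 (by rintro _ ⟨j, rfl⟩; exact hx j) : _ ≤ D.S 1) (hb i)
  have hlin : ∀ i, ∃ l, ev k x l = C (b i) * X := fun i => by
    have h1 := hb i
    rw [← pow_one (Submodule.span k (Set.range x)), ← map_homogeneousSubmodule_aeval] at h1
    obtain ⟨l, hl, hlb⟩ := h1
    refine ⟨l, ?_⟩
    rw [ev_of_isHomogeneous x hl, pow_one]
    exact congrArg (fun a => C a * X) hlb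
  choose l hl using hlin
  let Λ : MvPolynomial ι k →ₐ[k] MvPolynomial ι k := MvPolynomial.aeval l
  have hΛ : ∀ G, ev k x (Λ G) = ev k b G := fun G => by
    have : (ev k x).comp Λ = ev k b := by
      ext1 i
      simp [Λ, hl, ev_X]
    exact DFunLike.congr_fun this G
  set I := RingHom.ker (ev k x) with hI
  have : I.IsPrime := RingHom.ker_isPrime _
  have hIΛ : I ≤ I.comap Λ.toRingHom := fun G hG => by
    rw [Ideal.mem_comap]
    exact (hΛ G).trans (hker hG)
  let f : MvPolynomial ι k ⧸ I →+* MvPolynomial ι k ⧸ I := Ideal.quotientMap I Λ.toRingHom hIΛ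
  let j : MvPolynomial ι k ⧸ I →+* K[X] := RingHom.kerLift (ev k x).toRingHom
  have hj : Function.Injective j := RingHom.kerLift_injective _
  have hjmk : ∀ G, j (Ideal.Quotient.mk I G) = ev k x G := fun G => rfl
  have hint : f.IsIntegral := by
    intro q
    obtain ⟨G, rfl⟩ := Ideal.Quotient.mk_surjective q
    have h1 : _root_.IsIntegral (ev k b).range (ev k x G) := by
      induction G using MvPolynomial.induction_on with
      | C c =>
        rw [MvPolynomial.algHom_C]
        exact isIntegral_algebraMap (R := (ev k b).range) (x := algebraMap k _ c)
      | add p q hp hq => rw [map_add]; exact hp.add hq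
      | mul_X p i hp =>
        rw [map_mul, ev_X]
        refine hp.mul ?_
        have := D.isIntegral_of_basePointFree b one_ne_zero hbS hbpf (ev k b).range
          (fun i => ⟨MvPolynomial.X i, by rw [pow_one]; exact ev_X b i⟩) (hx i)
        rwa [pow_one] at this
    have h2 := isIntegralElem_of_surjective (f := algebraMap (ev k b).range K[X])
      (g := (ev k b).rangeRestrict.toRingHom) (ev k b).rangeRestrict_surjective h1
    obtain ⟨p, hp, hpy⟩ := h2
    refine ⟨p.map (Ideal.Quotient.mk I), hp.map _, hj ?_⟩
    rw [eval₂_map, hom_eval₂, map_zero, ← hpy, hjmk]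
    congr 1
    exact RingHom.ext fun G => (hΛ G).trans rfl
  have hinj := injective_of_isIntegral f hint
  refine le_antisymm hker fun G hG => ?_
  rw [← Ideal.Quotient.eq_zero_iff_mem]
  apply hinj
  rw [map_zero]
  change Ideal.Quotient.mk I (Λ G) = 0
  rw [Ideal.Quotient.eq_zero_iff_mem, hI, RingHom.mem_ker, hΛ]
  exact hG

theorem span_eq_of_basePointFree {ι : Type*} [Finite ι] {x b : ι → K} (hx : ∀ i, x i ∈ D.S 1)
    (hb : ∀ i, b i ∈ Submodule.span k (Set.range x))
    (hbpf : ∀ y, ∃ i, D.NonvanAt 1 (b i) y) (hker : RingHom.ker (ev k x) ≤ RingHom.ker (ev k b)) :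
    Submodule.span k (Set.range b) = Submodule.span k (Set.range x) := by
  have hk := D.ker_ev_eq_of_basePointFree hx hb hbpf hker
  cases nonempty_fintype ι
  have hev : ∀ (y : ι → K) (c : ι → k), ev k y (∑ i, c i • MvPolynomial.X i) =
      C (Fintype.linearCombination k y c) * X := fun y c => by
    rw [map_sum, Fintype.linearCombination_apply, map_sum, Finset.sum_mul]
    refine Finset.sum_congr rfl fun i _ => ?_
    rw [map_smul, ev_X, ← smul_C, smul_mul_assoc]
  have hzero : ∀ (y : ι → K) (c : ι → k), c ∈ LinearMap.ker (Fintype.linearCombination k y) ↔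
      (∑ i, c i • MvPolynomial.X i) ∈ RingHom.ker (ev k y) := fun y c => by
    rw [RingHom.mem_ker, hev, mul_eq_zero, or_iff_left X_ne_zero, C_eq_zero, LinearMap.mem_ker]
  have hker' : LinearMap.ker (Fintype.linearCombination k x) =
      LinearMap.ker (Fintype.linearCombination k b) := by
    ext c
    rw [hzero, hzero, hk]
  have hfin : Module.Finite k (Submodule.span k (Set.range x)) :=
    Module.Finite.span_of_finite k (Set.finite_range x)
  refine Submodule.eq_of_le_of_finrank_eq (Submodule.span_le.2
    (by rintro _ ⟨i, rfl⟩; exact hb i)) ?_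
  have h1 := LinearMap.finrank_range_add_finrank_ker (Fintype.linearCombination k x)
  have h2 := LinearMap.finrank_range_add_finrank_ker (Fintype.linearCombination k b)
  rw [hker', ← h2] at h1
  rw [← Fintype.range_linearCombination, ← Fintype.range_linearCombination]
  exact (Nat.add_right_cancel h1).symm

end PointData

end

section

theorem exists_add_notMem_of_finite {k E : Type*} [Field k] [Infinite k] [AddCommGroup E]
    [Module k E] (U : Submodule k E) (q : E) (T : Set (Submodule k E)) (hT : T.Finite)
    (hU : ∀ p ∈ T, ¬ U ≤ p) : ∃ f ∈ U, ∀ p ∈ T, q + f ∉ p := by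
  classical
  let ev : (k × U) →ₗ[k] E := LinearMap.coprod (LinearMap.toSpanSingleton k E q) U.subtype
  let S : Set (Subspace k (k × U)) :=
    insert (LinearMap.ker (LinearMap.fst k k U)) ((fun p => p.comap ev) '' T)
  have hS : S.Finite := (hT.image _).insert _
  have h1 : ⊤ ∉ hS.toFinset := by
    rw [Set.Finite.mem_toFinset]
    rintro (h | ⟨p, hp, h⟩)
    · have : ((1 : k), (0 : U)) ∈ LinearMap.ker (LinearMap.fst k k U) := h ▸ Submodule.mem_top
      simp at this
    · refine hU p hp fun u hu => ?_
      have : ((0 : k), (⟨u, hu⟩ : U)) ∈ p.comap ev := by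
        simp only at h
        rw [h]; trivial
      simpa [ev] using this
  have h2 := Subspace.biUnion_ne_univ_of_top_notMem h1
  obtain ⟨⟨t, f⟩, hx⟩ := (Set.ne_univ_iff_exists_notMem _).1 h2
  simp only [Set.Finite.mem_toFinset, Set.mem_iUnion, not_exists] at hx
  have ht : t ≠ 0 := fun h => hx _ (Set.mem_insert _ _) (by simp [h])
  refine ⟨t⁻¹ • f, U.smul_mem _ f.2, fun p hp hmem => ?_⟩
  refine hx (p.comap ev) (Set.mem_insert_of_mem _ ⟨p, hp, rfl⟩) ?_
  have : t • (q + t⁻¹ • (f : E)) ∈ p := p.smul_mem _ hmem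
  rw [smul_add, smul_inv_smul₀ ht] at this
  simpa [ev] using this

theorem exists_height_ge {k σ : Type*} [Field k] [Infinite k] [Finite σ]
    (U : Submodule k (MvPolynomial σ k)) (q : σ → MvPolynomial σ k) (s : Finset σ) :
    ∃ g : σ → MvPolynomial σ k, (∀ i, g i - q i ∈ U) ∧
      ∀ P : Ideal (MvPolynomial σ k), P.IsPrime → (∀ i ∈ s, g i ∈ P) → ¬ (U ≤ P.restrictScalars k) →
        (s.card : ℕ∞) ≤ P.height := by
  classical
  induction s using Finset.induction_on with
  | empty => exact ⟨q, by simp, by simp⟩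
  | insert j s hj ih =>
    obtain ⟨g, hgU, hg⟩ := ih
    let I := Ideal.span (g '' s)
    obtain ⟨f, hf, hfT⟩ := exists_add_notMem_of_finite U (q j)
      ((fun P : Ideal (MvPolynomial σ k) => P.restrictScalars k) ''
        {P ∈ I.minimalPrimes | ¬ U ≤ P.restrictScalars k})
      (((Ideal.finite_minimalPrimes_of_isNoetherianRing _ I).subset
        (Set.sep_subset _ _)).image _) (by rintro _ ⟨P, ⟨-, hP⟩, rfl⟩; exact hP)
    refine ⟨Function.update g j (q j + f), fun i => ?_, fun P hP hmem hUP => ?_⟩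
    · by_cases h : i = j
      · subst h; simpa using hf
      · simpa [h] using hgU i
    · have hs : ∀ i ∈ s, g i ∈ P := fun i hi => by
        have := hmem i (Finset.mem_insert_of_mem hi)
        rwa [Function.update_of_ne (fun h : i = j => hj (h ▸ hi))] at this
      have hjP : q j + f ∈ P := by simpa using hmem j (Finset.mem_insert_self _ _)
      have hI : I ≤ P := Ideal.span_le.2 (by rintro _ ⟨i, hi, rfl⟩; exact hs i hi)
      obtain ⟨Q, hQ, hQP⟩ := Ideal.exists_minimalPrimes_le hI
      have hUQ : ¬ U ≤ Q.restrictScalars k := fun h => hUP (h.trans fun x hx => hQP hx)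
      have hjQ : q j + f ∉ Q := hfT _ ⟨Q, ⟨hQ, hUQ⟩, rfl⟩
      have hQp : Q.IsPrime := hQ.1.1
      have h1 := hg Q hQp (fun i hi => hQ.1.2 (Ideal.subset_span ⟨i, hi, rfl⟩)) hUQ
      have hlt : Q < P := lt_of_le_of_ne hQP (fun h => hjQ (h ▸ hjP))
      have h2 := Ideal.height_add_one_le_of_lt_of_isPrime hlt
      rw [Finset.card_insert_of_notMem hj]
      push_cast
      exact (add_le_add_left h1 1).trans h2

/-- Homogeneous prime ideals of a polynomial ring lie in the irrelevant ideal. -/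
theorem homogeneousCore_le_ker_constantCoeff {k σ : Type*} [Field k]
    (P : Ideal (MvPolynomial σ k)) (hP : P.IsPrime) :
    (P.homogeneousCore (MvPolynomial.homogeneousSubmodule σ k)).toIdeal ≤
      RingHom.ker (MvPolynomial.constantCoeff (R := k) (σ := σ)) := by
  intro f hf
  have h0 := (P.homogeneousCore (MvPolynomial.homogeneousSubmodule σ k)).isHomogeneous 0 hf
  have h1 := P.toIdeal_homogeneousCore_le _ h0
  rw [show ((DirectSum.decompose (MvPolynomial.homogeneousSubmodule σ k) f 0 : _) :
    MvPolynomial σ k) = MvPolynomial.homogeneousComponent 0 f from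
    MvPolynomial.decomposition.decompose'_apply f 0, MvPolynomial.homogeneousComponent_zero] at h1
  by_contra h
  refine hP.ne_top (Ideal.eq_top_of_isUnit_mem _ h1 ?_)
  exact (IsUnit.mk0 _ h).map MvPolynomial.C

/-- A general choice of lifts has no common projective zero. -/
theorem exists_homogeneous_radical {k σ : Type*} [Field k] [Infinite k] [Finite σ] {d : ℕ}
    (hd : 1 ≤ d) (U : Submodule k (MvPolynomial σ k))
    (hU : U ≤ MvPolynomial.homogeneousSubmodule σ k d)
    (q : σ → MvPolynomial σ k) (hq : ∀ i, (q i).IsHomogeneous d)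
    (H : ∀ P : Ideal (MvPolynomial σ k), P.IsPrime → (∀ u ∈ U, u ∈ P) → (∀ i, q i ∈ P) →
      ∀ i, MvPolynomial.X i ∈ P) :
    ∃ g : σ → MvPolynomial σ k, (∀ i, (g i).IsHomogeneous d) ∧ (∀ i, g i - q i ∈ U) ∧
      ∀ i, MvPolynomial.X i ∈ (Ideal.span (Set.range g)).radical := by
  classical
  have := Fintype.ofFinite σ
  obtain ⟨g, hgU, hg⟩ := exists_height_ge U q Finset.univ
  have hhom : ∀ i, (g i).IsHomogeneous d := fun i => by
    have := (hU (hgU i) : (g i - q i).IsHomogeneous d).add (hq i)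
    rwa [sub_add_cancel] at this
  refine ⟨g, hhom, hgU, fun i => ?_⟩
  rw [Ideal.radical_eq_sInf, Ideal.mem_sInf]
  rintro P ⟨hP, hPp⟩
  set 𝒜 := MvPolynomial.homogeneousSubmodule σ k
  set Q := (P.homogeneousCore 𝒜).toIdeal with hQ
  have hQp : Q.IsPrime := hPp.homogeneousCore
  have hQP : Q ≤ P := P.toIdeal_homogeneousCore_le 𝒜
  have hgQ : ∀ i, g i ∈ Q := fun i =>
    Ideal.mem_homogeneousCore_of_homogeneous_of_mem ⟨d, hhom i⟩
      (hP (Ideal.subset_span ⟨i, rfl⟩))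
  refine hQP ?_
  by_cases hUQ : U ≤ Q.restrictScalars k
  · refine H Q hQp hUQ (fun i => ?_) i
    have := Q.sub_mem (hgQ i) (hUQ (hgU i))
    rwa [sub_sub_cancel] at this
  · exfalso
    have h1 := hg Q hQp (fun i _ => hgQ i) hUQ
    set M := RingHom.ker (MvPolynomial.constantCoeff (R := k) (σ := σ)) with hM
    have hMp : M.IsPrime := RingHom.ker_isPrime _
    have hQM : Q ≤ M := homogeneousCore_le_ker_constantCoeff P hPp
    have hlt : Q < M := by
      refine lt_of_le_of_ne hQM fun h => hUQ fun u hu => ?_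
      change u ∈ Q
      rw [h, hM, RingHom.mem_ker]
      exact (hU hu : u.IsHomogeneous d).coeff_eq_zero (by simp; omega)
    have h2 := Ideal.height_add_one_le_of_lt_of_isPrime hlt
    have h3 := Ideal.height_le_ringKrullDim_of_isPrime (I := M)
    rw [MvPolynomial.ringKrullDim_of_isNoetherianRing, ringKrullDim_eq_zero_of_field, zero_add,
      Nat.card_eq_fintype_card] at h3
    have h4 : M.height ≤ (Fintype.card σ : ℕ∞) := by exact_mod_cast h3
    have h5 : ((Fintype.card σ : ℕ∞)) + 1 ≤ (Fintype.card σ : ℕ∞) :=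
      (add_le_add_left (by simpa using h1) 1).trans (h2.trans h4)
    have h6 : Fintype.card σ + 1 ≤ Fintype.card σ := by exact_mod_cast h5
    omega

end

section

open Polynomial

namespace PointData

variable {k K P : Type*} [Field k] [Field K] [Algebra k K] (D : PointData k K P)

/-- The point data of the `e`-th power of the line bundle. -/
def veronese (e : ℕ) : PointData k K P where
  reg := D.reg
  τ x := D.τ x ^ e
  τ_ne x := pow_ne_zero _ (D.τ_ne x)
  exists_le := D.exists_le

theorem veronese_S (e m : ℕ) : (D.veronese e).S m = D.S (e * m) := by
  ext σ
  rw [mem_S, mem_S]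
  simp only [veronese, pow_mul]

theorem veronese_nonvanAt (e m : ℕ) (σ : K) (y : P) :
    (D.veronese e).NonvanAt m σ y ↔ D.NonvanAt (e * m) σ y := by
  rw [NonvanAt, NonvanAt]
  simp only [veronese, pow_mul]

/-- Multiplicative lifting of a base point free system of sections to polynomials, for a
line bundle whose section ring is generated in degree one. -/
theorem exists_polynomials_of_generated [Infinite k] {ι : Type*} [Finite ι] (x : ι → K)
    (hx : Submodule.span k (Set.range x) = D.S 1) (hS : ∀ m, D.S (m + 1) ≤ D.S 1 ^ (m + 1))
    {d : ℕ} (hd : 1 ≤ d) (b : ι → K) (hb : ∀ i, b i ∈ D.S d)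
    (hbpf : ∀ y, ∃ i, D.NonvanAt d (b i) y) (hker : RingHom.ker (ev k x) ≤ RingHom.ker (ev k b)) :
    ∃ n, 0 < n ∧ ∃ g : (Fin n → ι) → MvPolynomial (Fin n → ι) k,
      (∀ w, (g w).IsHomogeneous d) ∧
      (∀ w, MvPolynomial.aeval (fun v : Fin n → ι => ∏ p, x (v p)) (g w) = ∏ p, b (w p)) ∧
      ∀ w, MvPolynomial.X w ∈ (Ideal.span (Set.range g)).radical := by
  have hx1 : ∀ i, x i ∈ D.S 1 := fun i => hx ▸ Submodule.subset_span ⟨i, rfl⟩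
  obtain ⟨n, hn, T, hT, hTx⟩ := exists_ker_ev_eq_span (k := k) x
  have hbw : ∀ w : Fin n → ι, ∏ p, b (w p) ∈ D.S (n * d) := fun w => by
    have := D.prod_mem_S Finset.univ (fun p _ => hb (w p))
    simpa using this
  have hq : ∀ w : Fin n → ι, ∃ q : MvPolynomial (Fin n → ι) k, q.IsHomogeneous d ∧
      MvPolynomial.aeval x (wordMap k ι n q) = ∏ p, b (w p) := fun w => by
    obtain ⟨r, hr⟩ := Nat.exists_eq_succ_of_ne_zero (Nat.mul_ne_zero hn.ne' (by omega) : n * d ≠ 0)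
    have h1 := hbw w
    rw [hr] at h1
    have h2 := hS r h1
    rw [← hx, ← Nat.succ_eq_add_one, ← hr, ← map_homogeneousSubmodule_aeval, ← map_wordMap] at h2
    obtain ⟨_, ⟨q, hq, rfl⟩, h⟩ := h2
    exact ⟨q, hq, h⟩
  choose q hq hqb using hq
  have hbpfw : ∀ y, ∃ w : Fin n → ι, D.NonvanAt (n * d) (∏ p, b (w p)) y := fun y => by
    obtain ⟨i, hi⟩ := hbpf y
    refine ⟨fun _ => i, ?_⟩
    rw [Finset.prod_const, Finset.card_univ, Fintype.card_fin, mul_comm]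
    exact hi.pow D n
  have hev : ∀ {m} {G : MvPolynomial (Fin n → ι) k}, G.IsHomogeneous m →
      ev k x (wordMap k ι n G) =
        C (MvPolynomial.aeval x (wordMap k ι n G)) * X ^ (n * m) :=
    fun hG => ev_of_isHomogeneous x (isHomogeneous_wordMap hG)
  let U : Submodule k (MvPolynomial (Fin n → ι) k) :=
    MvPolynomial.homogeneousSubmodule (Fin n → ι) k d ⊓
      LinearMap.ker ((MvPolynomial.aeval x).comp (wordMap k ι n)).toLinearMap
  have hU : ∀ u, u ∈ U ↔ u.IsHomogeneous d ∧ MvPolynomial.aeval x (wordMap k ι n u) = 0 :=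
    fun u => Iff.rfl
  obtain ⟨g, hg, hgU, hgX⟩ := exists_homogeneous_radical hd U inf_le_left q hq (by
    intro p hp hpU hpq w
    have hpU' : ∀ u : MvPolynomial (Fin n → ι) k, u.IsHomogeneous d →
        ev k x (wordMap k ι n u) = 0 → u ∈ p := fun u hu h0 => hpU u ((hU u).2 ⟨hu, by
      rw [hev hu, mul_eq_zero, or_iff_left (pow_ne_zero _ X_ne_zero), C_eq_zero] at h0
      exact h0⟩)
    obtain rfl | hd2 := hd.eq_or_lt
    · have hspan := D.span_eq_of_basePointFree hx1 (fun i => hx ▸ hb i) hbpf hker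
      have h1 : ∏ r, x (w r) ∈ Submodule.span k (Set.range b) ^ n := by
        rw [hspan, span_range_pow]
        exact Submodule.subset_span ⟨w, rfl⟩
      cases nonempty_fintype ι
      rw [span_range_pow, Submodule.mem_span_range_iff_exists_fun] at h1
      obtain ⟨c, hc⟩ := h1
      have h2 : MvPolynomial.X w - ∑ v, c v • q v ∈ p := by
        refine hpU _ ((hU _).2 ⟨(MvPolynomial.isHomogeneous_X k w).sub ?_, ?_⟩)
        · exact (MvPolynomial.homogeneousSubmodule (Fin n → ι) k 1).sum_mem fun v _ =>
            Submodule.smul_mem _ _ (hq v)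
        · rw [map_sub, map_sub, map_sum, map_sum]
          simp_rw [map_smul, hqb]
          rw [hc, aeval_wordMap, MvPolynomial.aeval_X, sub_self]
      have h3 : ∑ v, c v • q v ∈ p := Ideal.sum_mem _ fun v _ => by
        rw [MvPolynomial.smul_eq_C_mul]
        exact Ideal.mul_mem_left _ _ (hpq v)
      simpa using add_mem h2 h3
    · exact D.X_mem_prime_of_two_le hx1 hn hd2 T hT hTx (fun w => ∏ p, b (w p)) hbw hbpfw q hq
        (fun w => by rw [hev (hq w), hqb]) p hpU' hpq w)
  refine ⟨n, hn, g, hg, fun w => ?_, hgX⟩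
  have := ((hU _).1 (hgU w)).2
  rw [map_sub, map_sub, sub_eq_zero, hqb, aeval_wordMap] at this
  exact this

theorem exists_polynomials [Infinite k] {ι : Type*} [Finite ι] (z : ι → K)
    (hz : ∀ i, z i ∈ D.S 1) (hz0 : ∀ i, z i ≠ 0) (hbpf : ∀ y, ∃ i, D.NonvanAt 1 (z i) y)
    (s : ι → Finset K) (hs : ∀ i, ∀ f ∈ s i, ∃ N, z i ^ N * f ∈ D.S N)
    (hA : ∀ i m, ∀ σ ∈ D.S m, σ / z i ^ m ∈ Algebra.adjoin k (s i : Set K))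
    {d : ℕ} (hd : 1 ≤ d) (Φ : ℕ → K → K) (hΦ : ∀ m, ∀ σ ∈ D.S m, Φ m σ ∈ D.S (m * d))
    (hΦbpf : ∀ m (J : Set K), (∀ σ ∈ J, σ ∈ D.S m) → (∀ y, ∃ σ ∈ J, D.NonvanAt m σ y) →
      ∀ y, ∃ σ ∈ J, D.NonvanAt (m * d) (Φ m σ) y)
    (hΦker : ∀ m (r : ℕ) (x : Fin r → K), (∀ i, x i ∈ D.S m) →
      RingHom.ker (ev k x) ≤ RingHom.ker (ev k fun i => Φ m (x i)))
    (hΦprod : ∀ m n (x : Fin n → K), (∀ i, x i ∈ D.S m) →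
      ∏ i, Φ m (x i) = Φ (m * n) (∏ i, x i)) :
    ∃ e, 0 < e ∧ ∃ (N : ℕ) (v : Fin (N + 1) → K), (∀ i, v i ∈ D.S e) ∧
      (∀ m, D.S (e * (m + 1)) ≤ Submodule.span k (Set.range v) ^ (m + 1)) ∧
      (∀ i, ∃ a, v a = z i ^ e) ∧ ∃ g : Fin (N + 1) → MvPolynomial (Fin (N + 1)) k,
      (∀ i, (g i).IsHomogeneous d) ∧ (∀ i, MvPolynomial.aeval v (g i) = Φ e (v i)) ∧
      ∀ i, MvPolynomial.X i ∈ (Ideal.span (Set.range g)).radical := by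
  classical
  obtain ⟨e, he, ⟨B, hB⟩, hgen⟩ := D.exists_veronese z hz hz0 hbpf s hs hA
  cases nonempty_fintype ι
  obtain ⟨y₀, -⟩ := D.exists_le ⊤ fun c => ValuationSubring.mem_top _
  let B' : Finset K := B ∪ Finset.univ.image fun i => z i ^ e
  have hz' : ∀ i, z i ^ e ∈ D.S e := fun i => by simpa using D.pow_mem_S (hz i) e
  have hB' : Submodule.span k (B' : Set K) = D.S e := by
    refine le_antisymm (Submodule.span_le.2 fun y hy => ?_)
      (hB.symm.trans_le (Submodule.span_mono (by simp [B'])))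
    rw [Finset.mem_coe, Finset.mem_union] at hy
    obtain hy | hy := hy
    · exact hB.le (Submodule.subset_span hy)
    · obtain ⟨i, -, rfl⟩ := Finset.mem_image.1 hy
      exact hz' i
  let x : Fin B'.card → K := fun i => B'.equivFin.symm i
  have hxr : Set.range x = B' := by
    rw [Set.range_comp' Subtype.val, B'.equivFin.symm.range_eq_univ, Set.image_univ,
      Subtype.range_coe]
  have hxe : ∀ i, x i ∈ D.S e := fun i => hB' ▸ Submodule.subset_span (hxr ▸ ⟨i, rfl⟩)
  have hxz : ∀ i, ∃ j, x j = z i ^ e := fun i => by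
    change z i ^ e ∈ Set.range x
    rw [hxr]
    simp [B']
  have hspan : Submodule.span k (Set.range x) = (D.veronese e).S 1 := by
    rw [veronese_S, hxr, hB', mul_one]
  have hzbpf : ∀ y, ∃ σ ∈ Set.range x, D.NonvanAt e σ y := fun y => by
    obtain ⟨i, hi⟩ := hbpf y
    obtain ⟨j, hj⟩ := hxz i
    have := hi.pow D e
    rw [one_mul] at this
    exact ⟨_, ⟨j, rfl⟩, hj ▸ this⟩
  have hS : ∀ m, (D.veronese e).S (m + 1) ≤ (D.veronese e).S 1 ^ (m + 1) := fun m => by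
    rw [veronese_S, veronese_S, mul_one]
    exact hgen m
  obtain ⟨n, hn, g, hg, hgv, hgX⟩ := (D.veronese e).exists_polynomials_of_generated x hspan
    hS hd (fun i => Φ e (x i)) (fun i => by rw [veronese_S]; exact hΦ _ _ (hxe i)) (fun y => by
      obtain ⟨_, ⟨i, rfl⟩, h⟩ := hΦbpf e (Set.range x) (by rintro _ ⟨i, rfl⟩; exact hxe i) hzbpf y
      exact ⟨i, (D.veronese_nonvanAt _ _ _ _).2 h⟩) (hΦker e _ x hxe)
  obtain ⟨_, ⟨i₀, rfl⟩, -⟩ := hzbpf y₀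
  obtain ⟨N, hN⟩ := Nat.exists_eq_succ_of_ne_zero
    (Fintype.card_pos_iff.2 ⟨fun _ => i₀⟩ : 0 < Fintype.card (Fin n → Fin B'.card)).ne'
  let E : (Fin n → Fin B'.card) ≃ Fin (N + 1) := Fintype.equivFinOfCardEq hN
  let v : (Fin n → Fin B'.card) → K := fun w => ∏ p, x (w p)
  have hvr : Set.range (v ∘ E.symm) = Set.range v := E.symm.surjective.range_comp v
  refine ⟨e * n, Nat.mul_pos he hn, N, v ∘ E.symm, fun i => ?_, fun m => ?_, fun i => ?_,
    fun i => MvPolynomial.rename E (g (E.symm i)), fun i => (hg _).rename_isHomogeneous,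
    fun i => ?_, fun i => ?_⟩
  · have := D.prod_mem_S Finset.univ (fun p _ => hxe (E.symm i p))
    simpa [mul_comm] using this
  · rw [hvr, ← span_range_pow, hspan, veronese_S, mul_one, ← pow_mul, mul_assoc]
    obtain ⟨r, hr⟩ := Nat.exists_eq_succ_of_ne_zero (Nat.mul_pos hn m.succ_pos).ne'
    rw [← Nat.succ_eq_add_one m, hr]
    exact hgen r
  · obtain ⟨j, hj⟩ := hxz i
    refine ⟨E fun _ => j, ?_⟩
    simp [v, hj, pow_mul]
  · rw [MvPolynomial.aeval_rename, Function.comp_assoc, E.symm_comp_self, Function.comp_id, hgv]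
    exact hΦprod e n _ fun p => hxe _
  · have h1 := Ideal.mem_map_of_mem (MvPolynomial.rename (R := k) E) (hgX (E.symm i))
    rw [MvPolynomial.rename_X, E.apply_symm_apply] at h1
    refine Ideal.map_radical_le _ |>.trans (Ideal.radical_mono ?_) h1
    rw [Ideal.map_span, Ideal.span_le]
    rintro _ ⟨_, ⟨w, rfl⟩, rfl⟩
    exact Ideal.subset_span ⟨E w, by simp⟩

end PointData

end

section

namespace PointData

variable {k K P : Type*} [Field k] [Field K] [Algebra k K]

/-- A self-map of the point set, together with the restriction of rational functions along it and
an isomorphism of the pullback of the line bundle with its `d`-th power. -/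
structure Pullback (D : PointData k K P) (d : ℕ) where
  φ : P → P
  y : P
  F : D.reg y →ₐ[k] K
  le : ∀ x, D.reg (φ x) ≤ D.reg y
  map_mem : ∀ x f (hf : f ∈ D.reg (φ x)), F ⟨f, le x hf⟩ ∈ D.reg x
  θ : K
  θ_ne : θ ≠ 0
  u : P → (D.reg y)ˣ
  τ_eq : ∀ x, D.τ (φ x) = (u x : D.reg y) * D.τ y
  mem : ∀ x, D.τ x ^ d * θ * (F (u x))⁻¹ ∈ D.reg x
  inv_mem : ∀ x, (D.τ x ^ d * θ * (F (u x))⁻¹)⁻¹ ∈ D.reg x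

namespace Pullback

variable {D : PointData k K P} {d : ℕ} (Q : D.Pullback d)

/-- The pullback structure on a power of the line bundle. -/
def veronese (e : ℕ) : (D.veronese e).Pullback d where
  φ := Q.φ
  y := Q.y
  F := Q.F
  le := Q.le
  map_mem := Q.map_mem
  θ := Q.θ ^ e
  θ_ne := pow_ne_zero _ Q.θ_ne
  u x := Q.u x ^ e
  τ_eq x := by
    change D.τ (Q.φ x) ^ e = ((Q.u x ^ e : (D.reg Q.y)ˣ) : D.reg Q.y) * D.τ Q.y ^ e
    rw [Q.τ_eq, mul_pow, Units.val_pow_eq_pow_val, SubmonoidClass.coe_pow]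
  mem x := by
    change (D.τ x ^ e) ^ d * Q.θ ^ e * (Q.F ((Q.u x ^ e : (D.reg Q.y)ˣ) : D.reg Q.y))⁻¹ ∈ D.reg x
    rw [Units.val_pow_eq_pow_val, map_pow, ← pow_mul, mul_comm e, pow_mul, ← mul_pow, ← inv_pow,
      ← mul_pow]
    exact pow_mem (Q.mem x) e
  inv_mem x := by
    change ((D.τ x ^ e) ^ d * Q.θ ^ e * (Q.F ((Q.u x ^ e : (D.reg Q.y)ˣ) : D.reg Q.y))⁻¹)⁻¹
      ∈ D.reg x
    rw [Units.val_pow_eq_pow_val, map_pow, ← pow_mul, mul_comm e, pow_mul, ← mul_pow, ← inv_pow,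
      ← mul_pow, ← inv_pow]
    exact pow_mem (Q.inv_mem x) e

open Classical in
/-- The pullback of sections of powers of the line bundle. -/
noncomputable def Φ (m : ℕ) (σ : K) : K :=
  if h : D.τ Q.y ^ m * σ ∈ D.reg Q.y then Q.θ ^ m * Q.F ⟨_, h⟩ else 0

theorem mem_reg_y {m : ℕ} {σ : K} (hσ : σ ∈ D.S m) : D.τ Q.y ^ m * σ ∈ D.reg Q.y := hσ Q.y

theorem Φ_eq {m : ℕ} {σ : K} (hσ : σ ∈ D.S m) :
    Q.Φ m σ = Q.θ ^ m * Q.F ⟨_, Q.mem_reg_y hσ⟩ := dif_pos _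

theorem F_u_ne (x : P) : Q.F (Q.u x) ≠ 0 := ((Q.u x).isUnit.map Q.F).ne_zero

theorem τ_mul_Φ {m : ℕ} {σ : K} (hσ : σ ∈ D.S m) (x : P) :
    D.τ x ^ (m * d) * Q.Φ m σ = (D.τ x ^ d * Q.θ * (Q.F (Q.u x))⁻¹) ^ m *
      Q.F ⟨_, Q.le x (hσ (Q.φ x))⟩ := by
  have h : (⟨_, Q.le x (hσ (Q.φ x))⟩ : D.reg Q.y) =
      (Q.u x : D.reg Q.y) ^ m * ⟨_, Q.mem_reg_y hσ⟩ := by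
    apply Subtype.ext
    change D.τ (Q.φ x) ^ m * σ = ((Q.u x : D.reg Q.y) ^ m : D.reg Q.y) * (D.τ Q.y ^ m * σ)
    rw [Q.τ_eq, mul_pow, SubmonoidClass.coe_pow, mul_assoc]
  rw [h, map_mul, map_pow, Q.Φ_eq hσ, mul_pow, mul_pow, mul_comm m d, pow_mul, inv_pow]
  have := pow_ne_zero m (Q.F_u_ne x)
  field_simp

theorem Φ_mem {m : ℕ} {σ : K} (hσ : σ ∈ D.S m) : Q.Φ m σ ∈ D.S (m * d) := fun x => by
  rw [Q.τ_mul_Φ hσ]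
  exact mul_mem (pow_mem (Q.mem x) m) (Q.map_mem x _ (hσ (Q.φ x)))

theorem Φ_nonvanAt {m : ℕ} {σ : K} (hσ : σ ∈ D.S m) {x : P} (h : D.NonvanAt m σ (Q.φ x)) :
    D.NonvanAt (m * d) (Q.Φ m σ) x := by
  have h1 : Q.F ⟨_, Q.le x (hσ (Q.φ x))⟩ * Q.F ⟨_, Q.le x h.2⟩ = 1 := by
    rw [← map_mul, ← map_one Q.F]
    congr 1
    exact Subtype.ext (mul_inv_cancel₀ (mul_ne_zero (pow_ne_zero _ (D.τ_ne _)) h.1))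
  have h2 : D.τ x ^ d * Q.θ * (Q.F (Q.u x))⁻¹ ≠ 0 :=
    mul_ne_zero (mul_ne_zero (pow_ne_zero _ (D.τ_ne x)) Q.θ_ne) (inv_ne_zero (Q.F_u_ne x))
  refine ⟨fun h0 => ?_, ?_⟩
  · have := Q.τ_mul_Φ hσ x
    rw [h0, mul_zero] at this
    exact mul_ne_zero (pow_ne_zero m h2) (left_ne_zero_of_mul_eq_one h1) this.symm
  · rw [Q.τ_mul_Φ hσ, mul_inv, ← inv_pow, inv_eq_of_mul_eq_one_right h1]
    exact mul_mem (pow_mem (Q.inv_mem x) m) (Q.map_mem x _ h.2)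

theorem Φ_prod {m n : ℕ} (x : Fin n → K) (hx : ∀ i, x i ∈ D.S m) :
    ∏ i, Q.Φ m (x i) = Q.Φ (m * n) (∏ i, x i) := by
  have h : ∏ i, x i ∈ D.S (m * n) := by
    have := D.prod_mem_S Finset.univ (m := fun _ => m) fun i _ => hx i
    simpa [mul_comm] using this
  rw [Q.Φ_eq h, Finset.prod_congr rfl fun i _ => Q.Φ_eq (hx i), Finset.prod_mul_distrib,
    ← map_prod, Finset.prod_const, Finset.card_univ, Fintype.card_fin, ← pow_mul]
  congr 2
  apply Subtype.ext
  rw [SubmonoidClass.coe_finsetProd]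
  simp [Finset.prod_mul_distrib, pow_mul]

theorem aeval_Φ {ι : Type*} {m n : ℕ} (x : ι → K) (hx : ∀ i, x i ∈ D.S m) {G : MvPolynomial ι k}
    (hG : G.IsHomogeneous n) (h0 : MvPolynomial.aeval x G = 0) :
    MvPolynomial.aeval (fun i => Q.Φ m (x i)) G = 0 := by
  rw [show (fun i => Q.Φ m (x i)) = fun i => Q.θ ^ m * Q.F ⟨_, Q.mem_reg_y (hx i)⟩ from
    funext fun i => Q.Φ_eq (hx i), aeval_mul_of_isHomogeneous _ _ hG]
  have h1 : MvPolynomial.aeval (fun i => (⟨_, Q.mem_reg_y (hx i)⟩ : D.reg Q.y)) G = 0 := by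
    apply Subtype.ext
    have h2 := MvPolynomial.map_aeval (fun i => (⟨_, Q.mem_reg_y (hx i)⟩ : D.reg Q.y))
      (D.reg Q.y).val.toRingHom G
    change ((MvPolynomial.aeval _ G : D.reg Q.y) : K) = 0
    have h3 := MvPolynomial.comp_aeval_apply (R := k)
      (fun i => (⟨_, Q.mem_reg_y (hx i)⟩ : D.reg Q.y)) (D.reg Q.y).val G
    refine h3.trans ((aeval_mul_of_isHomogeneous (D.τ Q.y ^ m) x hG).trans ?_)
    rw [h0, mul_zero]
  have h4 := MvPolynomial.comp_aeval_apply (R := k)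
      (fun i => (⟨_, Q.mem_reg_y (hx i)⟩ : D.reg Q.y)) Q.F G
  rw [h1, map_zero] at h4
  rw [← h4, mul_zero]

theorem ker_ev_le {ι : Type*} (m : ℕ) (x : ι → K) (hx : ∀ i, x i ∈ D.S m) :
    RingHom.ker (ev k x) ≤ RingHom.ker (ev k fun i => Q.Φ m (x i)) := by
  intro G hG
  rw [RingHom.mem_ker] at hG ⊢
  ext n
  rw [coeff_ev, Polynomial.coeff_zero]
  refine Q.aeval_Φ x hx (MvPolynomial.homogeneousComponent_isHomogeneous n G) ?_
  rw [← coeff_ev, hG, Polynomial.coeff_zero]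

end Pullback
end PointData

end

section

namespace AlgebraicGeometry.Scheme

/-- Two `S`-morphisms out of an integral scheme to a separated scheme agree once they agree at
the generic point. -/
theorem hom_ext_fromSpecStalk_genericPoint {X Y : Scheme.{u}} [IsIntegral X] [Y.IsSeparated]
    {f g : X ⟶ Y} (h : X.fromSpecStalk (genericPoint X) ≫ f = X.fromSpecStalk _ ≫ g) : f = g := by
  have h1 : f.toRationalMap = g.toRationalMap := by
    apply RationalMap.eq_of_fromFunctionField_eq
    rw [RationalMap.fromFunctionField_toRationalMap, RationalMap.fromFunctionField_toRationalMap]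
    exact (PartialMap.fromSpecStalkOfMem_toPartialMap f _).trans
      (h.trans (PartialMap.fromSpecStalkOfMem_toPartialMap g _).symm)
  have h2 := PartialMap.toRationalMap_eq_iff.mp h1
  have h3 := (PartialMap.equiv_iff_of_domain_eq_of_isSeparated (S := ⊤_ _)
    (f := f.toPartialMap) (g := g.toPartialMap) rfl).mp h2
  obtain ⟨h5, h4⟩ := (PartialMap.ext_iff _ _).mp h3
  change X.topIso.hom ≫ f = (X.isoOfEq (rfl : (⊤ : X.Opens) = ⊤)).hom ≫ X.topIso.hom ≫ g at h4
  have e : (X.isoOfEq (rfl : (⊤ : X.Opens) = ⊤)).hom = 𝟙 _ := by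
    rw [← cancel_mono (Scheme.Opens.ι _)]; simp
  rw [e, Category.id_comp] at h4
  exact (cancel_epi X.topIso.hom).mp h4

theorem PartialMap.exists_hom_of_domain_eq_top {X Y : Scheme.{u}} (p : X.PartialMap Y)
    (hp : p.domain = ⊤) : ∃ ι : X ⟶ Y, ι.toPartialMap = p := by
  obtain ⟨U, hU, f⟩ := p
  dsimp at hp
  subst hp
  refine ⟨X.topIso.inv ≫ f, PartialMap.ext _ _ rfl ?_⟩
  have e : (X.isoOfEq (rfl : (⊤ : X.Opens) = ⊤)).hom = 𝟙 _ := by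
    rw [← cancel_mono (Scheme.Opens.ι _)]; simp
  change X.topIso.hom ≫ X.topIso.inv ≫ f = (X.isoOfEq (rfl : (⊤ : X.Opens) = ⊤)).hom ≫ f
  rw [e, Iso.hom_inv_id_assoc, Category.id_comp]

theorem exists_hom_of_fromSpecStalk {S X Y : Scheme.{u}} (sX : X ⟶ S) (sY : Y ⟶ S)
    [IsIntegral X] [Y.IsSeparated] [S.IsSeparated] [LocallyOfFiniteType sY]
    (g : ∀ x, Spec (X.presheaf.stalk x) ⟶ Y) (hg : ∀ x, g x ≫ sY = X.fromSpecStalk x ≫ sX)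
    (hcomp : ∀ x, Spec.map (X.presheaf.stalkSpecializes (genericPoint_specializes x)) ≫ g x =
      g (genericPoint X)) :
    ∃ ι : X ⟶ Y, ι ≫ sY = sX ∧ X.fromSpecStalk (genericPoint X) ≫ ι = g (genericPoint X) := by
  let P (x : X) : X.PartialMap Y := PartialMap.ofFromSpecStalk sX sY (g x) (hg x)
  have hP (x) : x ∈ (P x).domain := PartialMap.mem_domain_ofFromSpecStalk sX sY _ _
  have hff (x) : (P x).toRationalMap.fromFunctionField = g (genericPoint X) := by
    rw [RationalMap.fromFunctionField_toRationalMap, ← hcomp x,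
      ← PartialMap.fromSpecStalkOfMem_ofFromSpecStalk sX sY (g x) (hg x)]
    simp only [PartialMap.fromFunctionField, PartialMap.fromSpecStalkOfMem]
    rw [← Category.assoc]
    congr 1
    rw [← cancel_mono (Scheme.Opens.ι _), Category.assoc, Scheme.Opens.fromSpecStalkOfMem_ι,
      Scheme.Opens.fromSpecStalkOfMem_ι, Scheme.SpecMap_stalkSpecializes_fromSpecStalk]
  let r := (P (genericPoint X)).toRationalMap
  have hr (x) : (P x).toRationalMap = r :=
    RationalMap.eq_of_fromFunctionField_eq _ _ ((hff x).trans (hff _).symm)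
  have hdom : r.toPartialMap.domain = ⊤ :=
    top_le_iff.mp fun x _ => RationalMap.mem_domain.mpr ⟨P x, hP x, hr x⟩
  obtain ⟨ι, hι⟩ := PartialMap.exists_hom_of_domain_eq_top _ hdom
  have hη : X.fromSpecStalk (genericPoint X) ≫ ι = g (genericPoint X) := by
    rw [← hff (genericPoint X), ← PartialMap.fromSpecStalkOfMem_toPartialMap,
      ← RationalMap.toRationalMap_toPartialMap (P (genericPoint X)).toRationalMap]
    change _ = (r.toPartialMap).fromFunctionField
    rw [← hι]
  refine ⟨ι, hom_ext_fromSpecStalk_genericPoint ?_, hη⟩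
  rw [← hg, ← hη, Category.assoc]
end AlgebraicGeometry.Scheme

end

section

open LineBundle

namespace AlgebraicGeometry.Scheme

variable (X : Scheme.{u}) [IsIntegral X]

theorem genericPoint_mem {U : X.Opens} {x : X} (hx : x ∈ U) : genericPoint X ∈ U :=
  (genericPoint_specializes x).mem_open U.2 hx

/-- The inclusion of a local ring of an integral scheme into the function field. -/
def stalkToFF (x : X) : X.presheaf.stalk x →+* X.functionField :=
  (X.presheaf.stalkSpecializes (genericPoint_specializes x)).hom

/-- The germ of a section at the generic point. -/
def gen {U : X.Opens} (hU : genericPoint X ∈ U) : Γ(X, U) →+* X.functionField :=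
  (X.presheaf.germ U (genericPoint X) hU).hom

theorem gen_injective {U : X.Opens} (hU : genericPoint X ∈ U) : Function.Injective (X.gen hU) :=
  germ_injective_of_isIntegral _ _ _

theorem stalkToFF_germ {U : X.Opens} {x : X} (hx : x ∈ U) (s : Γ(X, U)) :
    X.stalkToFF x (X.presheaf.germ U x hx s) = X.gen (X.genericPoint_mem hx) s :=
  X.presheaf.germ_stalkSpecializes_apply hx (genericPoint_specializes x) s

theorem stalkToFF_injective (x : X) : Function.Injective (X.stalkToFF x) := by
  rw [injective_iff_map_eq_zero]
  intro a ha
  obtain ⟨U, hx, s, rfl⟩ := X.presheaf.exists_germ_eq a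
  rw [stalkToFF_germ] at ha
  rw [(map_eq_zero_iff _ (X.gen_injective _)).mp ha, map_zero]

theorem gen_sres {U V : X.Opens} (h : V ≤ U) (hV : genericPoint X ∈ V) (s : Γ(X, U)) :
    X.gen hV (sres X h s) = X.gen (h hV) s :=
  X.presheaf.germ_res_apply (homOfLE h) _ hV s

/-- The local ring at a point, inside the function field. -/
def regAt (x : X) : Subring X.functionField := (X.stalkToFF x).range

theorem gen_mem_regAt {U : X.Opens} {x : X} (hx : x ∈ U) (s : Γ(X, U)) :
    X.gen (X.genericPoint_mem hx) s ∈ X.regAt x :=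
  ⟨_, X.stalkToFF_germ hx s⟩

theorem exists_of_mem_regAt {x : X} {f : X.functionField} (hf : f ∈ X.regAt x) :
    ∃ (U : X.Opens) (hx : x ∈ U) (s : Γ(X, U)), X.gen (X.genericPoint_mem hx) s = f := by
  obtain ⟨a, rfl⟩ := hf
  obtain ⟨U, hx, s, rfl⟩ := X.presheaf.exists_germ_eq a
  exact ⟨U, hx, s, (stalkToFF_germ ..).symm⟩

theorem exists_gen_eq {U : X.Opens} (hU : genericPoint X ∈ U) {f : X.functionField}
    (hf : ∀ x ∈ U, f ∈ X.regAt x) : ∃ s : Γ(X, U), X.gen hU s = f := by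
  choose V hV s hs using fun x : U => X.exists_of_mem_regAt (hf x x.2)
  have hη (x : U) : genericPoint X ∈ V x ⊓ U := ⟨X.genericPoint_mem (hV x), hU⟩
  obtain ⟨t, ht, -⟩ := X.sheaf.existsUnique_gluing' (fun x : U => V x ⊓ U) U
    (fun x => homOfLE inf_le_right) (fun x hx => TopologicalSpace.Opens.mem_iSup.mpr
      ⟨⟨x, hx⟩, hV ⟨x, hx⟩, hx⟩) (fun x => sres X inf_le_left (s x)) (by
      intro x y
      have h := (⟨hη x, hη y⟩ : genericPoint X ∈ (V x ⊓ U) ⊓ (V y ⊓ U))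
      apply X.gen_injective h
      refine (X.gen_sres inf_le_left h _).trans (Eq.trans ?_
        (X.gen_sres (inf_le_right : _ ≤ V y ⊓ U) h _).symm)
      rw [gen_sres, gen_sres, hs, hs])
  refine ⟨t, ?_⟩
  have := ht ⟨_, hU⟩
  have h2 := congrArg (X.gen (hη ⟨_, hU⟩)) this
  rw [gen_sres, hs] at h2
  exact (X.gen_sres inf_le_right (hη ⟨_, hU⟩) t).symm.trans h2

theorem mem_basicOpen_iff_gen {U : X.Opens} {x : X} (hx : x ∈ U) (s : Γ(X, U)) :
    x ∈ X.basicOpen s ↔ X.gen (X.genericPoint_mem hx) s ≠ 0 ∧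
      (X.gen (X.genericPoint_mem hx) s)⁻¹ ∈ X.regAt x := by
  rw [X.mem_basicOpen s x hx, ← X.stalkToFF_germ hx]
  constructor
  · rintro hu
    refine ⟨(hu.map (X.stalkToFF x)).ne_zero, ?_⟩
    obtain ⟨u, hu⟩ := hu
    rw [← hu]
    refine ⟨(u⁻¹ : (X.presheaf.stalk x)ˣ), ?_⟩
    refine eq_inv_of_mul_eq_one_left ?_
    rw [← map_mul, Units.inv_mul, map_one]
  · rintro ⟨h0, b, hb⟩
    refine IsUnit.of_mul_eq_one b (X.stalkToFF_injective x ?_)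
    rw [map_mul, map_one, hb, mul_inv_cancel₀ h0]

variable {X}

/-- The scalars in the local ring of a scheme over a field. -/
def stalkScalars {k : Type u} [Field k] {X : Scheme.{u}} (sX : X ⟶ Spec (CommRingCat.of k))
    (x : X) : k →+* X.presheaf.stalk x :=
  (X.presheaf.germ ⊤ x trivial).hom.comp (toSections sX ⊤)

theorem fromSpecStalk_comp_str {k : Type u} [Field k] {X : Scheme.{u}}
    (sX : X ⟶ Spec (CommRingCat.of k)) (x : X) :
    X.fromSpecStalk x ≫ sX = Spec.map (CommRingCat.ofHom (stalkScalars sX x)) := by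
  have h1 : sX = X.toSpecΓ ≫ Spec.map ((Scheme.ΓSpecIso (CommRingCat.of k)).inv ≫ sX.appTop) := by
    rw [Spec.map_comp, ← Scheme.toSpecΓ_naturality_assoc]
    simp [toSpecΓ_SpecMap_ΓSpecIso_inv]
  conv_lhs => rw [h1]
  rw [Scheme.fromSpecStalk_toSpecΓ_assoc, ← Spec.map_comp]
  congr 1
  ext c
  change X.presheaf.germ ⊤ x trivial _ = X.presheaf.germ ⊤ x trivial (sres X _ _)
  congr 1
  have h := congrArg (fun f => f.hom) (X.presheaf.map_id (op ⊤))
  exact (RingHom.congr_fun h _).symm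

theorem stalkToFF_stalkScalars {k : Type u} [Field k] (sX : X ⟶ Spec (CommRingCat.of k)) (x : X)
    (c : k) : X.stalkToFF x (stalkScalars sX x c) = stalkScalars sX (genericPoint X) c :=
  stalkToFF_germ ..

theorem gen_toSections {k : Type u} [Field k] (sX : X ⟶ Spec (CommRingCat.of k)) {U : X.Opens}
    (hU : genericPoint X ∈ U) (c : k) :
    X.gen hU (toSections sX U c) = stalkScalars sX (genericPoint X) c := by
  rw [← sres_toSections sX le_top, gen_sres]
  rfl

end AlgebraicGeometry.Scheme

end

section

open LineBundle

namespace AlgebraicGeometry.Scheme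

variable {X : Scheme.{u}} [IsIntegral X]

/-- Every valuation ring of the function field of a proper integral scheme dominates the local
ring of some point. -/
theorem exists_regAt_le {k : Type u} [Field k] (sX : X ⟶ Spec (CommRingCat.of k)) [IsProper sX]
    (V : ValuationSubring X.functionField)
    (hV : ∀ c : k, stalkScalars sX (genericPoint X) c ∈ V) :
    ∃ x, ∀ f ∈ X.regAt x, f ∈ V := by
  let ρ : k →+* V := (stalkScalars sX (genericPoint X)).codRestrict V.toSubring hV
  have hex : ValuativeCriterion.Existence sX := by
    have : UniversallyClosed sX := inferInstance
    rw [UniversallyClosed.eq_valuativeCriterion] at this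
    exact this.1
  let incl : CommRingCat.of V ⟶ X.functionField :=
    CommRingCat.ofHom (algebraMap V X.functionField)
  have hc : CommSq (X.fromSpecStalk (genericPoint X)) (Spec.map incl) sX
      (Spec.map (CommRingCat.ofHom ρ)) := by
    refine ⟨(fromSpecStalk_comp_str sX _).trans ?_⟩
    rw [← Spec.map_comp]
    rfl
  let S : ValuativeCommSq sX :=
    { R := V, K := X.functionField, i₁ := X.fromSpecStalk _,
      i₂ := Spec.map (CommRingCat.ofHom ρ), commSq := hc }
  obtain ⟨ℓ, hℓ, -⟩ := (hex S).1
  change Spec.map incl ≫ ℓ =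
    X.fromSpecStalk (genericPoint X) at hℓ
  let x := ℓ (IsLocalRing.closedPoint V)
  have h1 : X.presheaf.stalkSpecializes (genericPoint_specializes x) =
      stalkClosedPointTo (R := CommRingCat.of V) ℓ ≫ incl := by
    apply Spec.map_injective
    rw [← cancel_mono (X.fromSpecStalk x), SpecMap_stalkSpecializes_fromSpecStalk, ← hℓ,
      Spec.map_comp, Category.assoc]
    congr 1
    exact (Spec_stalkClosedPointTo_fromSpecStalk (R := CommRingCat.of V) ℓ).symm
  refine ⟨x, ?_⟩
  rintro f ⟨a, rfl⟩
  rw [stalkToFF, h1]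
  exact (stalkClosedPointTo (R := CommRingCat.of V) ℓ a : V).2

end AlgebraicGeometry.Scheme

namespace LineBundle
open Scheme
variable {X : Scheme.{u}} {L : LineBundle X}

theorem exists_mem (L : LineBundle X) (x : X) : ∃ i, x ∈ L.U i :=
  TopologicalSpace.Opens.mem_iSup.mp (L.covers ▸ TopologicalSpace.Opens.mem_top x)

/-- A chart around a point. -/
def chart (L : LineBundle X) (x : X) : L.ι := (L.exists_mem x).choose

theorem mem_chart (x : X) : x ∈ L.U (L.chart x) := (L.exists_mem x).choose_spec

variable [IsIntegral X] (L)

/-- The transition functions as rational functions. -/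
def gt (i j : L.ι) : X.functionField :=
  open Classical in
  if h : genericPoint X ∈ L.U i ⊓ L.U j then X.gen h (L.t i j) else 1

variable {L}

theorem gt_eq {i j : L.ι} (h : genericPoint X ∈ L.U i ⊓ L.U j) : L.gt i j = X.gen h (L.t i j) :=
  dif_pos h

theorem gt_ne_zero (i j : L.ι) : L.gt i j ≠ 0 := by
  unfold gt
  split_ifs with h
  · exact ((L.t i j).isUnit.map (X.gen h)).ne_zero
  · exact one_ne_zero

theorem gt_mem {x : X} {i j : L.ι} (hi : x ∈ L.U i) (hj : x ∈ L.U j) : L.gt i j ∈ X.regAt x := by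
  rw [gt_eq (X.genericPoint_mem (⟨hi, hj⟩ : x ∈ L.U i ⊓ L.U j))]
  exact X.gen_mem_regAt (⟨hi, hj⟩ : x ∈ L.U i ⊓ L.U j) _

theorem gt_mul {i j l : L.ι} (hi : genericPoint X ∈ L.U i) (hj : genericPoint X ∈ L.U j)
    (hl : genericPoint X ∈ L.U l) : L.gt i j * L.gt j l = L.gt i l := by
  rw [gt_eq ⟨hi, hj⟩, gt_eq ⟨hj, hl⟩, gt_eq ⟨hi, hl⟩]
  have h := congrArg (fun u : (Γ(X, L.U i ⊓ L.U j ⊓ L.U l))ˣ =>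
    X.gen (U := L.U i ⊓ L.U j ⊓ L.U l) ⟨⟨hi, hj⟩, hl⟩ (u : Γ(X, L.U i ⊓ L.U j ⊓ L.U l)))
      (L.cocycle i j l)
  simp only [Units.val_mul, map_mul, Units.coe_map] at h
  refine Eq.trans ?_ (h.trans ?_)
  · exact congrArg₂ _ (X.gen_sres inf_le_left _ _).symm (X.gen_sres (le_inf
      (inf_le_left.trans inf_le_right) inf_le_right : L.U i ⊓ L.U j ⊓ L.U l ≤ L.U j ⊓ L.U l)
      _ (L.t j l : Γ(X, L.U j ⊓ L.U l))).symm
  · exact X.gen_sres (le_inf (inf_le_left.trans inf_le_left) inf_le_right :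
      L.U i ⊓ L.U j ⊓ L.U l ≤ L.U i ⊓ L.U l) _ (L.t i l : Γ(X, L.U i ⊓ L.U l))

theorem gt_self {i : L.ι} (hi : genericPoint X ∈ L.U i) : L.gt i i = 1 :=
  mul_left_cancel₀ (gt_ne_zero i i) ((gt_mul hi hi hi).trans (mul_one _).symm)

theorem gt_inv {i j : L.ι} (hi : genericPoint X ∈ L.U i) (hj : genericPoint X ∈ L.U j) :
    (L.gt i j)⁻¹ = L.gt j i :=
  (eq_inv_of_mul_eq_one_right (by rw [gt_mul hi hj hi, gt_self hi])).symm

theorem gt_pow (n : ℕ) (i j : L.ι) : (L.pow n).gt i j = L.gt i j ^ n := by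
  unfold gt
  split_ifs with h1 h2 h2
  · exact (map_pow _ _ _)
  · exact absurd h1 h2
  · exact absurd h2 h1
  · exact (one_pow n).symm

theorem eta_mem_chart (x : X) : genericPoint X ∈ L.U (L.chart x) :=
  X.genericPoint_mem (mem_chart x)

/-- The pointwise trivialisations of a line bundle, relative to the trivialisation at the generic
point. -/
def tau (L : LineBundle X) (x : X) : X.functionField := L.gt (L.chart x) (L.chart (genericPoint X))

theorem tau_eq {x : X} {i : L.ι} (hi : x ∈ L.U i) :
    L.tau x = L.gt (L.chart x) i * L.gt i (L.chart (genericPoint X)) :=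
  (gt_mul (eta_mem_chart x) (X.genericPoint_mem hi) (eta_mem_chart _)).symm

theorem gt_chart_mem {x : X} {i : L.ι} (hi : x ∈ L.U i) :
    L.gt (L.chart x) i ∈ X.regAt x ∧ (L.gt (L.chart x) i)⁻¹ ∈ X.regAt x :=
  ⟨gt_mem (mem_chart x) hi,
    gt_inv (eta_mem_chart x) (X.genericPoint_mem hi) ▸ gt_mem hi (mem_chart x)⟩

/-- The data of local rings and local trivialisations of a line bundle on a proper variety. -/
def pointData (L : LineBundle X) {k : Type u} [Field k] (sX : X ⟶ Spec (CommRingCat.of k))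
    [IsProper sX] [Algebra k X.functionField]
    (hk : algebraMap k X.functionField = stalkScalars sX (genericPoint X)) :
    PointData k X.functionField X where
  reg x := { X.regAt x with
    algebraMap_mem' := fun c => by
      rw [hk, ← stalkToFF_stalkScalars sX x c]
      exact ⟨_, rfl⟩ }
  τ := L.tau
  τ_ne x := gt_ne_zero _ _
  exists_le V hV := exists_regAt_le sX V (by simpa [hk] using hV)

/-- The rational function defined by a global section, in the trivialisation at the generic
point. -/
def GlobalSec.val {m : ℕ} (σ : GlobalSec (L.pow m)) : X.functionField :=
  X.gen (U := L.U (L.chart (genericPoint X))) (eta_mem_chart _) (σ.s (L.chart (genericPoint X)))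

theorem GlobalSec.gen_s {m : ℕ} (σ : GlobalSec (L.pow m)) {i : L.ι}
    (hi : genericPoint X ∈ L.U i) :
    X.gen (U := L.U i) hi (σ.s i) = L.gt i (L.chart (genericPoint X)) ^ m * σ.val := by
  have hη : genericPoint X ∈ L.U i ⊓ L.U (L.chart (genericPoint X)) := ⟨hi, eta_mem_chart _⟩
  have h := (congrArg (X.gen hη) (σ.compat i (L.chart (genericPoint X)))).trans (map_mul _ _ _)
  rw [gt_eq hη, ← map_pow]
  refine (X.gen_sres inf_le_left hη _).symm.trans (h.trans ?_)
  exact congrArg₂ _ rfl (X.gen_sres inf_le_right hη _)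

theorem GlobalSec.mem_locus {m : ℕ} (σ : GlobalSec (L.pow m)) (x : X) :
    x ∈ σ.locus ↔ σ.val ≠ 0 ∧ (L.tau x ^ m * σ.val)⁻¹ ∈ X.regAt x := by
  have key (i : L.ι) (hi : x ∈ L.U i) : x ∈ X.basicOpen (U := L.U i) (σ.s i) ↔
      σ.val ≠ 0 ∧ (L.tau x ^ m * σ.val)⁻¹ ∈ X.regAt x := by
    refine (X.mem_basicOpen_iff_gen (U := L.U i) hi _).trans ?_
    rw [σ.gen_s, tau_eq hi]
    obtain ⟨h1, h2⟩ := gt_chart_mem hi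
    have h3 := gt_ne_zero (L.chart x) i
    have h4 := gt_ne_zero i (L.chart (genericPoint X))
    refine and_congr (by simp [h4]) ⟨fun h => ?_, fun h => ?_⟩
    · have := mul_mem (pow_mem h2 m) h
      convert this using 1
      rw [mul_pow, mul_assoc, mul_inv, inv_pow]
    · have := mul_mem (pow_mem h1 m) h
      convert this using 1
      rw [mul_pow, mul_assoc, mul_inv _ (_ * _), mul_inv_cancel_left₀ (pow_ne_zero _ h3)]
  refine TopologicalSpace.Opens.mem_iSup.trans ⟨?_, fun h => ⟨_, (key _ (mem_chart x)).mpr h⟩⟩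
  rintro ⟨i, hi⟩
  exact (key i (X.basicOpen_le _ hi)).mp hi

theorem GlobalSec.val_mem {m : ℕ} (σ : GlobalSec (L.pow m)) (x : X) :
    L.tau x ^ m * σ.val ∈ X.regAt x := by
  have := X.gen_mem_regAt (U := L.U (L.chart x)) (mem_chart x) (σ.s (L.chart x))
  rwa [σ.gen_s] at this

end LineBundle

end

section

open LineBundle

namespace AlgebraicGeometry.Scheme
variable {X : Scheme.{u}} [IsIntegral X]

theorem exists_finset_adjoin {k : Type u} [Field k] (sX : X ⟶ Spec (CommRingCat.of k))
    [LocallyOfFiniteType sX] [Algebra k X.functionField]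
    (hk : algebraMap k X.functionField = stalkScalars sX (genericPoint X))
    {W : X.Opens} (hW : IsAffineOpen W) (hη : genericPoint X ∈ W) :
    ∃ s : Finset X.functionField, (∀ f ∈ s, ∀ y ∈ W, f ∈ X.regAt y) ∧
      ∀ f, (∀ y ∈ W, f ∈ X.regAt y) → f ∈ Algebra.adjoin k (s : Set X.functionField) := by
  classical
  have h1 : (sX.appLE ⊤ W le_top).hom.FiniteType :=
    LocallyOfFiniteType.finiteType_appLE sX (isAffineOpen_top _) hW le_top
  have h2 : (toSections sX W).FiniteType := by
    have h3 := h1.comp (RingHom.FiniteType.of_surjective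
      (Scheme.ΓSpecIso (CommRingCat.of k)).inv.hom
      (ConcreteCategory.bijective_of_isIso (Scheme.ΓSpecIso (CommRingCat.of k)).inv).2)
    convert! h3 using 1
  let _ : Algebra k Γ(X, W) := (toSections sX W).toAlgebra
  obtain ⟨S, hS⟩ := h2.1
  let g : Γ(X, W) →ₐ[k] X.functionField :=
    { X.gen hη with
      commutes' := fun c => (gen_toSections sX hη c).trans (by rw [hk]) }
  refine ⟨S.image g, ?_, fun f hf => ?_⟩
  · intro f hf y hy
    obtain ⟨a, -, rfl⟩ := Finset.mem_image.mp hf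
    exact X.gen_mem_regAt hy a
  · obtain ⟨t, rfl⟩ := X.exists_gen_eq hη hf
    rw [Finset.coe_image, ← AlgHom.map_adjoin]
    exact ⟨t, hS ▸ Algebra.mem_top, rfl⟩

end AlgebraicGeometry.Scheme

namespace LineBundle
open Scheme
variable {X : Scheme.{u}} [IsIntegral X] {L : LineBundle X}

theorem GlobalSec.exists_pow_mul_mem_nhds {m : ℕ} (σ : GlobalSec (L.pow m)) (h0 : σ.val ≠ 0)
    {f : X.functionField} (hf : ∀ y ∈ σ.locus, f ∈ X.regAt y) (x : X) :
    ∃ V : X.Opens, x ∈ V ∧ ∃ N, ∀ y ∈ V, ∀ n, N ≤ n → (L.tau y ^ m * σ.val) ^ n * f ∈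
        X.regAt y := by
  obtain ⟨V, hV, hxV, hVU⟩ := exists_isAffineOpen_mem_and_subset (mem_chart (L := L) x)
  have hη : genericPoint X ∈ V := X.genericPoint_mem hxV
  let h : Γ(X, V) := sres X hVU (σ.s (L.chart x))
  have hgen : X.gen hη h = L.gt (L.chart x) (L.chart (genericPoint X)) ^ m * σ.val :=
    (X.gen_sres hVU hη _).trans (σ.gen_s (hVU hη))
  have hle : X.basicOpen h ≤ σ.locus := by
    refine le_trans ?_ (le_iSup (fun i => X.basicOpen (U := L.U i) (σ.s i)) (L.chart x))
    exact (X.basicOpen_res _ _).trans_le inf_le_right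
  have hηD : genericPoint X ∈ X.basicOpen h := by
    have hne : X.basicOpen h ≠ ⊥ := by
      rw [Ne, basicOpen_eq_bot_iff]
      intro h00
      rw [h00, map_zero] at hgen
      exact mul_ne_zero (pow_ne_zero _ (gt_ne_zero _ _)) h0 hgen.symm
    obtain ⟨y, hy⟩ := (TopologicalSpace.Opens.ne_bot_iff_nonempty _).mp hne
    exact X.genericPoint_mem hy
  obtain ⟨g, hg⟩ := X.exists_gen_eq hηD fun y hy => hf y (hle hy)
  obtain ⟨N, b, hb⟩ := exists_eq_pow_mul_of_isAffineOpen X V hV h g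
  have hb2 : X.gen hη b = X.gen hη h ^ N * f := by
    have := congrArg (X.gen hηD) hb
    rw [map_mul, map_pow, hg] at this
    refine (X.gen_sres (X.basicOpen_le h) hηD b).symm.trans (this.trans ?_)
    exact congrArg (fun a => a ^ N * f) (X.gen_sres (X.basicOpen_le h) hηD h)
  refine ⟨V, hxV, N, fun y hy n hn => ?_⟩
  obtain ⟨r, rfl⟩ := Nat.exists_eq_add_of_le hn
  have h1 : L.tau y ^ m * σ.val = L.gt (L.chart y) (L.chart x) ^ m * X.gen hη h := by
    rw [hgen, tau_eq (hVU hy), mul_pow, mul_assoc]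
  have h2 := X.gen_mem_regAt hy b
  rw [hb2] at h2
  have h3 := pow_mem (pow_mem (gt_chart_mem (hVU hy)).1 m) N
  have h4 := mul_mem (pow_mem (σ.val_mem y) r) (mul_mem h3 h2)
  convert h4 using 1
  rw [pow_add, h1, mul_pow]
  ring

theorem GlobalSec.exists_pow_mul_mem [CompactSpace X] {m : ℕ} (σ : GlobalSec (L.pow m))
    (h0 : σ.val ≠ 0) {f : X.functionField} (hf : ∀ y ∈ σ.locus, f ∈ X.regAt y) :
    ∃ N, ∀ y, ∀ n, N ≤ n → (L.tau y ^ m * σ.val) ^ n * f ∈ X.regAt y := by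
  choose V hV N hN using σ.exists_pow_mul_mem_nhds h0 hf
  obtain ⟨t, ht⟩ := isCompact_univ.elim_finite_subcover (fun x => (V x : Set X))
    (fun x => (V x).2) (fun x _ => Set.mem_iUnion.mpr ⟨x, hV x⟩)
  refine ⟨t.sup N, fun y n hn => ?_⟩
  obtain ⟨x, hx, hy⟩ := Set.mem_iUnion₂.mp (ht (Set.mem_univ y))
  exact hN x y hy n ((Finset.le_sup hx).trans hn)

/-- Finitely many sections of a common power of an ample line bundle, with affine
nonvanishing loci covering the scheme. -/
theorem IsAmple.exists_sections (hL : L.IsAmple) {k : Type u} [Field k]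
    (sX : X ⟶ Spec (CommRingCat.of k)) [IsProper sX] [Algebra k X.functionField]
    (hk : algebraMap k X.functionField = stalkScalars sX (genericPoint X)) :
    ∃ M, 0 < M ∧ ∃ (J : Finset X) (z : J → X.functionField) (W : J → X.Opens),
      (∀ i, z i ∈ (L.pointData sX hk).S M) ∧ (∀ i, z i ≠ 0) ∧ (∀ i, IsAffineOpen (W i)) ∧
      (∀ i y, y ∈ W i ↔ (L.pointData sX hk).NonvanAt M (z i) y) ∧ (∀ y, ∃ i, y ∈ W i) ∧
      ∀ i f, (∀ y ∈ W i, f ∈ X.regAt y) → ∃ N, z i ^ N * f ∈ (L.pointData sX hk).S (M * N) := by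
  obtain ⟨_, hL⟩ := hL
  choose m hm σ hσ hW using hL
  obtain ⟨J, hJ⟩ := isCompact_univ.elim_finite_subcover (fun x => ((σ x).locus : Set X))
    (fun x => (σ x).locus.2) (fun x _ => Set.mem_iUnion.mpr ⟨x, hσ x⟩)
  have hdvd (i : J) : m i ∣ ∏ j ∈ J, m j := Finset.dvd_prod_of_mem m i.2
  choose r hr using hdvd
  have hM : 0 < ∏ j ∈ J, m j := Finset.prod_pos fun i _ => hm i
  have hr0 (i : J) : 0 < r i := Nat.pos_of_mul_pos_left (hr i ▸ hM)
  set D := L.pointData sX hk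
  have hne (x) : (σ x).val ≠ 0 := (((σ x).mem_locus x).mp (hσ x)).1
  have hval (i : J) (y : X) : L.tau y ^ (∏ j ∈ J, m j) * (σ i).val ^ r i =
      (L.tau y ^ m i * (σ i).val) ^ r i := by rw [mul_pow, ← pow_mul, ← hr]
  refine ⟨∏ j ∈ J, m j, hM, J, fun i => (σ i).val ^ r i, fun i => (σ i).locus, ?_, ?_, ?_, ?_, ?_,
    ?_⟩
  · intro i y
    change L.tau y ^ _ * _ ∈ X.regAt y
    rw [hval]
    exact pow_mem ((σ i).val_mem y) _
  · exact fun i => pow_ne_zero _ (hne i)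
  · exact fun i => hW i
  · intro i y
    rw [(σ i).mem_locus]
    refine and_congr (by simp [(hr0 i).ne']) ?_
    change _ ↔ (L.tau y ^ _ * _)⁻¹ ∈ X.regAt y
    rw [hval]
    refine ⟨fun h => by rw [← inv_pow]; exact pow_mem h _, fun h => ?_⟩
    have h2 := mul_mem h (pow_mem ((σ i).val_mem y) (r i - 1))
    convert h2 using 1
    have h3 : L.tau y ^ m i * (σ i).val ≠ 0 := mul_ne_zero (pow_ne_zero _ (gt_ne_zero _ _)) (hne _)
    obtain ⟨q, hq⟩ : ∃ q, r i = 1 + q := Nat.exists_eq_add_of_le (hr0 i)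
    rw [hq, Nat.add_sub_cancel_left, pow_add, pow_one, mul_inv (_ * _) (_ ^ q),
      inv_mul_cancel_right₀ (pow_ne_zero _ h3)]
  · intro y
    obtain ⟨x, hx, hy⟩ := Set.mem_iUnion₂.mp (hJ (Set.mem_univ y))
    exact ⟨⟨x, hx⟩, hy⟩
  · intro i f hf
    obtain ⟨N, hN⟩ := (σ i).exists_pow_mul_mem (hne i) hf
    refine ⟨N, fun y => ?_⟩
    change L.tau y ^ _ * _ ∈ X.regAt y
    have := hN y (r i * N) (Nat.le_mul_of_pos_left N (hr0 i))
    convert this using 1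
    rw [← mul_assoc, pow_mul, ← mul_pow, hval, pow_mul]

end LineBundle

end

section

open LineBundle

namespace AlgebraicGeometry.Scheme

variable {X : Scheme.{u}} [IsIntegral X] (φ : X ⟶ X)

/-- Pullback along an endomorphism of rational functions regular at the image of the generic
point. -/
def pullFF : X.regAt (φ (genericPoint X)) →+* X.functionField :=
  (φ.stalkMap (genericPoint X)).hom.comp
    (RingEquiv.ofBijective (X.stalkToFF _).rangeRestrict ⟨fun _ _ h =>
      X.stalkToFF_injective (φ (genericPoint X)) (congrArg Subtype.val h),
      (X.stalkToFF _).rangeRestrict_surjective⟩).symm.toRingHom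

theorem pullFF_stalkToFF (a : X.presheaf.stalk (φ (genericPoint X))) :
    pullFF φ ⟨X.stalkToFF _ a, ⟨a, rfl⟩⟩ = φ.stalkMap (genericPoint X) a := by
  refine congrArg (φ.stalkMap (genericPoint X)).hom ?_
  exact RingEquiv.symm_apply_apply (RingEquiv.ofBijective (X.stalkToFF _).rangeRestrict
    ⟨fun _ _ h => X.stalkToFF_injective (φ (genericPoint X)) (congrArg Subtype.val h),
      (X.stalkToFF _).rangeRestrict_surjective⟩) a

theorem pullFF_gen {U : X.Opens} (hU : φ (genericPoint X) ∈ U) (s : Γ(X, U)) :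
    pullFF φ ⟨X.gen (X.genericPoint_mem hU) s, X.gen_mem_regAt hU s⟩ =
      X.gen (U := φ ⁻¹ᵁ U) hU (φ.app U s) := by
  have h : (⟨X.gen (X.genericPoint_mem hU) s, X.gen_mem_regAt hU s⟩ :
      X.regAt (φ (genericPoint X))) =
      ⟨X.stalkToFF _ (X.presheaf.germ U _ hU s), ⟨_, rfl⟩⟩ :=
    Subtype.ext (X.stalkToFF_germ hU s).symm
  rw [h, pullFF_stalkToFF]
  exact Scheme.Hom.germ_stalkMap_apply φ U (genericPoint X) hU s

theorem map_genericPoint_mem {U : X.Opens} {x : X} (hx : φ x ∈ U) : φ (genericPoint X) ∈ U :=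
  X.genericPoint_mem (U := φ ⁻¹ᵁ U) hx

theorem regAt_map_le (x : X) : X.regAt (φ x) ≤ X.regAt (φ (genericPoint X)) := by
  intro f hf
  obtain ⟨U, hx, s, rfl⟩ := X.exists_of_mem_regAt hf
  exact X.gen_mem_regAt (map_genericPoint_mem φ hx) s

theorem pullFF_mem {x : X} {f : X.functionField} (hf : f ∈ X.regAt (φ x)) :
    pullFF φ ⟨f, regAt_map_le φ x hf⟩ ∈ X.regAt x := by
  obtain ⟨U, hx, s, rfl⟩ := X.exists_of_mem_regAt hf
  rw [pullFF_gen φ (map_genericPoint_mem φ hx)]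
  exact X.gen_mem_regAt (U := φ ⁻¹ᵁ U) hx _

theorem stalkMap_comp_stalkScalars {k : Type u} [Field k] (sX : X ⟶ Spec (CommRingCat.of k))
    (hφ : φ ≫ sX = sX) : (φ.stalkMap (genericPoint X)).hom.comp
      (stalkScalars sX (φ (genericPoint X))) = stalkScalars sX (genericPoint X) := by
  have h : CommRingCat.ofHom (stalkScalars sX (φ (genericPoint X))) ≫
      φ.stalkMap (genericPoint X) = CommRingCat.ofHom (stalkScalars sX (genericPoint X)) := by
    apply Spec.map_injective
    rw [Spec.map_comp, ← fromSpecStalk_comp_str, ← fromSpecStalk_comp_str,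
      Scheme.SpecMap_stalkMap_fromSpecStalk_assoc, hφ]
  exact congrArg (fun f => f.hom) h

theorem pullFF_stalkScalars {k : Type u} [Field k] (sX : X ⟶ Spec (CommRingCat.of k))
    (hφ : φ ≫ sX = sX) (c : k) (h : stalkScalars sX (genericPoint X) c ∈ X.regAt _) :
    pullFF φ ⟨stalkScalars sX (genericPoint X) c, h⟩ = stalkScalars sX (genericPoint X) c := by
  have h1 : (⟨stalkScalars sX (genericPoint X) c, h⟩ : X.regAt (φ (genericPoint X))) =
      ⟨X.stalkToFF _ (stalkScalars sX _ c), ⟨_, rfl⟩⟩ :=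
    Subtype.ext (stalkToFF_stalkScalars sX _ c).symm
  rw [h1, pullFF_stalkToFF]
  exact RingHom.congr_fun (stalkMap_comp_stalkScalars φ sX hφ) c

end AlgebraicGeometry.Scheme

namespace LineBundle
open Scheme
variable {X : Scheme.{u}} [IsIntegral X]

theorem pullFF_gt (φ : X ⟶ X) (L : LineBundle X) {i j : L.ι} (hi : φ (genericPoint X) ∈ L.U i)
    (hj : φ (genericPoint X) ∈ L.U j) :
    pullFF φ ⟨L.gt i j, gt_mem hi hj⟩ = (pullbackLB φ L).gt i j := by
  have hU : φ (genericPoint X) ∈ L.U i ⊓ L.U j := ⟨hi, hj⟩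
  have h : (⟨L.gt i j, gt_mem hi hj⟩ : X.regAt (φ (genericPoint X))) =
      ⟨X.gen (X.genericPoint_mem hU) (L.t i j), X.gen_mem_regAt hU _⟩ :=
    Subtype.ext (gt_eq _)
  refine (congrArg (pullFF φ) h).trans ((pullFF_gen φ hU _).trans ?_)
  have h2 : genericPoint X ∈ (pullbackLB φ L).U i ⊓ (pullbackLB φ L).U j := ⟨hi, hj⟩
  rw [gt_eq h2]
  exact (X.gen_sres (preimage_inf φ (L.U i) (L.U j)).ge h2
    (φ.app (L.U i ⊓ L.U j) (L.t i j))).symm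

theorem EquivLB.exists_gt {L M : LineBundle X} (h : L.EquivLB M) :
    ∃ (a : X → L.ι) (b : X → M.ι) (σ : X → X.functionField), (∀ x, x ∈ L.U (a x)) ∧
      (∀ x, x ∈ M.U (b x)) ∧ (∀ x, σ x ≠ 0) ∧ (∀ x, σ x ∈ X.regAt x) ∧
      (∀ x, (σ x)⁻¹ ∈ X.regAt x) ∧
      ∀ x x', L.gt (a x) (a x') * σ x' = σ x * M.gt (b x) (b x') := by
  obtain ⟨κ, V, hV, a, b, ha, hb, s, h⟩ := h
  choose c hc using fun x : X =>
    TopologicalSpace.Opens.mem_iSup.mp (hV ▸ TopologicalSpace.Opens.mem_top x)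
  have hη x : genericPoint X ∈ V (c x) := X.genericPoint_mem (hc x)
  refine ⟨fun x => a (c x), fun x => b (c x), fun x => X.gen (hη x) (s (c x)),
    fun x => ha _ (hc x), fun x => hb _ (hc x),
    fun x => ((s (c x)).isUnit.map (X.gen (hη x))).ne_zero, fun x => X.gen_mem_regAt (hc x) _,
    fun x => ?_, fun x x' => ?_⟩
  · rw [← map_units_inv]
    exact X.gen_mem_regAt (hc x) _
  · have hx : genericPoint X ∈ V (c x) ⊓ V (c x') := ⟨hη x, hη x'⟩
    have h1 := congrArg (fun u : (Γ(X, V (c x) ⊓ V (c x')))ˣ => X.gen hx u) (h (c x) (c x'))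
    simp only [Units.val_mul, map_mul] at h1
    rw [gt_eq ⟨ha _ (hη x), ha _ (hη x')⟩, gt_eq ⟨hb _ (hη x), hb _ (hη x')⟩]
    refine Eq.trans ?_ (h1.trans ?_)
    · exact congrArg₂ _ (X.gen_sres (le_inf (inf_le_left.trans (ha _))
        (inf_le_right.trans (ha _))) hx
        _).symm (X.gen_sres inf_le_right hx _).symm
    · exact congrArg₂ _ (X.gen_sres inf_le_left hx _) (X.gen_sres (le_inf
        (inf_le_left.trans (hb _)) (inf_le_right.trans (hb _))) hx _)

/-- An endomorphism of `X` pulling `L` back to its `d`-th power. -/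
def pointDataPullback (L : LineBundle X) {k : Type u} [Field k] (sX : X ⟶ Spec (CommRingCat.of k))
    [IsProper sX] [Algebra k X.functionField]
    (hk : algebraMap k X.functionField = stalkScalars sX (genericPoint X))
    (φ : X ⟶ X) (hφ : φ ≫ sX = sX) {d : ℕ} (h : (pullbackLB φ L).EquivLB (L.pow d)) :
    (L.pointData sX hk).Pullback d := by
  let η := genericPoint X
  let y := φ η
  let a := h.exists_gt.choose
  let b : X → L.ι := h.exists_gt.choose_spec.choose
  let σ := h.exists_gt.choose_spec.choose_spec.choose
  have hh := h.exists_gt.choose_spec.choose_spec.choose_spec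
  have ha : ∀ x, x ∈ (pullbackLB φ L).U (a x) := hh.1
  have hb : ∀ x, x ∈ L.U (b x) := hh.2.1
  have hσ0 : ∀ x, σ x ≠ 0 := hh.2.2.1
  have hσ : ∀ x, σ x ∈ X.regAt x := hh.2.2.2.1
  have hσi : ∀ x, (σ x)⁻¹ ∈ X.regAt x := hh.2.2.2.2.1
  have hab : ∀ x x', (pullbackLB φ L).gt (a x) (a x') * σ x' = σ x * L.gt (b x) (b x') ^ d :=
    fun x x' => (hh.2.2.2.2.2 x x').trans (congrArg (σ x * ·) (gt_pow d _ _))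
  have hc x : x ∈ (pullbackLB φ L).U (L.chart (φ x)) := mem_chart (L := L) (φ x)
  have hyc x : y ∈ L.U (L.chart (φ x)) := map_genericPoint_mem φ (mem_chart (φ x))
  let F : (L.pointData sX hk).reg y →ₐ[k] X.functionField :=
    { pullFF φ with
      commutes' := fun c => by
        have h1 : stalkScalars sX (genericPoint X) c ∈ X.regAt (φ (genericPoint X)) :=
          ⟨_, stalkToFF_stalkScalars sX _ c⟩
        exact (congrArg (pullFF φ) (Subtype.ext (RingHom.congr_fun hk c))).trans
          ((pullFF_stalkScalars φ sX hφ c h1).trans (RingHom.congr_fun hk c).symm) }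
  let u : X → ((L.pointData sX hk).reg y)ˣ := fun x =>
    { val := ⟨L.gt (L.chart (φ x)) (L.chart y), gt_mem (hyc x) (mem_chart y)⟩
      inv := ⟨L.gt (L.chart y) (L.chart (φ x)), gt_mem (mem_chart y) (hyc x)⟩
      val_inv := Subtype.ext ((gt_mul (eta_mem_chart _) (eta_mem_chart _)
        (eta_mem_chart _)).trans (gt_self (eta_mem_chart _)))
      inv_val := Subtype.ext ((gt_mul (eta_mem_chart _) (eta_mem_chart _)
        (eta_mem_chart _)).trans (gt_self (eta_mem_chart _))) }
  let θ := (pullbackLB φ L).gt (a η) (L.chart y) * (σ η)⁻¹ * (L.gt (b η) (L.chart η) ^ d)⁻¹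
  have hFu x : F (u x) = (pullbackLB φ L).gt (L.chart (φ x)) (L.chart y) :=
    pullFF_gt φ L (hyc x) (mem_chart y)
  have key x : L.tau x ^ d * θ * (F (u x))⁻¹ = L.gt (L.chart x) (b x) ^ d *
      ((pullbackLB φ L).gt (L.chart (φ x)) (a x))⁻¹ * (σ x)⁻¹ := by
    have h1 : L.tau x = L.gt (L.chart x) (b x) * L.gt (b x) (b η) * L.gt (b η) (L.chart η) := by
      rw [tau_eq (hb x), mul_assoc, gt_mul (X.genericPoint_mem (hb x)) (hb η) (eta_mem_chart _)]
    have h2 : F (u x) = (pullbackLB φ L).gt (L.chart (φ x)) (a x) *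
        (pullbackLB φ L).gt (a x) (a η) * (pullbackLB φ L).gt (a η) (L.chart y) := by
      rw [hFu, gt_mul (X.genericPoint_mem (hc x)) (X.genericPoint_mem (ha x)) (ha η),
        gt_mul (X.genericPoint_mem (hc x)) (ha η) (hc η)]
    have h3 := hab x η
    have h4 := (eq_mul_inv_iff_mul_eq₀ (hσ0 η)).mpr h3
    rw [h2, h1, h4]
    have := hσ0 x
    have := hσ0 η
    have := gt_ne_zero (L := pullbackLB φ L) (L.chart (φ x)) (a x)
    have := gt_ne_zero (L := pullbackLB φ L) (a η) (L.chart y)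
    have := gt_ne_zero (L := L) (b x) (b η)
    have := gt_ne_zero (L := L) (b η) (L.chart η)
    simp only [θ, mul_pow]
    field_simp
  have hm x := mul_mem (mul_mem (pow_mem (gt_chart_mem (hb x)).1 d)
    (gt_inv (X.genericPoint_mem (hc x)) (X.genericPoint_mem (ha x)) ▸ gt_mem (ha x) (hc x)))
    (hσi x)
  have hmi x := mul_mem (mul_mem (pow_mem (gt_chart_mem (hb x)).2 d) (gt_mem (hc x) (ha x)))
    (hσ x)
  exact
  { φ := φ
    y := y
    F := F
    le := regAt_map_le φ
    map_mem := fun x f hf => pullFF_mem φ hf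
    θ := θ
    θ_ne := mul_ne_zero (mul_ne_zero (gt_ne_zero _ _) (inv_ne_zero (hσ0 _)))
      (inv_ne_zero (pow_ne_zero _ (gt_ne_zero _ _)))
    u := u
    τ_eq := fun x => (gt_mul (eta_mem_chart _) (eta_mem_chart _) (eta_mem_chart _)).symm
    mem := fun x => by
      change L.tau x ^ d * θ * (F (u x))⁻¹ ∈ X.regAt x
      rw [key]
      exact hm x
    inv_mem := fun x => by
      change (L.tau x ^ d * θ * (F (u x))⁻¹)⁻¹ ∈ X.regAt x
      rw [key, mul_inv, mul_inv, inv_inv, inv_inv, ← inv_pow]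
      exact hmi x }

end LineBundle

end

section

section ProjPoint

open HomogeneousLocalization

variable {σ : Type*} {A B C : Type u} [CommRing A] [CommRing B] [CommRing C] [SetLike σ A]
  [AddSubgroupClass σ A] (𝒜 : ℕ → σ) [GradedRing 𝒜]

/-- A ring homomorphism `f` sending `F` to a unit induces a homomorphism on the degree zero part
of the localization away from `F`. -/
def HomogeneousLocalization.Away.evalHom (f : A →+* B) {F : A} (hF : IsUnit (f F)) :
    Away 𝒜 F →+* B :=
  (Localization.awayLift f F hF).comp (algebraMap (Away 𝒜 F) (Localization.Away F))

theorem HomogeneousLocalization.Away.evalHom_mk (f : A →+* B) {F : A} (hF : IsUnit (f F)) {m : ℕ}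
    (hm : F ∈ 𝒜 m) (n : ℕ) (a : A) (ha : a ∈ 𝒜 (n • m)) :
    Away.evalHom 𝒜 f hF (Away.mk 𝒜 hm n a ha) * f F ^ n = f a := by
  have h1 : Localization.mk a (⟨F ^ n, n, rfl⟩ : Submonoid.powers F) *
      algebraMap A (Localization.Away F) (F ^ n) =
      algebraMap A (Localization.Away F) a := by
    rw [Localization.mk_eq_mk']
    exact IsLocalization.mk'_spec _ a (⟨F ^ n, n, rfl⟩ : Submonoid.powers F)
  have h2 := congrArg (Localization.awayLift f F hF) h1
  rw [map_mul] at h2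
  simpa [Away.evalHom, Localization.awayLift, IsLocalization.Away.lift] using h2

theorem HomogeneousLocalization.Away.eq_evalHom {f : A →+* B} {F : A} (hF : IsUnit (f F)) {m : ℕ}
    (hm : F ∈ 𝒜 m) (g : Away 𝒜 F →+* B)
    (hg : ∀ n a (ha : a ∈ 𝒜 (n • m)), g (Away.mk 𝒜 hm n a ha) * f F ^ n = f a) :
    g = Away.evalHom 𝒜 f hF := by
  ext x
  obtain ⟨n, a, ha, rfl⟩ := Away.mk_surjective 𝒜 hm x
  exact (hF.pow n).mul_right_cancel ((hg n a ha).trans (Away.evalHom_mk 𝒜 f hF hm n a ha).symm)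

namespace AlgebraicGeometry.Proj

/-- The point of `Proj 𝒜` determined by a ring homomorphism sending a homogeneous element of
positive degree to a unit. -/
def ptHom (f : A →+* B) {F : A} (hF : IsUnit (f F)) {m : ℕ} (hm : F ∈ 𝒜 m) (h0 : 0 < m) :
    Spec (CommRingCat.of B) ⟶ Proj 𝒜 :=
  Spec.map (CommRingCat.ofHom (Away.evalHom 𝒜 f hF)) ≫ Proj.awayι 𝒜 F hm h0

theorem ptHom_comp (f : A →+* B) {F : A} (hF : IsUnit (f F)) {m : ℕ} (hm : F ∈ 𝒜 m) (h0 : 0 < m)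
    (g : B →+* C) :
    Spec.map (CommRingCat.ofHom g) ≫ ptHom 𝒜 f hF hm h0 =
      ptHom 𝒜 (g.comp f) (F := F) (hF.map g) hm h0 := by
  rw [ptHom, ptHom, ← Category.assoc, ← Spec.map_comp, ← CommRingCat.ofHom_comp,
    Away.eq_evalHom 𝒜 (f := g.comp f) (F := F) (hF.map g) hm (g.comp (Away.evalHom 𝒜 f hF))]
  intro n a ha
  simp only [RingHom.comp_apply, ← map_pow, ← map_mul]
  rw [map_pow, Away.evalHom_mk]

theorem ptHom_mul (f : A →+* B) {F G : A} (hF : IsUnit (f F)) (hG : IsUnit (f G)) {m n : ℕ}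
    (hm : F ∈ 𝒜 m) (h0 : 0 < m) (hn : G ∈ 𝒜 n) (h : IsUnit (f (F * G)))
    (hmn : F * G ∈ 𝒜 (m + n)) (h0' : 0 < m + n) :
    ptHom 𝒜 f h hmn h0' = ptHom 𝒜 f hF hm h0 := by
  rw [ptHom, ptHom, ← Proj.SpecMap_awayMap_awayι 𝒜 hm h0 hn rfl, ← Category.assoc,
    ← Spec.map_comp, ← CommRingCat.ofHom_comp,
    Away.eq_evalHom 𝒜 (f := f) hF hm ((Away.evalHom 𝒜 f h).comp (awayMap 𝒜 hn rfl))]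
  intro r a ha
  rw [RingHom.comp_apply, awayMap_mk]
  have := Away.evalHom_mk 𝒜 f h hmn r (a * G ^ r)
    (by rw [smul_add]; exact SetLike.mul_mem_graded ha (SetLike.pow_mem_graded r hn))
  refine (hG.pow r).mul_right_cancel ?_
  rw [mul_assoc, ← mul_pow, ← map_mul, this, map_mul, map_pow]

theorem ptHom_congr (f : A →+* B) {F G : A} (hF : IsUnit (f F)) (hG : IsUnit (f G)) {m n : ℕ}
    (hm : F ∈ 𝒜 m) (h0 : 0 < m) (hn : G ∈ 𝒜 n) (h0' : 0 < n) :
    ptHom 𝒜 f hF hm h0 = ptHom 𝒜 f hG hn h0' := by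
  have h : IsUnit (f (F * G)) := by rw [map_mul]; exact hF.mul hG
  have h' : IsUnit (f (G * F)) := by rw [map_mul]; exact hG.mul hF
  rw [← ptHom_mul 𝒜 f hF hG hm h0 hn h (SetLike.mul_mem_graded hm hn) (by omega),
    ← ptHom_mul 𝒜 f hG hF hn h0' hm h' (SetLike.mul_mem_graded hn hm) (by omega)]
  congr 1
  · exact mul_comm F G
  · exact add_comm m n

theorem ptHom_scale (f f' : A →+* B) (u : B) {F : A} (hF : IsUnit (f F)) (hF' : IsUnit (f' F))
    (hu : ∀ n, ∀ a ∈ 𝒜 n, f' a = u ^ n * f a) {m : ℕ} (hm : F ∈ 𝒜 m) (h0 : 0 < m) :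
    ptHom 𝒜 f' hF' hm h0 = ptHom 𝒜 f hF hm h0 := by
  rw [ptHom, ptHom, Away.eq_evalHom 𝒜 (f := f') hF' hm (Away.evalHom 𝒜 f hF)]
  intro n a ha
  rw [hu _ _ ha, hu _ _ hm, ← Away.evalHom_mk 𝒜 f hF hm n a ha, mul_pow, ← pow_mul, smul_eq_mul,
    mul_comm m n]
  ring

theorem ptHom_toSpecZero (f : A →+* B) {F : A} (hF : IsUnit (f F)) {m : ℕ} (hm : F ∈ 𝒜 m)
    (h0 : 0 < m) :
    ptHom 𝒜 f hF hm h0 ≫ Proj.toSpecZero 𝒜 =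
      Spec.map (CommRingCat.ofHom (f.comp (algebraMap (𝒜 0) A))) := by
  rw [ptHom, Category.assoc, awayι_toSpecZero, ← Spec.map_comp, ← CommRingCat.ofHom_comp]
  congr 2
  ext a
  have := Away.evalHom_mk 𝒜 f hF hm 0 (a : A) (by simp)
  rw [pow_zero, mul_one] at this
  rw [RingHom.comp_apply, RingHom.comp_apply, SetLike.GradeZero.algebraMap_apply, ← this]
  congr 1
  ext
  simp only [fromZeroRingHom, Away.val_mk, pow_zero]
  rfl

end AlgebraicGeometry.Proj

end ProjPoint

end

section

namespace ProjSpace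

open HomogeneousLocalization

variable {k : Type u} [Field k] {N : ℕ} {B C : Type u} [CommRing B] [CommRing C]

local notation "𝒢" => MvPolynomial.homogeneousSubmodule (Fin (N + 1)) k

theorem X_mem (i : Fin (N + 1)) : (MvPolynomial.X i : MvPolynomial (Fin (N + 1)) k) ∈ 𝒢 1 :=
  MvPolynomial.isHomogeneous_X k i

/-- The point of projective space with given homogeneous coordinates, one of which is a unit. -/
def pt (ρ : k →+* B) (z : Fin (N + 1) → B) (h : ∃ a, IsUnit (z a)) :
    Spec (CommRingCat.of B) ⟶ Proj 𝒢 :=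
  Proj.ptHom 𝒢 (MvPolynomial.eval₂Hom ρ z) (F := MvPolynomial.X h.choose)
    (by simpa using h.choose_spec) (X_mem _) one_pos

theorem pt_eq (ρ : k →+* B) (z : Fin (N + 1) → B) (h : ∃ a, IsUnit (z a))
    {F : MvPolynomial (Fin (N + 1)) k} {m : ℕ} (hF : F ∈ 𝒢 m) (hm : 0 < m)
    (hu : IsUnit (MvPolynomial.eval₂Hom ρ z F)) :
    pt ρ z h = Proj.ptHom 𝒢 (MvPolynomial.eval₂Hom ρ z) hu hF hm :=
  Proj.ptHom_congr ..

theorem pt_comp (ρ : k →+* B) (z : Fin (N + 1) → B) (h : ∃ a, IsUnit (z a)) (g : B →+* C)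
    (h' : ∃ a, IsUnit (g (z a))) :
    Spec.map (CommRingCat.ofHom g) ≫ pt ρ z h = pt (g.comp ρ) (fun i => g (z i)) h' := by
  have e : g.comp (MvPolynomial.eval₂Hom ρ z) =
      MvPolynomial.eval₂Hom (g.comp ρ) fun i => g (z i) := by
    ext <;> simp
  rw [pt, Proj.ptHom_comp]
  simp only [e]
  exact (pt_eq ..).symm

theorem eval₂Hom_smul (ρ : k →+* B) (z : Fin (N + 1) → B) (u : B) {n : ℕ}
    {a : MvPolynomial (Fin (N + 1)) k} (ha : a.IsHomogeneous n) :
    MvPolynomial.eval₂Hom ρ (fun i => u * z i) a = u ^ n * MvPolynomial.eval₂Hom ρ z a := by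
  simp only [MvPolynomial.coe_eval₂Hom, MvPolynomial.eval₂_eq', Finset.mul_sum]
  refine Finset.sum_congr rfl fun e he => ?_
  have := ha (MvPolynomial.mem_support_iff.1 he)
  replace this : ∑ i, e i = n := by
    rw [← this, ← Finsupp.degree_eq_sum, Finsupp.degree_eq_weight_one]
    rfl
  simp only [mul_pow, Finset.prod_mul_distrib, Finset.prod_pow_eq_pow_sum, this]
  ring

theorem pt_smul (ρ : k →+* B) (z w : Fin (N + 1) → B) (u : B) (h : ∃ a, IsUnit (z a))
    (h' : ∃ a, IsUnit (w a)) (hw : ∀ i, w i = u * z i) :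
    pt ρ w h' = pt ρ z h := by
  obtain rfl : w = fun i => u * z i := funext hw
  obtain ⟨a, ha⟩ := h'
  have ha' := isUnit_of_mul_isUnit_right ha
  rw [pt_eq ρ _ ⟨a, ha⟩ (F := MvPolynomial.X a) (X_mem _) one_pos
      (by simpa using ha),
    pt_eq ρ z h (F := MvPolynomial.X a) (X_mem _) one_pos
      (by simpa using ha')]
  exact Proj.ptHom_scale _ _ _ u _ _ (fun n a ha => eval₂Hom_smul ρ z u ha) _ _

theorem pt_str (ρ : k →+* B) (z : Fin (N + 1) → B) (h : ∃ a, IsUnit (z a)) :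
    pt ρ z h ≫ Proj.toSpecZero 𝒢 ≫ Spec.map (CommRingCat.ofHom (degreeZeroInclusion k N)) =
      Spec.map (CommRingCat.ofHom ρ) := by
  rw [pt, ← Category.assoc, Proj.ptHom_toSpecZero, ← Spec.map_comp, ← CommRingCat.ofHom_comp]
  congr 2
  ext c
  simp [degreeZeroInclusion, SetLike.GradeZero.algebraMap_apply]

theorem iSup_basicOpen_X : ⨆ i, Proj.basicOpen 𝒢 (MvPolynomial.X i) = ⊤ := by
  refine Proj.iSup_basicOpen_eq_top' _ _ (fun i => ⟨1, X_mem i⟩) ?_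
  rw [eq_top_iff]
  intro p _
  induction p using MvPolynomial.induction_on with
  | C c =>
    exact Subalgebra.algebraMap_mem _
      (⟨MvPolynomial.C c, MvPolynomial.isHomogeneous_C _ c⟩ : 𝒢 0)
  | add p q hp hq => exact add_mem (hp trivial) (hq trivial)
  | mul_X p i hp => exact mul_mem (hp trivial) (Algebra.subset_adjoin ⟨i, rfl⟩)

end ProjSpace

end

section

namespace ProjSpace

open HomogeneousLocalization

variable {k : Type u} [Field k] {N : ℕ}

local notation "𝒢" => MvPolynomial.homogeneousSubmodule (Fin (N + 1)) k

variable (k N) in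
/-- The structure morphism of projective space, as a morphism out of `Proj`. -/
def strProj : Proj 𝒢 ⟶ Spec (CommRingCat.of k) :=
  Proj.toSpecZero 𝒢 ≫ Spec.map (CommRingCat.ofHom (degreeZeroInclusion k N))

/-- The affine charts given by homogeneous elements without common zero. -/
def awayCover {d : ℕ} (hd : 0 < d) (g : Fin (N + 1) → MvPolynomial (Fin (N + 1)) k)
    (hg : ∀ i, g i ∈ 𝒢 d)
    (hX : ∀ i, MvPolynomial.X i ∈ (Ideal.span (Set.range g)).radical) :
    (Proj 𝒢).AffineOpenCover :=
  have key (x : Proj 𝒢) : ∃ i, x ∈ Proj.basicOpen 𝒢 (g i) := by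
    have hx : x ∈ ⨆ i, Proj.basicOpen 𝒢 (MvPolynomial.X i) := iSup_basicOpen_X.ge trivial
    obtain ⟨a, ha⟩ := TopologicalSpace.Opens.mem_iSup.1 hx
    by_contra! H
    simp only [Proj.mem_basicOpen, not_not] at H ha
    refine ha (x.isPrime.radical_le_iff.2 (Ideal.span_le.2 ?_) (hX a))
    rintro _ ⟨i, rfl⟩
    exact H i
  { I₀ := Fin (N + 1)
    X i := .of (Away 𝒢 (g i))
    f i := Proj.awayι 𝒢 (g i) (hg i) hd
    idx x := (key x).choose
    covers x := by
      change x ∈ (Proj.awayι 𝒢 _ _ _).opensRange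
      rw [Proj.opensRange_awayι]
      exact (key x).choose_spec }

/-- The scalars in the degree zero part of a localization. -/
def awayScalars (F : MvPolynomial (Fin (N + 1)) k) : k →+* Away 𝒢 F :=
  (fromZeroRingHom 𝒢 _).comp (degreeZeroInclusion k N)

/-- The local expression of an endomorphism of projective space given by homogeneous
polynomials. -/
def mapChart {d : ℕ} (g : Fin (N + 1) → MvPolynomial (Fin (N + 1)) k)
    (hg : ∀ i, g i ∈ 𝒢 d) (i : Fin (N + 1)) : Spec (CommRingCat.of (Away 𝒢 (g i))) ⟶ Proj 𝒢 :=
  pt (awayScalars (g i))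
    (fun j => Away.mk 𝒢 (hg i) 1 (g j) (by rw [one_smul]; exact hg j))
    ⟨i, by
      convert! isUnit_one
      ext
      simp [Localization.mk_self_mk]⟩

theorem mapChart_awayMap {d : ℕ} (g : Fin (N + 1) → MvPolynomial (Fin (N + 1)) k)
    (hg : ∀ i, g i ∈ 𝒢 d) (i j : Fin (N + 1)) :
    Spec.map (CommRingCat.ofHom (awayMap 𝒢 (hg j) rfl)) ≫ mapChart g hg i =
      Spec.map (CommRingCat.ofHom (awayMap 𝒢 (hg i) (mul_comm (g i) (g j)))) ≫
        mapChart g hg j := by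
  have hi : IsUnit (awayMap 𝒢 (hg j) rfl (Away.mk 𝒢 (hg i) 1 (g i)
      (by rw [one_smul]; exact hg i))) := by
    refine IsUnit.map _ ?_
    convert! isUnit_one
    ext
    simp [Localization.mk_self_mk]
  have hj : IsUnit (awayMap 𝒢 (hg i) (mul_comm (g i) (g j)) (Away.mk 𝒢 (hg j) 1 (g j)
      (by rw [one_smul]; exact hg j))) := by
    refine IsUnit.map _ ?_
    convert! isUnit_one
    ext
    simp [Localization.mk_self_mk]
  have hs : (awayMap 𝒢 (hg j) rfl).comp (awayScalars (g i)) =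
      (awayMap 𝒢 (hg i) (mul_comm (g i) (g j))).comp (awayScalars (g j)) := by
    ext c
    simp only [awayScalars, RingHom.comp_apply, awayMap_fromZeroRingHom]
  rw [mapChart, mapChart, pt_comp _ _ _ _ ⟨i, hi⟩, pt_comp _ _ _ _ ⟨j, hj⟩]
  simp only [hs]
  refine pt_smul _ _ _ (awayMap 𝒢 (hg j) rfl (Away.mk 𝒢 (hg i) 1 (g j)
      (by rw [one_smul]; exact hg j))) _ _ fun l => ?_
  ext
  simp only [awayMap_mk, val_mul, Away.val_mk, Localization.mk_mul, pow_one,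
    Localization.mk_eq_mk_iff]
  refine Localization.r_iff_exists.2 ⟨1, ?_⟩
  simp
  ring

theorem exists_map {d : ℕ} (g : Fin (N + 1) → MvPolynomial (Fin (N + 1)) k)
    (hg : ∀ i, g i ∈ 𝒢 d) (hd : 0 < d)
    (hX : ∀ i, MvPolynomial.X i ∈ (Ideal.span (Set.range g)).radical) :
    ∃ ψ : Proj 𝒢 ⟶ Proj 𝒢, ψ ≫ strProj k N = strProj k N ∧
      ∀ (K : Type u) [Field K] (ρ : k →+* K) (z : Fin (N + 1) → K) (h : ∃ a, IsUnit (z a)),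
      ∃ h', pt ρ z h ≫ ψ = pt ρ (fun i => MvPolynomial.eval₂Hom ρ z (g i)) h' := by
  let 𝒰 := (awayCover hd g hg hX).openCover
  let ψ : Proj 𝒢 ⟶ Proj 𝒢 := 𝒰.glueMorphisms (mapChart g hg) fun i j => by
    revert i j
    change ∀ i j : Fin (N + 1), _
    intro i j
    change pullback.fst (Proj.awayι 𝒢 (g i) (hg i) hd) (Proj.awayι 𝒢 (g j) (hg j) hd) ≫ _ =
      pullback.snd (Proj.awayι 𝒢 (g i) (hg i) hd) (Proj.awayι 𝒢 (g j) (hg j) hd) ≫ _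
    rw [← Proj.pullbackAwayιIso_hom_SpecMap_awayMap_left 𝒢 (hg i) hd (hg j) hd rfl,
      ← Proj.pullbackAwayιIso_hom_SpecMap_awayMap_right 𝒢 (hg i) hd (hg j) hd rfl, Category.assoc,
      Category.assoc, mapChart_awayMap]
  have hψ (i) : Proj.awayι 𝒢 (g i) (hg i) hd ≫ ψ = mapChart g hg i := 𝒰.ι_glueMorphisms ..
  refine ⟨ψ, ?_, ?_⟩
  · refine 𝒰.hom_ext _ _ ?_
    change ∀ i : Fin (N + 1), _
    intro i
    change Proj.awayι 𝒢 (g i) (hg i) hd ≫ _ = Proj.awayι 𝒢 (g i) (hg i) hd ≫ _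
    rw [← Category.assoc, hψ, mapChart, strProj, pt_str, Proj.awayι_toSpecZero_assoc,
      ← Spec.map_comp]
    rfl
  · intro K _ ρ z h
    obtain ⟨a, ha⟩ := h
    have : ∃ i, MvPolynomial.eval₂Hom ρ z (g i) ≠ 0 := by
      by_contra! H
      have : (Ideal.span (Set.range g)).radical ≤ RingHom.ker (MvPolynomial.eval₂Hom ρ z) := by
        refine (RingHom.ker_isPrime _).radical_le_iff.2 (Ideal.span_le.2 ?_)
        rintro _ ⟨i, rfl⟩
        exact H i
      have := this (hX a)
      rw [RingHom.mem_ker] at this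
      exact ha.ne_zero (by simpa using this)
    obtain ⟨i, hi⟩ := this
    refine ⟨⟨i, hi.isUnit⟩, ?_⟩
    have hmk (j) := Away.evalHom_mk 𝒢 (MvPolynomial.eval₂Hom ρ z) hi.isUnit (hg i) 1 (g j)
      (by rw [one_smul]; exact hg j)
    simp only [pow_one] at hmk
    have hsc : (Away.evalHom 𝒢 (MvPolynomial.eval₂Hom ρ z) hi.isUnit).comp (awayScalars (g i)) =
        ρ := by
      ext c
      have := Away.evalHom_mk 𝒢 (MvPolynomial.eval₂Hom ρ z) hi.isUnit (hg i) 0 (MvPolynomial.C c)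
        (by rw [zero_smul]; exact MvPolynomial.isHomogeneous_C _ c)
      have hC : MvPolynomial.eval₂Hom ρ z (MvPolynomial.C c) = ρ c := by simp
      rw [pow_zero, mul_one] at this
      rw [← hC, ← this, RingHom.comp_apply]
      congr 1
      ext
      simp only [awayScalars, RingHom.comp_apply, fromZeroRingHom, Away.val_mk, pow_zero]
      rfl
    rw [pt_eq ρ z ⟨a, ha⟩ (hg i) hd hi.isUnit, Proj.ptHom, Category.assoc, hψ, mapChart, pt_comp]
    · simp only [hsc]
      refine (pt_smul ρ _ _ (MvPolynomial.eval₂Hom ρ z (g i)) _ _ fun j => ?_).symm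
      rw [← hmk, mul_comm]
    · refine ⟨i, ?_⟩
      have := hmk i
      rw [mul_eq_right₀ hi] at this
      rw [this]
      exact isUnit_one

end ProjSpace

end

section

/-- A closed map that is a preimmersion on the members of an open cover by preimages of opens is a
closed immersion. -/
theorem AlgebraicGeometry.IsClosedImmersion.of_isClosedMap_of_isPreimmersion {X Y : Scheme.{u}}
    (f : X ⟶ Y) (hf : IsClosedMap f) {I : Type*} (Z : I → Scheme.{u}) (g : ∀ i, Z i ⟶ X)
    [∀ i, IsOpenImmersion (g i)] (hg : ∀ x, ∃ i, x ∈ (g i).opensRange) (U : I → Y.Opens)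
    (hU : ∀ i x, x ∈ (g i).opensRange ↔ f x ∈ U i) [∀ i, IsPreimmersion (g i ≫ f)] :
    IsClosedImmersion f where
  stalkMap_surjective x := by
    obtain ⟨i, z, rfl⟩ := hg x
    have h1 := (g i ≫ f).stalkMap_surjective z
    rw [Scheme.Hom.stalkMap_comp] at h1
    intro a
    obtain ⟨b, hb⟩ := h1 ((g i).stalkMap z a)
    refine ⟨b, ?_⟩
    exact (ConcreteCategory.bijective_of_isIso ((g i).stalkMap z)).1 hb
  isClosedEmbedding := by
    refine .of_continuous_injective_isClosedMap f.continuous (fun x x' h => ?_) hf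
    obtain ⟨i, hx⟩ := hg x
    obtain ⟨z', rfl⟩ := (hU i x').mpr (h ▸ (hU i x).mp hx)
    obtain ⟨z, rfl⟩ := hx
    have : (g i ≫ f) z = (g i ≫ f) z' := by simpa using h
    rw [(g i ≫ f).isEmbedding.injective this]

namespace ProjSpace

open HomogeneousLocalization

variable {k : Type u} [Field k] {N : ℕ} {B : Type u} [CommRing B]

local notation "𝒢" => MvPolynomial.homogeneousSubmodule (Fin (N + 1)) k

theorem pt_preimage_basicOpen (ρ : k →+* B) (z : Fin (N + 1) → B) (h : ∃ a, IsUnit (z a))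
    (b : Fin (N + 1)) :
    pt ρ z h ⁻¹ᵁ Proj.basicOpen 𝒢 (MvPolynomial.X b) = PrimeSpectrum.basicOpen (z b) := by
  obtain ⟨a, ha⟩ := id h
  have hu : IsUnit (MvPolynomial.eval₂Hom ρ z (MvPolynomial.X a)) := by simpa using ha
  rw [pt_eq ρ z h (F := MvPolynomial.X a) (X_mem _) one_pos hu, Proj.ptHom,
    Scheme.Hom.comp_preimage,
    Proj.awayι_preimage_basicOpen 𝒢 (X_mem a) one_pos (X_mem b) one_pos]
  refine (PrimeSpectrum.comap_basicOpen _ _).trans ?_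
  have h1 : Away.evalHom 𝒢 (MvPolynomial.eval₂Hom ρ z) hu
      (Away.isLocalizationElem (X_mem a) (X_mem b)) * z a = z b := by
    have := Away.evalHom_mk 𝒢 (MvPolynomial.eval₂Hom ρ z) hu (X_mem a) 1 (MvPolynomial.X b ^ 1)
      (by simpa using X_mem (k := k) b)
    have e1 : MvPolynomial.eval₂Hom ρ z (MvPolynomial.X a) ^ 1 = z a := by simp
    have e2 : MvPolynomial.eval₂Hom ρ z (MvPolynomial.X b ^ 1) = z b := by simp
    rw [e1, e2] at this
    exact this
  have h2 : PrimeSpectrum.basicOpen (z a) = ⊤ :=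
    top_unique fun p _ hz => p.2.ne_top (Ideal.eq_top_of_isUnit_mem _ hz ha)
  rw [← h1, PrimeSpectrum.basicOpen_mul, h2, inf_top_eq]
  rfl

theorem isPreimmersion_pt (ρ : k →+* B) (z : Fin (N + 1) → B) (h : ∃ a, IsUnit (z a))
    {a : Fin (N + 1)} (ha : z a = 1)
    (hs : ∀ f : B, ∃ n, ∃ G ∈ 𝒢 n, MvPolynomial.eval₂Hom ρ z G = f) :
    IsPreimmersion (pt ρ z h) := by
  have hu : IsUnit (MvPolynomial.eval₂Hom ρ z (MvPolynomial.X a)) := by simp [ha]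
  rw [pt_eq ρ z h (F := MvPolynomial.X a) (X_mem _) one_pos hu, Proj.ptHom]
  have : IsClosedImmersion (Spec.map (CommRingCat.ofHom
      (Away.evalHom 𝒢 (MvPolynomial.eval₂Hom ρ z) hu))) := by
    apply IsClosedImmersion.spec_of_surjective
    intro f
    obtain ⟨n, G, hG, rfl⟩ := hs f
    refine ⟨Away.mk 𝒢 (X_mem a) n G (by simpa using hG), ?_⟩
    have := Away.evalHom_mk 𝒢 (MvPolynomial.eval₂Hom ρ z) hu (X_mem a) n G (by simpa using hG)
    simpa [ha] using this
  infer_instance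

theorem degreeZeroInclusion_surjective : Function.Surjective (degreeZeroInclusion k N) := by
  rintro ⟨G, hG⟩
  refine ⟨G.coeff 0, Subtype.ext ?_⟩
  exact (MvPolynomial.totalDegree_eq_zero_iff_eq_C.mp
    (Nat.le_zero.mp (MvPolynomial.IsHomogeneous.totalDegree_le hG))).symm

instance isProper_strProj : IsProper (strProj k N) := by
  have : Algebra.FiniteType (𝒢 0) (MvPolynomial (Fin (N + 1)) k) :=
    have : IsScalarTower k (𝒢 0) (MvPolynomial (Fin (N + 1)) k) :=
      ⟨fun a b c => smul_mul_assoc a (b : MvPolynomial (Fin (N + 1)) k) c⟩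
    Algebra.FiniteType.of_restrictScalars_finiteType k _ _
  have : IsClosedImmersion (Spec.map (CommRingCat.ofHom (degreeZeroInclusion k N))) :=
    IsClosedImmersion.spec_of_surjective _ degreeZeroInclusion_surjective
  unfold strProj
  infer_instance

end ProjSpace

end

section

namespace AlgebraicGeometry.Scheme

theorem hom_ext_of_injective {B K : Type u} [CommRing B] [IsDomain B] [CommRing K] (j : B →+* K)
    (hj : Function.Injective j) {Y : Scheme.{u}} [Y.IsSeparated]
    {f g : Spec (CommRingCat.of B) ⟶ Y}
    (h : Spec.map (CommRingCat.ofHom j) ≫ f = Spec.map (CommRingCat.ofHom j) ≫ g) : f = g := by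
  have : IsDominant (Spec.map (CommRingCat.ofHom j)) :=
    ⟨PrimeSpectrum.denseRange_comap_iff_ker_le_nilRadical j |>.mpr
      (by rw [(RingHom.injective_iff_ker_eq_bot j).mp hj]; exact bot_le)⟩
  exact ext_of_isDominant _ h

variable {X : Scheme.{u}} [IsIntegral X]

theorem stalkToFF_genericPoint (a : X.functionField) : X.stalkToFF (genericPoint X) a = a := by
  have := X.presheaf.stalkSpecializes_refl (genericPoint X)
  exact congrArg (fun f => f.hom a) this

theorem mem_regAt_genericPoint (a : X.functionField) : a ∈ X.regAt (genericPoint X) :=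
  ⟨a, stalkToFF_genericPoint a⟩

theorem isUnit_stalk_iff {x : X} (a : X.presheaf.stalk x) :
    IsUnit a ↔ X.stalkToFF x a ≠ 0 ∧ (X.stalkToFF x a)⁻¹ ∈ X.regAt x := by
  constructor
  · rintro ⟨u, rfl⟩
    refine ⟨(u.isUnit.map (X.stalkToFF x)).ne_zero, (u⁻¹ : (X.presheaf.stalk x)ˣ), ?_⟩
    refine eq_inv_of_mul_eq_one_left ?_
    rw [← map_mul, Units.inv_mul, map_one]
  · rintro ⟨h0, b, hb⟩
    refine IsUnit.of_mul_eq_one b (X.stalkToFF_injective x ?_)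
    rw [map_mul, map_one, hb, mul_inv_cancel₀ h0]

end AlgebraicGeometry.Scheme

namespace ProjSpace
open Scheme
variable {X : Scheme.{u}} [IsIntegral X] {k : Type u} [Field k] {N : ℕ}

local notation "𝒢" => MvPolynomial.homogeneousSubmodule (Fin (N + 1)) k

/-- Rational functions, viewed as sections of a line bundle via local trivialisations, define a
morphism to projective space when they have no common zero. -/
theorem exists_hom_pt (sX : X ⟶ Spec (CommRingCat.of k)) (t : X → X.functionField)
    (ht : ∀ x, t x ≠ 0)
    (v : Fin (N + 1) → X.functionField) (hv : ∀ x i, t x * v i ∈ X.regAt x)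
    (hbpf : ∀ x, ∃ i, v i ≠ 0 ∧ (t x * v i)⁻¹ ∈ X.regAt x) (h0 : ∃ a, IsUnit (v a)) :
    ∃ ι : X ⟶ Proj 𝒢, ι ≫ strProj k N = sX ∧
      X.fromSpecStalk (genericPoint X) ≫ ι = pt (stalkScalars sX (genericPoint X)) v h0 := by
  choose w hw using hv
  have hu (x : X) : ∃ a, IsUnit (w x a) := by
    obtain ⟨a, ha0, ha⟩ := hbpf x
    refine ⟨a, (isUnit_stalk_iff _).mpr ?_⟩
    rw [hw]
    exact ⟨mul_ne_zero (ht x) ha0, ha⟩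
  have hgen (x : X) : Spec.map (X.presheaf.stalkSpecializes (genericPoint_specializes x)) ≫
      pt (stalkScalars sX x) (w x) (hu x) = pt (stalkScalars sX (genericPoint X)) v h0 := by
    have hu' : ∃ a, IsUnit (X.stalkToFF x (w x a)) := (hu x).imp fun a ha => ha.map _
    refine (pt_comp (stalkScalars sX x) (w x) (hu x) (X.stalkToFF x) hu').trans ?_
    have e : (X.stalkToFF x).comp (stalkScalars sX x) = stalkScalars sX (genericPoint X) :=
      RingHom.ext (stalkToFF_stalkScalars sX x)
    simp only [e]
    exact pt_smul _ _ _ (t x) _ _ (hw x)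
  have hη : pt (stalkScalars sX (genericPoint X)) (w (genericPoint X)) (hu _) =
      pt (stalkScalars sX (genericPoint X)) v h0 :=
    pt_smul _ _ _ (t (genericPoint X)) _ _ fun i => by
      rw [← hw, stalkToFF_genericPoint]
  obtain ⟨ι, h1, h2⟩ := exists_hom_of_fromSpecStalk sX (strProj k N)
    (fun x => pt (stalkScalars sX x) (w x) (hu x))
    (fun x => (pt_str (stalkScalars sX x) (w x) (hu x)).trans (fromSpecStalk_comp_str sX x).symm)
    (fun x => (hgen x).trans hη.symm)
  exact ⟨ι, h1, h2.trans hη⟩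

theorem comp_eq_pt {sX : X ⟶ Spec (CommRingCat.of k)} {v : Fin (N + 1) → X.functionField}
    {h0 : ∃ a, IsUnit (v a)} {ι : X ⟶ Proj 𝒢}
    (hι : X.fromSpecStalk (genericPoint X) ≫ ι = pt (stalkScalars sX (genericPoint X)) v h0)
    {B : Type u} [CommRing B] [IsDomain B] (j : B →+* X.functionField) (hj : Function.Injective j)
    (q : Spec (CommRingCat.of B) ⟶ X)
    (hq : Spec.map (CommRingCat.ofHom j) ≫ q = X.fromSpecStalk (genericPoint X)) (ρ : k →+* B)
    (hρ : ∀ c, j (ρ c) = stalkScalars sX (genericPoint X) c) (w : Fin (N + 1) → B)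
    (h : ∃ a, IsUnit (w a)) (c : X.functionField) (hw : ∀ i, j (w i) = c * v i) :
    q ≫ ι = pt ρ w h := by
  apply hom_ext_of_injective j hj
  have h' : ∃ a, IsUnit (j (w a)) := h.imp fun a ha => ha.map _
  rw [← Category.assoc, hq, hι, pt_comp ρ w h j h']
  have e : j.comp ρ = stalkScalars sX (genericPoint X) := RingHom.ext hρ
  simp only [e]
  exact (pt_smul _ _ _ c _ _ hw).symm

theorem fromSpecStalk_comp_eq_pt {sX : X ⟶ Spec (CommRingCat.of k)}
    {v : Fin (N + 1) → X.functionField}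
    {h0 : ∃ a, IsUnit (v a)} {ι : X ⟶ Proj 𝒢}
    (hι : X.fromSpecStalk (genericPoint X) ≫ ι = pt (stalkScalars sX (genericPoint X)) v h0)
    (x : X) (w : Fin (N + 1) → X.presheaf.stalk x) (h : ∃ a, IsUnit (w a)) (c : X.functionField)
    (hw : ∀ i, X.stalkToFF x (w i) = c * v i) :
    X.fromSpecStalk x ≫ ι = pt (stalkScalars sX x) w h :=
  comp_eq_pt hι (X.stalkToFF x) (X.stalkToFF_injective x) (X.fromSpecStalk x)
    (SpecMap_stalkSpecializes_fromSpecStalk (genericPoint_specializes x)) _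
    (stalkToFF_stalkScalars sX x) w h c hw

theorem mem_preimage_basicOpen_iff {sX : X ⟶ Spec (CommRingCat.of k)}
    {v : Fin (N + 1) → X.functionField}
    {h0 : ∃ a, IsUnit (v a)} {ι : X ⟶ Proj 𝒢}
    (t : X → X.functionField) (ht : ∀ x, t x ≠ 0)
    (hv : ∀ x i, t x * v i ∈ X.regAt x)
    (hbpf : ∀ x, ∃ i, v i ≠ 0 ∧ (t x * v i)⁻¹ ∈ X.regAt x)
    (hι : X.fromSpecStalk (genericPoint X) ≫ ι = pt (stalkScalars sX (genericPoint X)) v h0)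
    (x : X) (a : Fin (N + 1)) :
    ι x ∈ Proj.basicOpen 𝒢 (MvPolynomial.X a) ↔ v a ≠ 0 ∧ (t x * v a)⁻¹ ∈ X.regAt x := by
  choose w hw using hv
  have hu (a) : IsUnit (w x a) ↔ v a ≠ 0 ∧ (t x * v a)⁻¹ ∈ X.regAt x := by
    rw [isUnit_stalk_iff, hw]
    simp [ht]
  have hx := fromSpecStalk_comp_eq_pt hι x (w x) ((hbpf x).imp fun a => (hu a).mpr) (t x) (hw x)
  rw [← hu]
  have h1 : ι x = (X.fromSpecStalk x ≫ ι) (IsLocalRing.closedPoint (X.presheaf.stalk x)) :=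
    ((Scheme.Hom.comp_apply _ _ _).trans (congrArg ι Scheme.fromSpecStalk_closedPoint)).symm
  rw [h1, hx]
  change _ ∈ pt (stalkScalars sX x) (w x) _ ⁻¹ᵁ Proj.basicOpen 𝒢 (MvPolynomial.X a) ↔ _
  rw [pt_preimage_basicOpen]
  exact (IsLocalRing.notMem_maximalIdeal (x := w x a))

theorem isClosedImmersion_of {sX : X ⟶ Spec (CommRingCat.of k)} {v : Fin (N + 1) → X.functionField}
    {h0 : ∃ a, IsUnit (v a)} {ι : X ⟶ Proj 𝒢}
    [IsProper sX]
    (t : X → X.functionField) (ht : ∀ x, t x ≠ 0)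
    (hv : ∀ x i, t x * v i ∈ X.regAt x)
    (hbpf : ∀ x, ∃ i, v i ≠ 0 ∧ (t x * v i)⁻¹ ∈ X.regAt x)
    (hs : ι ≫ strProj k N = sX)
    (hι : X.fromSpecStalk (genericPoint X) ≫ ι = pt (stalkScalars sX (genericPoint X)) v h0)
    {J : Type*} (W : J → X.Opens) (hW : ∀ i, IsAffineOpen (W i)) (hWc : ∀ y, ∃ i, y ∈ W i)
    (a : J → Fin (N + 1)) (ha : ∀ i, v (a i) ≠ 0)
    (hWa : ∀ i y, y ∈ W i ↔ (t y * v (a i))⁻¹ ∈ X.regAt y)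
    (hS : ∀ i f, (∀ y ∈ W i, f ∈ X.regAt y) → ∃ n, ∃ G ∈ 𝒢 n,
      MvPolynomial.eval₂Hom (stalkScalars sX (genericPoint X)) v G = f * v (a i) ^ n) :
    IsClosedImmersion ι := by
  have hprop : IsProper ι := by
    have : IsProper (ι ≫ strProj k N) := hs ▸ inferInstance
    exact IsProper.of_comp ι (strProj k N)
  have (i : J) : IsPreimmersion ((hW i).fromSpec ≫ ι) := by
    have hη : genericPoint X ∈ W i := (hWa i _).mpr (mem_regAt_genericPoint _)
    have hr (b) : ∃ s : Γ(X, W i), X.gen hη s = (v (a i))⁻¹ * v b := by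
      refine X.exists_gen_eq hη fun y hy => ?_
      have := mul_mem ((hWa i y).mp hy) (hv y b)
      convert this using 1
      have := ht y
      have := ha i
      field_simp
    choose w hw using hr
    have hw1 : w (a i) = 1 := X.gen_injective hη (by rw [hw, inv_mul_cancel₀ (ha i), map_one])
    have h : ∃ a, IsUnit (w a) := ⟨a i, hw1 ▸ isUnit_one⟩
    have : Nonempty (W i) := ⟨_, hη⟩
    have e := comp_eq_pt (B := Γ(X, W i)) hι (X.gen hη) (X.gen_injective hη) (hW i).fromSpec
      ((hW i).fromSpecStalk_eq_fromSpecStalk hη) (LineBundle.toSections sX (W i))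
        (gen_toSections sX hη) w h
      (v (a i))⁻¹ hw
    rw [e]
    refine isPreimmersion_pt _ w h hw1 fun f => ?_
    obtain ⟨n, G, hG, hGf⟩ := hS i (X.gen hη f) fun y hy => X.gen_mem_regAt hy f
    refine ⟨n, G, hG, X.gen_injective hη ?_⟩
    have h1 : X.gen hη (MvPolynomial.eval₂Hom (LineBundle.toSections sX (W i)) w G) =
        MvPolynomial.eval₂Hom (stalkScalars sX (genericPoint X))
          (fun b => (v (a i))⁻¹ * v b) G := by
      have h2 : (X.gen hη).comp (MvPolynomial.eval₂Hom (LineBundle.toSections sX (W i)) w) =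
          MvPolynomial.eval₂Hom (stalkScalars sX (genericPoint X))
            (fun b => (v (a i))⁻¹ * v b) := by
        ext c
        · simp [gen_toSections]
        · simp [hw]
      exact RingHom.congr_fun h2 G
    rw [h1, eval₂Hom_smul _ _ _ hG, hGf, inv_pow, mul_comm, mul_assoc,
      mul_inv_cancel₀ (pow_ne_zero _ (ha i)), mul_one]
  refine IsClosedImmersion.of_isClosedMap_of_isPreimmersion ι ι.isClosedMap _
    (fun i => (hW i).fromSpec) (fun x => ?_)
    (fun i => Proj.basicOpen 𝒢 (MvPolynomial.X (a i))) fun i x => ?_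
  · obtain ⟨i, hi⟩ := hWc x
    exact ⟨i, by rwa [(hW i).opensRange_fromSpec]⟩
  · rw [(hW i).opensRange_fromSpec, hWa, mem_preimage_basicOpen_iff t ht hv hbpf hι]
    simp [ha]

end ProjSpace

end

section

namespace PointData
variable {k K P : Type*} [Field k] [Field K] [Algebra k K] {D : PointData k K P}

theorem NonvanAt.div_pow_mem {m : ℕ} {z σ : K} {y : P} (hz : D.NonvanAt 1 z y)
    (hσ : σ ∈ D.S m) : σ / z ^ m ∈ D.reg y := by
  have h := mul_mem (hσ y) (pow_mem hz.2 m)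
  have hτ := D.τ_ne y
  have h0 := hz.1
  convert h using 1
  rw [pow_one, inv_pow, mul_pow]
  field_simp

theorem NonvanAt.of_pow {e : ℕ} (he : 0 < e) {z : K} {y : P} (hz : z ∈ D.S 1) (h0 : z ≠ 0)
    (h : (D.τ y ^ e * z ^ e)⁻¹ ∈ D.reg y) : D.NonvanAt 1 z y := by
  refine ⟨h0, ?_⟩
  have h1 := mul_mem (pow_mem (hz y) (e - 1)) h
  have hτ := D.τ_ne y
  obtain ⟨e, rfl⟩ := Nat.exists_eq_add_of_lt he
  convert h1 using 1
  rw [zero_add, pow_one, add_tsub_cancel_right, ← mul_pow, pow_succ]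
  have := pow_ne_zero e (mul_ne_zero hτ h0)
  field_simp

end PointData

namespace LineBundle
open Scheme ProjSpace
variable {X : Scheme.{u}} [IsIntegral X] {k : Type u} [Field k] {N : ℕ}

theorem comp_eq_comp_of_aeval_eq (L : LineBundle X) (sX : X ⟶ Spec (CommRingCat.of k)) [IsProper sX]
    [Algebra k X.functionField]
    (hk : algebraMap k X.functionField = stalkScalars sX (genericPoint X))
    (φ : X ⟶ X) (hφ : φ ≫ sX = sX) {d : ℕ} (h : (pullbackLB φ L).EquivLB (L.pow d))
    {M e : ℕ} {v : Fin (N + 1) → X.functionField}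
    (hv : ∀ i, v i ∈ ((L.pointData sX hk).veronese M).S e)
    (hbpf : ∀ x, ∃ i, ((L.pointData sX hk).veronese M).NonvanAt e (v i) x)
    {h0 : ∃ a, IsUnit (v a)}
    {p : X ⟶ Proj (MvPolynomial.homogeneousSubmodule (Fin (N + 1)) k)}
    (hp : X.fromSpecStalk (genericPoint X) ≫ p = pt (stalkScalars sX (genericPoint X)) v h0)
    {g : Fin (N + 1) → MvPolynomial (Fin (N + 1)) k}
    (hg : ∀ i, MvPolynomial.aeval v (g i) =
      ((L.pointDataPullback sX hk φ hφ h).veronese M).Φ e (v i))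
    {ψ : Proj (MvPolynomial.homogeneousSubmodule (Fin (N + 1)) k) ⟶
      Proj (MvPolynomial.homogeneousSubmodule (Fin (N + 1)) k)}
    (h' : ∃ a, IsUnit (MvPolynomial.eval₂Hom (stalkScalars sX (genericPoint X)) v (g a)))
    (hψ : pt (stalkScalars sX (genericPoint X)) v h0 ≫ ψ = pt (stalkScalars sX (genericPoint X))
      (fun i => MvPolynomial.eval₂Hom (stalkScalars sX (genericPoint X)) v (g i)) h') :
    φ ≫ p = p ≫ ψ := by
  set D := (L.pointData sX hk).veronese M
  set Q := (L.pointDataPullback sX hk φ hφ h).veronese M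
  apply hom_ext_fromSpecStalk_genericPoint
  choose w hw using fun i => (hv i (φ (genericPoint X)))
  have hu : ∃ a, IsUnit (w a) := by
    obtain ⟨a, ha0, ha⟩ := hbpf (φ (genericPoint X))
    refine ⟨a, (isUnit_stalk_iff _).mpr ?_⟩
    have hwa : X.stalkToFF _ (w a) = D.τ (φ (genericPoint X)) ^ e * v a := hw a
    rw [hwa]
    exact ⟨mul_ne_zero (pow_ne_zero _ (D.τ_ne _)) ha0, ha⟩
  have h1 := fromSpecStalk_comp_eq_pt hp _ w hu (D.τ (φ (genericPoint X)) ^ e) hw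
  have hu' : ∃ a, IsUnit ((φ.stalkMap (genericPoint X)).hom (w a)) := hu.imp fun a ha => ha.map _
  have h2 := pt_comp (stalkScalars sX (φ (genericPoint X))) w hu
    (φ.stalkMap (genericPoint X)).hom hu'
  simp only [stalkMap_comp_stalkScalars φ sX hφ] at h2
  refine (Scheme.SpecMap_stalkMap_fromSpecStalk_assoc φ p).symm.trans ?_
  refine (congrArg (Spec.map (φ.stalkMap (genericPoint X)) ≫ ·) h1).trans (h2.trans ?_)
  refine Eq.trans ?_ ((congrArg (· ≫ ψ) hp).trans hψ |>.symm.trans (Category.assoc _ _ _))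
  refine (pt_smul _ _ _ (Q.θ ^ e) _ _ fun i => ?_).symm
  have h3 : MvPolynomial.eval₂Hom (stalkScalars sX (genericPoint X)) v (g i) =
      MvPolynomial.aeval v (g i) := by rw [← hk]; rfl
  refine h3.trans ((hg i).trans ((Q.Φ_eq (hv i)).trans (congrArg (Q.θ ^ e * ·) ?_)))
  have h4 : (⟨D.τ (φ (genericPoint X)) ^ e * v i, hv i _⟩ : X.regAt (φ (genericPoint X))) =
      ⟨X.stalkToFF _ (w i), ⟨w i, rfl⟩⟩ := Subtype.ext (hw i).symm
  exact (congrArg (pullFF φ) h4).trans (pullFF_stalkToFF φ (w i))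

theorem IsAmple.exists_embedding [Infinite k] {L : LineBundle X} (hL : L.IsAmple)
    (sX : X ⟶ Spec (CommRingCat.of k)) [IsProper sX] (φ : X ⟶ X) (hφ : φ ≫ sX = sX) {d : ℕ}
    (hd : 1 ≤ d) (h : (pullbackLB φ L).EquivLB (L.pow d)) :
    ∃ (N : ℕ) (p : X ⟶ Proj (MvPolynomial.homogeneousSubmodule (Fin (N + 1)) k))
      (ψ : Proj (MvPolynomial.homogeneousSubmodule (Fin (N + 1)) k) ⟶
        Proj (MvPolynomial.homogeneousSubmodule (Fin (N + 1)) k)),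
      IsClosedImmersion p ∧ p ≫ strProj k N = sX ∧ ψ ≫ strProj k N = strProj k N ∧
      φ ≫ p = p ≫ ψ := by
  let : Algebra k X.functionField := (stalkScalars sX (genericPoint X)).toAlgebra
  have hk : algebraMap k X.functionField = stalkScalars sX (genericPoint X) := rfl
  obtain ⟨M, -, J, z, W, hz, hz0, hWa, hW, hWc, hWS⟩ := hL.exists_sections sX hk
  set D := (L.pointData sX hk).veronese M with hD
  set Q := (L.pointDataPullback sX hk φ hφ h).veronese M with hQ
  have hS (m : ℕ) : D.S m = (L.pointData sX hk).S (M * m) := PointData.veronese_S _ M m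
  have hz1 i : z i ∈ D.S 1 := by rw [hS, mul_one]; exact hz i
  have hWn i y : y ∈ W i ↔ D.NonvanAt 1 (z i) y := by
    rw [hW, PointData.veronese_nonvanAt, mul_one]
  have hη i : genericPoint X ∈ W i := (hW i _).mpr ⟨hz0 i, mem_regAt_genericPoint _⟩
  have hWS' i f (hf : ∀ y ∈ W i, f ∈ X.regAt y) : ∃ N, z i ^ N * f ∈ D.S N := by
    obtain ⟨N, hN⟩ := hWS i f hf
    exact ⟨N, by rwa [hS]⟩
  choose s hs hsA using fun i => exists_finset_adjoin sX hk (hWa i) (hη i)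
  obtain ⟨e, he, N, v, hv, hvS, hvz, g, hg, hgv, hgX⟩ := D.exists_polynomials z hz1 hz0
    (fun y => (hWc y).imp fun i hi => (hWn i y).mp hi) s
    (fun i f hf => hWS' i f (hs i f hf))
    (fun i m σ hσ => hsA i _ fun y hy => ((hWn i y).mp hy).div_pow_mem hσ)
    hd Q.Φ (fun m σ hσ => Q.Φ_mem hσ)
    (fun m J hJ hJb y => by
      obtain ⟨σ, hσ, hn⟩ := hJb (φ y)
      exact ⟨σ, hσ, Q.Φ_nonvanAt (hJ σ hσ) hn⟩)
    (fun m r x hx => Q.ker_ev_le m x hx) (fun m n x hx => Q.Φ_prod x hx)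
  choose a ha using hvz
  have hbpf y : ∃ i, D.NonvanAt e (v i) y := by
    obtain ⟨i, hi⟩ := hWc y
    refine ⟨a i, ?_⟩
    have := ((hWn i y).mp hi).pow D e
    rwa [one_mul, ← ha] at this
  have hva i : v (a i) ≠ 0 := ha i ▸ pow_ne_zero _ (hz0 i)
  have h0 : ∃ b, IsUnit (v b) := (hbpf (genericPoint X)).imp fun b hb => hb.1.isUnit
  obtain ⟨p, hp, hpη⟩ := exists_hom_pt sX (fun x => D.τ x ^ e)
    (fun x => pow_ne_zero _ (D.τ_ne x)) v (fun x i => hv i x) hbpf h0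
  obtain ⟨ψ, hψ, hψpt⟩ := exists_map g hg hd hgX
  obtain ⟨h', hh⟩ := hψpt X.functionField (stalkScalars sX (genericPoint X)) v h0
  refine ⟨N, p, ψ, ?_, hp, hψ, comp_eq_comp_of_aeval_eq L sX hk φ hφ h hv hbpf hpη hgv h' hh⟩
  refine isClosedImmersion_of (fun x => D.τ x ^ e) (fun x => pow_ne_zero _ (D.τ_ne x))
    (fun x i => hv i x) hbpf hp hpη W hWa hWc a hva (fun i y => ?_) fun i f hf => ?_
  · rw [hWn]
    refine ⟨fun hy => ?_, fun hy => PointData.NonvanAt.of_pow he (hz1 i) (hz0 i) (ha i ▸ hy)⟩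
    have := (hy.pow D e).2
    rwa [one_mul, ← ha] at this
  · obtain ⟨n, hn⟩ := hWS' i f hf
    have h1 : f * v (a i) ^ (n + 1) ∈ D.S (e * (n + 1)) := by
      have h2 := D.mul_mem_S hn (D.pow_mem_S (hz1 i) (e * (n + 1) - n))
      have h3 : n ≤ e * (n + 1) := by nlinarith
      rw [one_mul, Nat.add_sub_cancel' h3] at h2
      convert h2 using 1
      rw [ha, ← pow_mul, mul_right_comm, ← pow_add, Nat.add_sub_cancel' h3, mul_comm]
    have h2 := hvS n h1
    rw [← PointData.map_homogeneousSubmodule_aeval] at h2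
    obtain ⟨G, hG, hGe⟩ := h2
    exact ⟨n + 1, G, hG, hGe⟩

end LineBundle

end

/-- Let `X` be a projective variety over an infinite field `k`, `φ : X → X` a
morphism and `L` an ample line bundle on `X` with `φ*(L) ≅ L^{⊗d}` for some `d ≥ 1`. Then
there is an embedding `ι` of `X` into some projective space `ℙ^N_k` and a morphism
`ψ : ℙ^N_k → ℙ^N_k` with `ψ ∘ ι = ι ∘ φ`. -/
theorem stmt_1 {k : Type u} [Field k] [Infinite k] {X : Scheme.{u}}
    (sX : X ⟶ Spec (CommRingCat.of k)) (hX : IsProjectiveVariety sX)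
    (φ : X ⟶ X) (hφ : φ ≫ sX = sX)
    (L : LineBundle X) (hL : L.IsAmple)
    (d : ℕ) (hd : 1 ≤ d) (hpull : (LineBundle.pullbackLB φ L).EquivLB (L.pow d)) :
    ∃ (N : ℕ) (ι : X ⟶ ProjSpace k N) (ψ : ProjSpace k N ⟶ ProjSpace k N),
      IsClosedImmersion ι ∧ ι ≫ ProjSpace.str k N = sX ∧
      ψ ≫ ProjSpace.str k N = ProjSpace.str k N ∧ φ ≫ ι = ι ≫ ψ := by
  obtain ⟨hXint, n, j, hj, hjs⟩ := hX
  have hstr : IsProper (ProjSpace.str k n) := ProjSpace.isProper_strProj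
  have hprop : IsProper sX := hjs ▸ inferInstance
  exact hL.exists_embedding sX φ hφ hd hpull
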